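/- Let A, B, C, D be integers with gcd(A, B, C, D) = 1 and Δ := A·D − B·C ≠ 0. Then for every ε > 0 there is a constant C = C(ε, A, B, C, D) such that for all integers n ≠ 0 with n² − 4Δ not a perfect square, and all H ≥ 1, |Σ_{H ≤ q < 2H} 𝔖_q(n)| ≤ C · |n|^{3/8} · H^{−1/2} · (|n|·H)^ε. -/

import Mathlib

/-- The Ramanujan sum `c_q(x) = Σ_{r (mod q), gcd(r,q)=1} e^{2πi r x / q}`,
viewed as a function of `x ∈ ℤ/qℤ`. -/
noncomputable def ramanujanSum (q : ℕ) (x : ZMod q) : ℂ :=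
  ∑ r ∈ (Finset.range q).filter (fun r => Nat.Coprime r q),
    Complex.exp (2 * Real.pi * Complex.I * ((r * x.val : ℕ) : ℂ) / q)

/-- The linear form `ℒ(γ) = A·a + B·b + C·c + D·d` on `SL₂(ℤ/qℤ)`. -/
def Lform (A B C D : ℤ) {q : ℕ} (γ : Matrix.SpecialLinearGroup (Fin 2) (ZMod q)) : ZMod q :=
  (A : ZMod q) * γ.1 0 0 + (B : ZMod q) * γ.1 0 1 +
    (C : ZMod q) * γ.1 1 0 + (D : ZMod q) * γ.1 1 1

/-- The singular series term `𝔖_q(n) = |SL₂(ℤ/qℤ)|⁻¹ Σ_{γ ∈ SL₂(ℤ/qℤ)} c_q(ℒ(γ) − n)`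
(a real number), with junk value `0` at `q = 0`. -/
noncomputable def singSeriesTerm (A B C D : ℤ) (q : ℕ) (n : ℤ) : ℝ :=
  if h : q = 0 then 0 else
    haveI : NeZero q := ⟨h⟩
    ((Fintype.card (Matrix.SpecialLinearGroup (Fin 2) (ZMod q)) : ℂ)⁻¹ *
      ∑ γ : Matrix.SpecialLinearGroup (Fin 2) (ZMod q),
        ramanujanSum q (Lform A B C D γ - (n : ZMod q))).re

namespace Stepanov

open Polynomial

/-- The operator `r ↦ e f' r + f r'`, for which `(f ^ e r)' = f ^ (e - 1) (twist f e r)`. -/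
noncomputable def twist {F : Type*} [Field F] (f : F[X]) (e : ℕ) : F[X] →ₗ[F] F[X] where
  toFun r := (e : F[X]) * derivative f * r + f * derivative r
  map_add' r s := by simp only [derivative_add]; ring
  map_smul' c r := by simp only [derivative_smul, RingHom.id_apply, smul_add, mul_smul_comm]

/-- The `i`-fold iterate of `twist` that computes `i`-th derivatives of `f ^ e r`. -/
noncomputable def iterTwist {F : Type*} [Field F] (f : F[X]) (e : ℕ) : ℕ → F[X] →ₗ[F] F[X]
  | 0 => LinearMap.id
  | i + 1 => twist f (e - i) ∘ₗ iterTwist f e i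

lemma iterate_derivative_pow_mul {F : Type*} [Field F] (f r Y : F[X]) (hY : derivative Y = 0)
    (e i : ℕ) (hi : i ≤ e) :
    derivative^[i] (f ^ e * r * Y) = f ^ (e - i) * iterTwist f e i r * Y := by
  induction i with
  | zero => simp [iterTwist]
  | succ i ih =>
    rw [Function.iterate_succ_apply', ih (by omega)]
    obtain ⟨k, hk⟩ : ∃ k, e - i = k + 1 := ⟨e - i - 1, by omega⟩
    have h2 : e - (i + 1) = k := by omega
    rw [h2, iterTwist]
    simp only [derivative_mul, hY, hk, derivative_pow, LinearMap.comp_apply]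
    simp only [twist, LinearMap.coe_mk, AddHom.coe_mk, Nat.cast_add, Nat.cast_one,
      Nat.add_sub_cancel, map_add, map_natCast, map_one]
    ring

lemma natDegree_twist_le {F : Type*} [Field F] (f : F[X]) (hf : f.natDegree ≤ 3) (e : ℕ)
    (r : F[X]) : (twist f e r).natDegree ≤ r.natDegree + 2 := by
  simp only [twist, LinearMap.coe_mk, AddHom.coe_mk]
  have h1 : (derivative f).natDegree ≤ 2 := (natDegree_derivative_le f).trans (by omega)
  refine natDegree_add_le_of_degree_le ?_ ?_
  · refine natDegree_mul_le.trans ?_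
    have : ((e : F[X]) * derivative f).natDegree ≤ 0 + 2 :=
      natDegree_mul_le.trans (add_le_add (by simp) h1)
    omega
  · by_cases hr : r.natDegree = 0
    · have : derivative r = 0 := by
        rw [eq_C_of_natDegree_eq_zero hr, derivative_C]
      simp [this]
    · refine natDegree_mul_le.trans ?_
      have := natDegree_derivative_le r
      omega

lemma natDegree_iterTwist_le {F : Type*} [Field F] (f : F[X]) (hf : f.natDegree ≤ 3) (e i : ℕ)
    (r : F[X]) : (iterTwist f e i r).natDegree ≤ r.natDegree + 2 * i := by
  induction i with
  | zero => simp [iterTwist]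
  | succ i ih =>
    have := natDegree_twist_le f hf (e - i) (iterTwist f e i r)
    simp only [iterTwist, LinearMap.comp_apply]
    omega

/-- The polynomial controlling the values of the `i`-th derivative of the auxiliary polynomial at
the points where `f ^ h = a`. -/
noncomputable def reduction {F : Type*} [Field F] (f : F[X]) (a : F) (e h J i : ℕ) :
    ((Fin J → F[X]) × (Fin J → F[X])) →ₗ[F] F[X] where
  toFun rs := ∑ j, (iterTwist f e i (rs.1 j) + C a * iterTwist f (e + h) i (rs.2 j)) * X ^ (j : ℕ)
  map_add' x y := by
    simp only [Prod.fst_add, Prod.snd_add, Pi.add_apply, map_add, ← Finset.sum_add_distrib]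
    refine Finset.sum_congr rfl fun j _ => ?_
    ring
  map_smul' c x := by
    simp only [Prod.smul_fst, Prod.smul_snd, Pi.smul_apply, map_smul, RingHom.id_apply,
      Finset.smul_sum]
    refine Finset.sum_congr rfl fun j _ => ?_
    simp only [smul_eq_C_mul]
    ring

lemma natDegree_reduction_lt {F : Type*} [Field F] (f : F[X]) (hf : f.natDegree ≤ 3) (a : F)
    (e h J i d : ℕ) (rs : (Fin J → F[X]) × (Fin J → F[X])) (hd : 0 < d)
    (h1 : ∀ j, (rs.1 j).natDegree < d) (h2 : ∀ j, (rs.2 j).natDegree < d) (t : ℕ)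
    (ht : d + 2 * i + J ≤ t) :
    (reduction f a e h J i rs).coeff t = 0 := by
  simp only [reduction, LinearMap.coe_mk, AddHom.coe_mk, finsetSum_coeff]
  refine Finset.sum_eq_zero fun j _ => ?_
  apply coeff_eq_zero_of_natDegree_lt
  refine lt_of_le_of_lt natDegree_mul_le ?_
  have hj := j.2
  have e1 := natDegree_iterTwist_le f hf e i (rs.1 j)
  have e2 := natDegree_iterTwist_le f hf (e + h) i (rs.2 j)
  have h3 : (iterTwist f e i (rs.1 j) + C a * iterTwist f (e + h) i (rs.2 j)).natDegree
      ≤ d - 1 + 2 * i := by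
    refine natDegree_add_le_of_degree_le ?_ ((natDegree_C_mul_le _ _).trans ?_)
    · have := h1 j; omega
    · have := h2 j; omega
  rw [natDegree_X_pow]
  omega

/-- Existence of a nontrivial system of coefficients annihilating all the reductions. -/
lemma exists_coefficients {F : Type*} [Field F] (f : F[X]) (hf : f.natDegree ≤ 3) (a : F)
    (e h J ℓ d : ℕ) (hd : 0 < d) (hcount : ℓ * (d + 2 * ℓ + J) < 2 * (J * d)) :
    ∃ rs : (Fin J → F[X]) × (Fin J → F[X]), rs ≠ 0 ∧ (∀ j, (rs.1 j).natDegree < d) ∧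
      (∀ j, (rs.2 j).natDegree < d) ∧ ∀ i < ℓ, reduction f a e h J i rs = 0 := by
  let ι : (Fin d → F) →ₗ[F] F[X] := (degreeLT F d).subtype ∘ₗ (degreeLTEquiv F d).symm.toLinearMap
  have hι : ∀ c, (ι c).natDegree < d := by
    intro c
    have := ((degreeLTEquiv F d).symm c).2
    rw [mem_degreeLT] at this
    by_cases h0 : ι c = 0
    · rw [h0]; simpa using hd
    · exact (natDegree_lt_iff_degree_lt h0).2 this
  have hinj : Function.Injective ι := by
    intro x y hxy
    exact (degreeLTEquiv F d).symm.injective (Subtype.ext hxy)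
  let κ : ((Fin J → Fin d → F) × (Fin J → Fin d → F)) →ₗ[F] ((Fin J → F[X]) × (Fin J → F[X])) :=
    LinearMap.prodMap (LinearMap.pi fun j => ι ∘ₗ LinearMap.proj j)
      (LinearMap.pi fun j => ι ∘ₗ LinearMap.proj j)
  let L : ((Fin J → Fin d → F) × (Fin J → Fin d → F)) →ₗ[F]
      (Fin ℓ × Fin (d + 2 * ℓ + J) → F) :=
    LinearMap.pi fun it => lcoeff F it.2 ∘ₗ reduction f a e h J it.1 ∘ₗ κ
  have hk : LinearMap.ker L ≠ ⊥ := by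
    apply LinearMap.ker_ne_bot_of_finrank_lt
    simp only [Module.finrank_prod, Module.finrank_pi, Module.finrank_pi_fintype,
      Fintype.card_prod, Fintype.card_fin, Finset.sum_const, Finset.card_univ, smul_eq_mul]
    omega
  obtain ⟨c, hc, hc0⟩ := (Submodule.ne_bot_iff _).1 hk
  refine ⟨κ c, ?_, fun j => hι _, fun j => hι _, fun i hi => ?_⟩
  · intro h0
    apply hc0
    have h1 : ∀ j, ι (c.1 j) = 0 := fun j => congrFun (congrArg Prod.fst h0) j
    have h2 : ∀ j, ι (c.2 j) = 0 := fun j => congrFun (congrArg Prod.snd h0) j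
    refine Prod.ext (funext fun j => hinj ?_) (funext fun j => hinj ?_)
    · rw [h1 j]; simp
    · rw [h2 j]; simp
  · ext t
    rw [coeff_zero]
    by_cases ht : t < d + 2 * ℓ + J
    · have := congrFun (LinearMap.mem_ker.1 hc) (⟨i, hi⟩, ⟨t, ht⟩)
      simpa [L] using this
    · have g1 : ∀ j, ((κ c).1 j).natDegree < d := fun j => hι (c.1 j)
      have g2 : ∀ j, ((κ c).2 j).natDegree < d := fun j => hι (c.2 j)
      have g3 : d + 2 * i + J ≤ t := by omega
      exact natDegree_reduction_lt f hf a e h J i d (κ c) hd g1 g2 t g3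

/-- The auxiliary polynomial of Stepanov's method. -/
noncomputable def auxiliary {F : Type*} [Field F] (f : F[X]) (e h p J : ℕ)
    (rs : (Fin J → F[X]) × (Fin J → F[X])) : F[X] :=
  ∑ j, (f ^ e * rs.1 j * X ^ (p * (j : ℕ)) + f ^ (e + h) * rs.2 j * X ^ (p * (j : ℕ)))

lemma natDegree_auxiliary_le {F : Type*} [Field F] (f : F[X]) (hf : f.natDegree ≤ 3)
    (e h p J d : ℕ) (rs : (Fin J → F[X]) × (Fin J → F[X]))
    (h1 : ∀ j, (rs.1 j).natDegree < d) (h2 : ∀ j, (rs.2 j).natDegree < d) :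
    (auxiliary f e h p J rs).natDegree ≤ 3 * (e + h) + d + p * (J - 1) := by
  refine natDegree_sum_le_of_forall_le _ _ fun j _ => ?_
  have hj : p * (j : ℕ) ≤ p * (J - 1) := Nat.mul_le_mul_left _ (by have := j.2; omega)
  have key : ∀ (k : ℕ) (r : F[X]), k ≤ e + h → r.natDegree < d →
      (f ^ k * r * X ^ (p * (j : ℕ))).natDegree ≤ 3 * (e + h) + d + p * (J - 1) := by
    intro k r hk hr
    have a1 : (f ^ k).natDegree ≤ 3 * (e + h) := by
      refine natDegree_pow_le.trans ?_
      nlinarith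
    have a2 : (f ^ k * r).natDegree ≤ _ := natDegree_mul_le
    have a3 : (f ^ k * r * X ^ (p * (j : ℕ))).natDegree ≤ _ := natDegree_mul_le
    rw [natDegree_X_pow] at a3
    omega
  exact natDegree_add_le_of_degree_le (key _ _ (by omega) (h1 j)) (key _ _ le_rfl (h2 j))

lemma eval_iterate_derivative_auxiliary {p : ℕ} [Fact p.Prime] (f : (ZMod p)[X]) (a x : ZMod p)
    (e h J i : ℕ) (hi : i ≤ e) (hx : f.eval x ^ h = a)
    (rs : (Fin J → (ZMod p)[X]) × (Fin J → (ZMod p)[X])) :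
    (derivative^[i] (auxiliary f e h p J rs)).eval x =
      f.eval x ^ (e - i) * (reduction f a e h J i rs).eval x := by
  have hY : ∀ j : ℕ, derivative ((X : (ZMod p)[X]) ^ (p * j)) = 0 := by
    intro j; simp [derivative_X_pow]
  have hxp : ∀ j : ℕ, x ^ (p * j) = x ^ j := fun j => by rw [pow_mul, ZMod.pow_card]
  simp only [auxiliary, iterate_derivative_sum, iterate_map_add,
    iterate_derivative_pow_mul _ _ _ (hY _) _ _ hi,
    iterate_derivative_pow_mul _ _ _ (hY _) _ _ (le_trans hi (Nat.le_add_right e h))]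
  simp only [reduction, LinearMap.coe_mk, AddHom.coe_mk, eval_finsetSum, eval_add, eval_mul,
    eval_pow, eval_X, eval_C, Finset.mul_sum, hxp]
  refine Finset.sum_congr rfl fun j _ => ?_
  rw [show e + h - i = (e - i) + h by omega, pow_add, hx]
  ring

lemma eq_zero_of_mul_sq_eq {F : Type*} [Field F] (f r s : F[X]) (b : F) (hb : b ≠ 0)
    (hf : f.natDegree = 3) (heq : f * r ^ 2 = C b * s ^ 2) : r = 0 ∧ s = 0 := by
  have hf0 : f ≠ 0 := by rintro rfl; simp at hf
  by_cases hr : r = 0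
  · subst hr
    have : s ^ 2 = 0 := by simpa [hb] using heq.symm
    exact ⟨rfl, by simpa using this⟩
  · exfalso
    have hs : s ≠ 0 := by
      rintro rfl
      simp [hf0, hr] at heq
    have := congrArg natDegree heq
    rw [natDegree_mul hf0 (pow_ne_zero _ hr), natDegree_C_mul hb, natDegree_pow, natDegree_pow,
      hf] at this
    omega

/-- Nonvanishing of the auxiliary polynomial. -/
lemma auxiliary_ne_zero {p : ℕ} [Fact p.Prime] (hp : p ≠ 2) (f : (ZMod p)[X])
    (hf : f.natDegree = 3) (hf0 : f.eval 0 ≠ 0) (e J d : ℕ) (hd : 2 * d + 3 ≤ p)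
    (rs : (Fin J → (ZMod p)[X]) × (Fin J → (ZMod p)[X])) (hrs : rs ≠ 0)
    (h1 : ∀ j, (rs.1 j).natDegree < d) (h2 : ∀ j, (rs.2 j).natDegree < d) :
    auxiliary f e ((p - 1) / 2) p J rs ≠ 0 := by
  have hpp : p.Prime := Fact.out
  have hodd : p % 2 = 1 := (hpp.eq_two_or_odd).resolve_left hp
  have hfne : f ≠ 0 := by rintro rfl; simp at hf
  intro h0
  have h3 : f ^ e * (∑ j, rs.1 j * X ^ (p * (j : ℕ)) +
      f ^ ((p - 1) / 2) * ∑ j, rs.2 j * X ^ (p * (j : ℕ))) = 0 := by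
    rw [← h0, auxiliary, Finset.mul_sum, ← Finset.sum_add_distrib, Finset.mul_sum]
    refine Finset.sum_congr rfl fun j _ => ?_
    rw [pow_add]; ring
  have h4 := (mul_eq_zero.1 h3).resolve_left (pow_ne_zero _ hfne)
  set P := ∑ j, rs.1 j * X ^ (p * (j : ℕ)) with hP
  set Q := ∑ j, rs.2 j * X ^ (p * (j : ℕ)) with hQ
  have h5 : f * P ^ 2 = f ^ p * Q ^ 2 := by
    have : P = - (f ^ ((p - 1) / 2) * Q) := eq_neg_of_add_eq_zero_left h4
    rw [this]
    have h6 : f ^ p = f * (f ^ ((p - 1) / 2)) ^ 2 := by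
      rw [← pow_mul, ← pow_succ']
      congr 1; omega
    rw [h6]; ring
  -- all coefficients vanish, by strong induction
  have key : ∀ k : ℕ, ∀ hk : k < J, rs.1 ⟨k, hk⟩ = 0 ∧ rs.2 ⟨k, hk⟩ = 0 := by
    intro k
    induction k using Nat.strong_induction_on with
    | _ k ih =>
    intro hk
    have split : ∀ r : Fin J → (ZMod p)[X], (∀ m, ∀ hm : m < J, m < k → r ⟨m, hm⟩ = 0) →
        ∃ U, ∑ j, r j * X ^ (p * (j : ℕ)) = X ^ (p * k) * (r ⟨k, hk⟩ + X ^ p * U) := by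
      intro r hr
      refine ⟨∑ j ∈ Finset.univ.filter (fun j : Fin J => k < j),
        r j * X ^ (p * ((j : ℕ) - k - 1)), ?_⟩
      rw [← Finset.sum_subset (Finset.subset_univ (insert (⟨k, hk⟩ : Fin J)
        (Finset.univ.filter (fun j : Fin J => k < j))))]
      · rw [Finset.sum_insert (by simp), mul_add, Finset.mul_sum, Finset.mul_sum, mul_comm]
        congr 1
        refine Finset.sum_congr rfl fun j hj => ?_
        simp only [Finset.mem_filter, Finset.mem_univ, true_and] at hj
        have : p * (j : ℕ) = p * k + (p + p * ((j : ℕ) - k - 1)) := by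
          obtain ⟨t, ht⟩ : ∃ t, (j : ℕ) = k + 1 + t := ⟨j - (k + 1), by omega⟩
          rw [ht, show k + 1 + t - k - 1 = t by omega]; ring
        rw [this, pow_add, pow_add]; ring
      · intro j _ hj
        simp only [Finset.mem_insert, Finset.mem_filter, Finset.mem_univ, true_and, not_or,
          not_lt] at hj
        have h7 : (j : ℕ) < k := lt_of_le_of_ne hj.2 fun h => hj.1 (Fin.ext h)
        rw [hr j j.2 h7, zero_mul]
    obtain ⟨U, hU⟩ := split rs.1 fun m hm hmk => (ih m hmk hm).1
    obtain ⟨W, hW⟩ := split rs.2 fun m hm hmk => (ih m hmk hm).2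
    set r := rs.1 ⟨k, hk⟩
    set s := rs.2 ⟨k, hk⟩
    have hr : r.natDegree < d := h1 _
    have hs : s.natDegree < d := h2 _
    rw [hP, hQ, hU, hW] at h5
    have h6 : f * (r + X ^ p * U) ^ 2 = f ^ p * (s + X ^ p * W) ^ 2 := by
      have hX : ((X : (ZMod p)[X]) ^ (p * k)) ^ 2 ≠ 0 := pow_ne_zero _ (pow_ne_zero _ X_ne_zero)
      apply mul_left_cancel₀ hX
      linear_combination h5
    have hfp : ∃ G, f ^ p = C (f.eval 0) + X ^ p * G := by
      rw [← ZMod.expand_card]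
      refine ⟨expand (ZMod p) p f.divX, ?_⟩
      conv_lhs => rw [← divX_mul_X_add f]
      rw [map_add, map_mul, expand_X, expand_C, coeff_zero_eq_eval_zero]
      ring
    obtain ⟨G, hG⟩ := hfp
    have h7 : X ^ p ∣ f * r ^ 2 - C (f.eval 0) * s ^ 2 := by
      rw [hG] at h6
      refine ⟨G * (s + X ^ p * W) ^ 2 + C (f.eval 0) * (2 * s * W + X ^ p * W ^ 2)
        - f * (2 * r * U + X ^ p * U ^ 2), ?_⟩
      linear_combination h6
    have h8 : f * r ^ 2 - C (f.eval 0) * s ^ 2 = 0 := by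
      apply eq_zero_of_dvd_of_natDegree_lt h7
      rw [natDegree_X_pow]
      refine lt_of_le_of_lt
        (natDegree_sub_le_of_le (m := p - 1) ?_ ?_ |>.trans (max_self _).le) (by omega)
      · have a1 : (f * r ^ 2).natDegree ≤ _ := natDegree_mul_le
        have a2 : (r ^ 2).natDegree ≤ 2 * r.natDegree := natDegree_pow_le
        omega
      · have a1 := natDegree_C_mul_le (f.eval 0) (s ^ 2)
        have a2 : (s ^ 2).natDegree ≤ 2 * s.natDegree := natDegree_pow_le
        omega
    exact eq_zero_of_mul_sq_eq f r s _ hf0 hf (sub_eq_zero.1 h8)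
  exact hrs (Prod.ext (funext fun j => (key j j.2).1) (funext fun j => (key j j.2).2))

/-- Stepanov's estimate with free parameters. -/
lemma mul_card_le {p : ℕ} [Fact p.Prime] (hp : p ≠ 2) (f : (ZMod p)[X])
    (hf : f.natDegree = 3) (hf0 : f.eval 0 ≠ 0) (a : ZMod p) (ℓ J d : ℕ) (hd0 : 0 < d)
    (hd : 2 * d + 3 ≤ p) (hℓ : ℓ ≤ p) (hcount : ℓ * (d + 2 * ℓ + J) < 2 * (J * d)) :
    ℓ * (Finset.univ.filter fun x : ZMod p => f.eval x ^ ((p - 1) / 2) = a).card ≤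
      3 * (ℓ + (p - 1) / 2) + d + p * (J - 1) := by
  obtain ⟨rs, hrs, h1, h2, h3⟩ := exists_coefficients f hf.le a ℓ ((p - 1) / 2) J ℓ d hd0 hcount
  set R := auxiliary f ℓ ((p - 1) / 2) p J rs with hR
  have hR0 : R ≠ 0 := auxiliary_ne_zero hp f hf hf0 ℓ J d hd rs hrs h1 h2
  have hdeg : R.natDegree ≤ 3 * (ℓ + (p - 1) / 2) + d + p * (J - 1) :=
    natDegree_auxiliary_le f hf.le _ _ _ _ _ rs h1 h2
  refine le_trans ?_ hdeg
  set Z := Finset.univ.filter fun x : ZMod p => f.eval x ^ ((p - 1) / 2) = a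
  have hmult : ∀ x ∈ Z, ℓ ≤ R.roots.count x := by
    intro x hx
    rw [count_roots]
    rcases Nat.eq_zero_or_pos ℓ with h | h
    · omega
    obtain ⟨n, rfl⟩ : ∃ n, ℓ = n + 1 := ⟨ℓ - 1, by omega⟩
    refine lt_rootMultiplicity_of_isRoot_iterate_derivative_of_mem_nonZeroDivisors hR0 ?_ ?_
    · intro m hm
      rw [IsRoot.def, hR, eval_iterate_derivative_auxiliary f a x (n + 1) _ J m (by omega)
        (Finset.mem_filter.1 hx).2, h3 m (by omega)]
      simp
    · rw [mem_nonZeroDivisors_iff_ne_zero]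
      intro h0
      have := (ZMod.natCast_eq_zero_iff _ _).1 h0
      rw [(Fact.out : p.Prime).dvd_factorial] at this
      omega
  calc ℓ * Z.card = ∑ x ∈ Z, ℓ := by simp [mul_comm]
    _ ≤ ∑ x ∈ Z, R.roots.count x := Finset.sum_le_sum hmult
    _ ≤ R.roots.card := by
        classical
        rw [← Multiset.sum_count_eq_card (s := Finset.univ) (m := R.roots) (by simp)]
        exact Finset.sum_le_sum_of_subset (Finset.subset_univ _)
    _ ≤ R.natDegree := card_roots' R

/-- Points on one branch of `y ^ 2 = f x` for a cubic `f`. -/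
lemma card_le_half_add_sqrt {p : ℕ} [Fact p.Prime] (hp : 400 ≤ p) (f : (ZMod p)[X])
    (hf : f.natDegree = 3) (hf0 : f.eval 0 ≠ 0) (a : ZMod p) :
    ((Finset.univ.filter fun x : ZMod p => f.eval x ^ ((p - 1) / 2) = a).card : ℝ) ≤
      p / 2 + 20 * Real.sqrt p := by
  have hpp : p.Prime := Fact.out
  have hodd : p % 2 = 1 := (hpp.eq_two_or_odd).resolve_left (by omega)
  set L := Nat.sqrt p with hL
  have hL1 : L * L ≤ p := Nat.sqrt_le p
  have hL2 : p < (L + 1) * (L + 1) := Nat.lt_succ_sqrt p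
  have hL3 : 20 ≤ L := by
    rw [hL, Nat.le_sqrt]; omega
  obtain ⟨d, hd⟩ : ∃ d, p = 2 * d + 3 := ⟨(p - 3) / 2, by omega⟩
  have := mul_card_le (by omega) f hf hf0 a (2 * L) (L + 12) d (by omega) (by omega)
    (by nlinarith) (by nlinarith)
  set Z := (Finset.univ.filter fun x : ZMod p => f.eval x ^ ((p - 1) / 2) = a).card
  have h2 : (p - 1) / 2 = d + 1 := by omega
  rw [h2] at this
  have h3 : 2 * L * Z ≤ 3 * (2 * L + (d + 1)) + d + p * (L + 11) := this
  have h4 : 2 * (L : ℝ) * Z ≤ 3 * (2 * L + (d + 1)) + d + p * (L + 11) := by exact_mod_cast h3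
  have h5 : (p : ℝ) = 2 * d + 3 := by exact_mod_cast hd
  have h6 : (L : ℝ) ≤ Real.sqrt p := by
    apply Real.le_sqrt_of_sq_le
    rw [sq]; exact_mod_cast hL1
  have h7 : (p : ℝ) ≤ (L + 1) * (L + 1) := by exact_mod_cast hL2.le
  have h8 : (20 : ℝ) ≤ L := by exact_mod_cast hL3
  have h9 : (p : ℝ) ≤ L * L * (1.1025) := by nlinarith
  have h10 : 2 * (L : ℝ) * Z ≤ 2 * L * (p / 2 + 20 * L) := by
    nlinarith
  have h11 : (Z : ℝ) ≤ p / 2 + 20 * L := le_of_mul_le_mul_left h10 (by linarith)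
  linarith

end Stepanov

namespace CharSum

open Polynomial
open Stepanov

lemma abs_sum_quadraticChar_cubic_le {p : ℕ} [Fact p.Prime] (hp : 400 ≤ p) (f : (ZMod p)[X])
    (hf : f.natDegree = 3) (hf0 : f.eval 0 ≠ 0) :
    |((∑ x : ZMod p, quadraticChar (ZMod p) (f.eval x) : ℤ) : ℝ)| ≤ 41 * Real.sqrt p := by
  have hchar : ringChar (ZMod p) ≠ 2 := by rw [ZMod.ringChar_zmod_n]; omega
  have hpp : p.Prime := Fact.out
  have hodd : p % 2 = 1 := (hpp.eq_two_or_odd).resolve_left (by omega)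
  have hne : (1 : ZMod p) ≠ -1 := (Ring.neg_one_ne_one_of_char_ne_two hchar).symm
  set h := (p - 1) / 2
  set Z := fun a : ZMod p => Finset.univ.filter fun x : ZMod p => f.eval x ^ h = a with hZ
  have hcast : ∀ y : ZMod p, ((quadraticChar (ZMod p) y : ℤ) : ZMod p) = y ^ h := by
    intro y
    rw [quadraticChar_eq_pow_of_char_ne_two' hchar, ZMod.card]
    congr 1; omega
  have hsum : (∑ x : ZMod p, quadraticChar (ZMod p) (f.eval x) : ℤ) =
      ((Z 1).card : ℤ) - (Z (-1)).card := by
    simp only [hZ, Finset.card_filter, Nat.cast_sum, ← Finset.sum_sub_distrib]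
    refine Finset.sum_congr rfl fun x _ => ?_
    have := hcast (f.eval x)
    rcases eq_or_ne (f.eval x) 0 with h0 | h0
    · have e : f.eval x ^ h = 0 := by rw [h0, zero_pow]; omega
      rw [e, h0]; simp
    · rcases quadraticChar_dichotomy h0 with h1 | h1
      · rw [h1] at this ⊢
        rw [← this]; simp [hne]
      · rw [h1] at this ⊢
        rw [← this]; simp [hne.symm]
  have hcover : (Finset.univ : Finset (ZMod p)) ⊆ (Z 1 ∪ Z (-1)) ∪ f.roots.toFinset := by
    intro x _
    have hfne : f ≠ 0 := by rintro rfl; simp at hf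
    simp only [hZ, Finset.mem_union, Finset.mem_filter, Finset.mem_univ, true_and,
      Multiset.mem_toFinset, mem_roots hfne, IsRoot.def]
    rcases eq_or_ne (f.eval x) 0 with h0 | h0
    · exact Or.inr h0
    · left
      rw [← hcast]
      rcases quadraticChar_dichotomy h0 with h1 | h1 <;> rw [h1] <;> simp
  have hcard : p ≤ (Z 1).card + (Z (-1)).card + 3 := by
    calc p = (Finset.univ : Finset (ZMod p)).card := by rw [Finset.card_univ, ZMod.card]
      _ ≤ _ := Finset.card_le_card hcover
      _ ≤ (Z 1).card + (Z (-1)).card + 3 := by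
        refine (Finset.card_union_le _ _).trans (add_le_add (Finset.card_union_le _ _) ?_)
        exact (Multiset.toFinset_card_le _).trans ((card_roots' f).trans hf.le)
  have h1 : ((Z 1).card : ℝ) ≤ p / 2 + 20 * Real.sqrt p := card_le_half_add_sqrt hp f hf hf0 1
  have h2 : ((Z (-1)).card : ℝ) ≤ p / 2 + 20 * Real.sqrt p :=
    card_le_half_add_sqrt hp f hf hf0 (-1)
  have h3 : (p : ℝ) ≤ (Z 1).card + (Z (-1)).card + 3 := by exact_mod_cast hcard
  have h4 : (20 : ℝ) ≤ Real.sqrt p := by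
    apply Real.le_sqrt_of_sq_le
    have : (400 : ℝ) ≤ p := by exact_mod_cast hp
    linarith
  rw [hsum, abs_le]
  push_cast
  constructor <;> linarith

lemma abs_quadraticChar_le {F : Type*} [Field F] [Fintype F] [DecidableEq F] (y : F) :
    |((quadraticChar F y : ℤ) : ℝ)| ≤ 1 := by
  rcases eq_or_ne y 0 with h0 | h0
  · simp [h0]
  · rcases quadraticChar_dichotomy h0 with h1 | h1 <;> rw [h1] <;> simp

/-- Square-root cancellation for four shifts, the first one being different from the others. -/
lemma abs_sum_quadraticChar_shifts_le {p : ℕ} [Fact p.Prime] (v₁ v₂ v₃ v₄ : ZMod p)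
    (h₂ : v₁ ≠ v₂) (h₃ : v₁ ≠ v₃) (h₄ : v₁ ≠ v₄) :
    |((∑ x : ZMod p, quadraticChar (ZMod p) ((x + v₁) * (x + v₂) * (x + v₃) * (x + v₄)) : ℤ) : ℝ)|
      ≤ 42 * Real.sqrt p := by
  rcases lt_or_ge p 400 with hp | hp
  · have h1 : |((∑ x : ZMod p, quadraticChar (ZMod p)
        ((x + v₁) * (x + v₂) * (x + v₃) * (x + v₄)) : ℤ) : ℝ)| ≤ p := by
      push_cast
      refine (Finset.abs_sum_le_sum_abs _ _).trans ?_
      refine (Finset.sum_le_sum fun x _ => abs_quadraticChar_le _).trans ?_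
      simp
    have h2 : Real.sqrt p ≤ 20 := by
      apply Real.sqrt_le_iff.2
      have : (p : ℝ) < 400 := by exact_mod_cast hp
      constructor <;> linarith
    have h3 : (p : ℝ) = Real.sqrt p * Real.sqrt p := (Real.mul_self_sqrt (by positivity)).symm
    have h4 := Real.sqrt_nonneg (p : ℝ)
    nlinarith
  · set u₂ := v₂ - v₁ with hu₂
    set u₃ := v₃ - v₁ with hu₃
    set u₄ := v₄ - v₁ with hu₄
    have g₂ : u₂ ≠ 0 := sub_ne_zero.2 h₂.symm
    have g₃ : u₃ ≠ 0 := sub_ne_zero.2 h₃.symm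
    have g₄ : u₄ ≠ 0 := sub_ne_zero.2 h₄.symm
    set f : (ZMod p)[X] := (C u₂ * X + C 1) * (C u₃ * X + C 1) * (C u₄ * X + C 1) with hf
    have hdeg : f.natDegree = 3 := by
      have n₂ := natDegree_linear (b := (1 : ZMod p)) g₂
      have n₃ := natDegree_linear (b := (1 : ZMod p)) g₃
      have n₄ := natDegree_linear (b := (1 : ZMod p)) g₄
      have k₂ : (C u₂ * X + C 1 : (ZMod p)[X]) ≠ 0 := ne_zero_of_natDegree_gt (n := 0) (by omega)
      have k₃ : (C u₃ * X + C 1 : (ZMod p)[X]) ≠ 0 := ne_zero_of_natDegree_gt (n := 0) (by omega)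
      have k₄ : (C u₄ * X + C 1 : (ZMod p)[X]) ≠ 0 := ne_zero_of_natDegree_gt (n := 0) (by omega)
      rw [hf, natDegree_mul (mul_ne_zero k₂ k₃) k₄, natDegree_mul k₂ k₃, n₂, n₃, n₄]
    have hev : ∀ z, f.eval z = (u₂ * z + 1) * (u₃ * z + 1) * (u₄ * z + 1) := by
      intro z; simp [hf]
    have h0 : f.eval 0 ≠ 0 := by rw [hev]; simp
    have main := abs_sum_quadraticChar_cubic_le hp f hdeg h0
    have hsum : (∑ x : ZMod p, quadraticChar (ZMod p)
        ((x + v₁) * (x + v₂) * (x + v₃) * (x + v₄)) : ℤ) =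
        (∑ x : ZMod p, quadraticChar (ZMod p) (f.eval x)) - 1 := by
      have s1 : (∑ x : ZMod p, quadraticChar (ZMod p)
          ((x + v₁) * (x + v₂) * (x + v₃) * (x + v₄)) : ℤ) =
          ∑ y : ZMod p, quadraticChar (ZMod p) (y * (y + u₂) * (y + u₃) * (y + u₄)) := by
        refine Fintype.sum_equiv (Equiv.addRight v₁) _ _ fun x => ?_
        simp only [Equiv.coe_addRight, hu₂, hu₃, hu₄]
        congr 1; ring
      have s2 : (∑ y : ZMod p, quadraticChar (ZMod p) (y * (y + u₂) * (y + u₃) * (y + u₄)) : ℤ) =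
          ∑ y ∈ Finset.univ.erase (0 : ZMod p), quadraticChar (ZMod p) (f.eval y⁻¹) := by
        rw [← Finset.add_sum_erase _ _ (Finset.mem_univ (0 : ZMod p))]
        rw [zero_mul, zero_mul, zero_mul, quadraticChar_zero, zero_add]
        refine Finset.sum_congr rfl fun y hy => ?_
        have hy0 : y ≠ 0 := Finset.ne_of_mem_erase hy
        have : y * (y + u₂) * (y + u₃) * (y + u₄) = (y ^ 2) ^ 2 * f.eval y⁻¹ := by
          rw [hev]; field_simp; ring
        rw [this, map_mul, map_pow, quadraticChar_sq_one' hy0, one_pow, one_mul]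
      have s3 : (∑ y ∈ Finset.univ.erase (0 : ZMod p), quadraticChar (ZMod p) (f.eval y⁻¹) : ℤ) =
          ∑ y ∈ Finset.univ.erase (0 : ZMod p), quadraticChar (ZMod p) (f.eval y) := by
        refine Finset.sum_nbij' (fun y => y⁻¹) (fun y => y⁻¹) ?_ ?_ ?_ ?_ ?_ <;> simp
      rw [s1, s2, s3, ← Finset.add_sum_erase _ _ (Finset.mem_univ (0 : ZMod p)), hev]
      simp
    have h4 : (1 : ℝ) ≤ Real.sqrt p := by
      rw [Real.one_le_sqrt]
      exact_mod_cast (by omega : 1 ≤ p)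
    rw [hsum]
    push_cast at main ⊢
    rw [abs_le] at main ⊢
    constructor <;> linarith [main.1, main.2]

end CharSum

namespace CharSum

open Finset

lemma sum_range_mul_of_coprime {R : Type*} [CommSemiring R] {m n : ℕ} (h : m.Coprime n)
    (hm : 0 < m) (hn : 0 < n) (f g : ℕ → R) (hf : ∀ x, f (x % m) = f x)
    (hg : ∀ x, g (x % n) = g x) :
    ∑ x ∈ range (m * n), f x * g x = (∑ x ∈ range m, f x) * ∑ x ∈ range n, g x := by
  rw [sum_mul_sum, ← sum_product']
  refine sum_nbij (fun x => (x % m, x % n)) ?_ ?_ ?_ ?_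
  · intro x _
    simp [Nat.mod_lt _ hm, Nat.mod_lt _ hn]
  · intro x hx y hy hxy
    simp only [Prod.mk.injEq] at hxy
    have : x ≡ y [MOD m * n] := (Nat.modEq_and_modEq_iff_modEq_mul h).1 ⟨hxy.1, hxy.2⟩
    exact Nat.ModEq.eq_of_lt_of_lt this (by simpa using hx) (by simpa using hy)
  · rintro ⟨a, b⟩ hab
    simp only [coe_product, Set.mem_prod, mem_coe, mem_range] at hab
    obtain ⟨x, hx1, hx2⟩ := Nat.chineseRemainder h a b
    refine ⟨x % (m * n), by simpa using Nat.mod_lt _ (Nat.mul_pos hm hn), ?_⟩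
    have e1 : x % (m * n) % m = a := by
      rw [Nat.mod_mul_right_mod, hx1, Nat.mod_eq_of_lt hab.1]
    have e2 : x % (m * n) % n = b := by
      rw [Nat.mod_mul_left_mod, hx2, Nat.mod_eq_of_lt hab.2]
    simp [e1, e2]
  · intro x _
    simp only [hf, hg]

lemma sum_range_natCast_zmod {R : Type*} [AddCommMonoid R] (k : ℕ) [NeZero k] (f : ZMod k → R) :
    ∑ x ∈ range k, f x = ∑ x, f x := by
  refine sum_nbij' (fun x => (x : ZMod k)) ZMod.val ?_ ?_ ?_ ?_ ?_
  · simp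
  · simp [ZMod.val_lt]
  · intro x hx; exact ZMod.val_cast_of_lt (by simpa using hx)
  · simp
  · simp

lemma jacobiSym_congr {k : ℕ} {a b : ℤ} (h : (a : ZMod k) = b) : jacobiSym a k = jacobiSym b k :=
  jacobiSym.mod_left' ((ZMod.intCast_eq_intCast_iff' a b k).1 h)

lemma abs_jacobiSym_le (a : ℤ) (k : ℕ) : |((jacobiSym a k : ℤ) : ℝ)| ≤ 1 := by
  rcases jacobiSym.trichotomy a k with h | h | h <;> rw [h] <;> simp

/-- An induction principle for odd squarefree numbers. -/
lemma odd_squarefree_induction {P : ℕ → Prop} (one : P 1)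
    (prime : ∀ p, p.Prime → p ≠ 2 → P p)
    (mul : ∀ a b, 1 < a → 1 < b → a.Coprime b → P a → P b → P (a * b)) :
    ∀ k, Odd k → Squarefree k → P k := by
  intro k
  induction k using Nat.recOnPosPrimePosCoprime with
  | zero => intro h; simp at h
  | one => intros; exact one
  | prime_pow p n hp hn =>
    intro ho hs
    have : n = 1 := by
      by_contra h1
      have h2 : p * p ∣ p ^ n := by
        rw [← sq]; exact pow_dvd_pow p (by omega)
      exact hp.one_lt.ne' (by simpa using hs p h2)
    subst this
    rw [pow_one] at ho ⊢
    exact prime p hp (by rintro rfl; exact absurd ho (by decide))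
  | coprime a b ha hb hab iha ihb =>
    intro ho hs
    rw [Nat.odd_mul] at ho
    rw [Nat.squarefree_mul_iff] at hs
    exact mul a b ha hb hab (iha ho.1 hs.2.1) (ihb ho.2 hs.2.2)

/-- The complete sum of the Jacobi symbol over four shifts. -/
def shiftSum (k : ℕ) (v₁ v₂ v₃ v₄ : ℤ) : ℤ :=
  ∑ x ∈ range k, jacobiSym ((x + v₁) * (x + v₂) * (x + v₃) * (x + v₄)) k

lemma abs_shiftSum_le_self (k : ℕ) (v₁ v₂ v₃ v₄ : ℤ) :
    |((shiftSum k v₁ v₂ v₃ v₄ : ℤ) : ℝ)| ≤ k := by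
  rw [shiftSum]
  push_cast
  refine (abs_sum_le_sum_abs _ _).trans ?_
  refine (sum_le_sum fun x _ => abs_jacobiSym_le _ _).trans ?_
  simp

lemma shiftSum_mul {m n : ℕ} (h : m.Coprime n) (hm : 0 < m) (hn : 0 < n) (v₁ v₂ v₃ v₄ : ℤ) :
    shiftSum (m * n) v₁ v₂ v₃ v₄ = shiftSum m v₁ v₂ v₃ v₄ * shiftSum n v₁ v₂ v₃ v₄ := by
  rw [shiftSum, shiftSum, shiftSum, ← sum_range_mul_of_coprime h hm hn]
  · exact sum_congr rfl fun x _ => jacobiSym.mul_right' _ hm.ne' hn.ne'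
  · intro x; apply jacobiSym_congr; push_cast; rfl
  · intro x; apply jacobiSym_congr; push_cast; rfl

lemma abs_shiftSum_le (k : ℕ) (hk : Odd k) (hs : Squarefree k) (v₁ v₂ v₃ v₄ : ℤ) :
    |((shiftSum k v₁ v₂ v₃ v₄ : ℤ) : ℝ)| ≤ 42 ^ k.primeFactors.card * Real.sqrt k *
      (Int.gcd k ((v₁ - v₂) * (v₁ - v₃) * (v₁ - v₄)) : ℝ) := by
  refine odd_squarefree_induction (P := fun k => |((shiftSum k v₁ v₂ v₃ v₄ : ℤ) : ℝ)| ≤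
    42 ^ k.primeFactors.card * Real.sqrt k *
      (Int.gcd k ((v₁ - v₂) * (v₁ - v₃) * (v₁ - v₄)) : ℝ)) ?_ ?_ ?_ k hk hs
  · simp [shiftSum]
  · intro p hp hp2
    have := Fact.mk hp
    have hpos : (1 : ℝ) ≤ Real.sqrt p := by
      rw [Real.one_le_sqrt]; exact_mod_cast hp.one_lt.le
    rw [hp.primeFactors, card_singleton, pow_one]
    by_cases hdvd : (p : ℤ) ∣ (v₁ - v₂) * (v₁ - v₃) * (v₁ - v₄)
    · have hgp : Int.gcd p ((v₁ - v₂) * (v₁ - v₃) * (v₁ - v₄)) = p := by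
        rw [Int.gcd_eq_natAbs, Int.natAbs_natCast]
        exact Nat.gcd_eq_left (Int.natCast_dvd.1 hdvd)
      rw [hgp]
      refine (abs_shiftSum_le_self p v₁ v₂ v₃ v₄).trans ?_
      have : (0 : ℝ) ≤ p := by positivity
      nlinarith
    · have hg : (1 : ℝ) ≤ (Int.gcd p ((v₁ - v₂) * (v₁ - v₃) * (v₁ - v₄)) : ℝ) := by
        have : 0 < Int.gcd p ((v₁ - v₂) * (v₁ - v₃) * (v₁ - v₄)) :=
          Int.gcd_pos_of_ne_zero_left _ (by exact_mod_cast hp.ne_zero)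
        exact_mod_cast this
      rw [← ZMod.intCast_zmod_eq_zero_iff_dvd] at hdvd
      push_cast at hdvd
      have hd := hdvd
      simp only [mul_eq_zero, not_or, sub_eq_zero] at hd
      have main := abs_sum_quadraticChar_shifts_le (p := p) v₁ v₂ v₃ v₄ hd.1.1 hd.1.2 hd.2
      have heq : shiftSum p v₁ v₂ v₃ v₄ = ∑ x : ZMod p, quadraticChar (ZMod p)
          ((x + v₁) * (x + v₂) * (x + v₃) * (x + v₄)) := by
        rw [shiftSum, ← sum_range_natCast_zmod]
        refine sum_congr rfl fun x _ => ?_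
        rw [← jacobiSym.legendreSym.to_jacobiSym, legendreSym]
        push_cast
        rfl
      rw [heq]
      refine main.trans ?_
      nlinarith
  · intro a b ha hb hab iha ihb
    rw [shiftSum_mul hab (by omega) (by omega), hab.primeFactors_mul,
      card_union_of_disjoint hab.disjoint_primeFactors]
    have hg : (Int.gcd ((a * b : ℕ) : ℤ) ((v₁ - v₂) * (v₁ - v₃) * (v₁ - v₄)) : ℝ) =
        (Int.gcd a ((v₁ - v₂) * (v₁ - v₃) * (v₁ - v₄)) : ℝ) *
        (Int.gcd b ((v₁ - v₂) * (v₁ - v₃) * (v₁ - v₄)) : ℝ) := by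
      rw [← Nat.cast_mul]
      congr 1
      rw [Int.gcd_eq_natAbs, Int.gcd_eq_natAbs, Int.gcd_eq_natAbs, Int.natAbs_natCast,
        Int.natAbs_natCast, Int.natAbs_natCast, Nat.gcd_comm, hab.gcd_mul, Nat.gcd_comm,
        Nat.gcd_comm _ b]
    rw [hg]
    push_cast
    rw [abs_mul, Real.sqrt_mul (by positivity), pow_add]
    refine (mul_le_mul iha ihb (abs_nonneg _) (by positivity)).trans (le_of_eq ?_)
    ring

lemma sum_jacobiSym_eq_zero (k : ℕ) (hk : Odd k) (hs : Squarefree k) (h1 : 1 < k) :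
    ∑ x ∈ range k, jacobiSym x k = 0 := by
  revert h1
  refine odd_squarefree_induction (P := fun k => 1 < k → ∑ x ∈ range k, jacobiSym x k = 0)
    ?_ ?_ ?_ k hk hs
  · simp
  · intro p hp hp2 _
    have := Fact.mk hp
    have hchar : ringChar (ZMod p) ≠ 2 := by rwa [ZMod.ringChar_zmod_n]
    rw [← quadraticChar_sum_zero hchar, ← sum_range_natCast_zmod]
    refine sum_congr rfl fun x _ => ?_
    rw [← jacobiSym.legendreSym.to_jacobiSym, legendreSym]
    push_cast
    rfl
  · intro a b ha hb hab iha ihb _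
    calc ∑ x ∈ range (a * b), jacobiSym x (a * b)
        = ∑ x ∈ range (a * b), jacobiSym x a * jacobiSym x b :=
          sum_congr rfl fun x _ => jacobiSym.mul_right' _ (by omega) (by omega)
      _ = 0 := by
          rw [sum_range_mul_of_coprime hab (by omega) (by omega) (fun x : ℕ => jacobiSym x a)
            (fun x : ℕ => jacobiSym x b), iha ha, zero_mul]
          · intro x; apply jacobiSym_congr; push_cast; rfl
          · intro x; apply jacobiSym_congr; push_cast; rfl

/-- The additive character `e(j / k)`. -/
noncomputable def addE (k : ℕ) (j : ℤ) : ℂ := Complex.exp (2 * Real.pi * Complex.I * j / k)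

lemma addE_eq_stdAddChar (k : ℕ) [NeZero k] (j : ℤ) :
    addE k j = ZMod.stdAddChar (N := k) (j : ZMod k) :=
  (ZMod.stdAddChar_coe j).symm

/-- The Gauss sum of the Jacobi symbol at the frequency `h`. -/
noncomputable def jacobiGauss (k : ℕ) (h : ℤ) : ℂ :=
  ∑ x ∈ range k, (jacobiSym x k : ℂ) * addE k (h * x)

lemma stdAddChar_mul_of_coprime {m n : ℕ} [NeZero m] [NeZero n] [NeZero (m * n)]
    (h : m.Coprime n) : ∃ u v : ℤ, ∀ j : ℤ, ZMod.stdAddChar (N := m * n) (j : ZMod (m * n)) =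
      ZMod.stdAddChar (N := m) ((j * u : ℤ) : ZMod m) *
        ZMod.stdAddChar (N := n) ((j * v : ℤ) : ZMod n) := by
  have hb := Nat.gcd_eq_gcd_ab m n
  rw [h] at hb
  refine ⟨m.gcdB n, m.gcdA n, fun j => ?_⟩
  rw [ZMod.stdAddChar_coe, ZMod.stdAddChar_coe, ZMod.stdAddChar_coe, ← Complex.exp_add]
  congr 1
  have hm : (m : ℂ) ≠ 0 := by exact_mod_cast NeZero.ne m
  have hn : (n : ℂ) ≠ 0 := by exact_mod_cast NeZero.ne n
  have hb' : (1 : ℂ) = m * m.gcdA n + n * m.gcdB n := by exact_mod_cast hb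
  push_cast
  field_simp
  linear_combination j * hb'

lemma norm_jacobiGauss_le (k : ℕ) (hk : Odd k) (hs : Squarefree k) :
    ∀ h : ℤ, ‖jacobiGauss k h‖ ≤ Real.sqrt k := by
  refine odd_squarefree_induction (P := fun k => ∀ h : ℤ, ‖jacobiGauss k h‖ ≤ Real.sqrt k)
    ?_ ?_ ?_ k hk hs
  · intro h
    simp [jacobiGauss, addE]
  · intro p hp hp2 h
    have := Fact.mk hp
    have hchar : ringChar (ZMod p) ≠ 2 := by rwa [ZMod.ringChar_zmod_n]
    set χ : MulChar (ZMod p) ℂ := (quadraticChar (ZMod p)).ringHomComp (Int.castRingHom ℂ) with hχ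
    have hχq : χ.IsQuadratic := quadraticChar_isQuadratic (ZMod p) |>.comp _
    have hχ1 : χ ≠ 1 := by
      rw [hχ]
      exact (MulChar.ringHomComp_ne_one_iff Int.cast_injective).2 (quadraticChar_ne_one hchar)
    have heq : jacobiGauss p h = gaussSum χ ((ZMod.stdAddChar (N := p)).mulShift (h : ZMod p)) := by
      rw [jacobiGauss, gaussSum, ← sum_range_natCast_zmod]
      refine sum_congr rfl fun x _ => ?_
      rw [addE_eq_stdAddChar, ← jacobiSym.legendreSym.to_jacobiSym, legendreSym,
        AddChar.mulShift_apply]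
      push_cast
      rfl
    by_cases hh : (h : ZMod p) = 0
    · rw [jacobiGauss]
      have : ∀ x : ℕ, ((h * x : ℤ) : ZMod p) = 0 := fun x => by push_cast; rw [hh, zero_mul]
      simp only [addE_eq_stdAddChar, this, AddChar.map_zero_eq_one, mul_one]
      have z := sum_jacobiSym_eq_zero p (hp.odd_of_ne_two hp2) hp.squarefree hp.one_lt
      have z' : ∑ x ∈ range p, (jacobiSym x p : ℂ) = 0 := by exact_mod_cast z
      rw [z', norm_zero]
      exact Real.sqrt_nonneg _
    · have hprim : ((ZMod.stdAddChar (N := p)).mulShift (h : ZMod p)).IsPrimitive := by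
        apply AddChar.IsPrimitive.of_ne_one
        exact ZMod.isPrimitive_stdAddChar p hh
      have hsq := gaussSum_sq hχ1 hχq hprim
      rw [← heq, ZMod.card] at hsq
      apply Real.le_sqrt_of_sq_le
      rw [← norm_pow, hsq, norm_mul, Complex.norm_natCast]
      have : ‖χ (-1)‖ ≤ 1 := by
        rcases hχq (-1) with h | h | h <;> rw [h] <;> simp
      nlinarith [(Nat.cast_nonneg p : (0 : ℝ) ≤ p)]
  · intro a b ha hb hab iha ihb h
    have : NeZero a := ⟨by omega⟩
    have : NeZero b := ⟨by omega⟩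
    have : NeZero (a * b) := ⟨by positivity⟩
    obtain ⟨u, v, huv⟩ := stdAddChar_mul_of_coprime hab
    have : jacobiGauss (a * b) h = jacobiGauss a (h * u) * jacobiGauss b (h * v) := by
      rw [jacobiGauss, jacobiGauss, jacobiGauss,
        ← sum_range_mul_of_coprime hab (by omega) (by omega)]
      · refine sum_congr rfl fun x _ => ?_
        simp only [addE_eq_stdAddChar]
        rw [huv, jacobiSym.mul_right' _ (by omega) (by omega)]
        push_cast
        rw [show (h : ZMod a) * x * u = h * u * x by ring,
          show (h : ZMod b) * x * v = h * v * x by ring]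
        ring
      · intro x
        simp only [addE_eq_stdAddChar]
        congr 2
        · apply jacobiSym_congr; push_cast; rfl
        · push_cast; rfl
      · intro x
        simp only [addE_eq_stdAddChar]
        congr 2
        · apply jacobiSym_congr; push_cast; rfl
        · push_cast; rfl
    rw [this, norm_mul, Nat.cast_mul, Real.sqrt_mul (by positivity)]
    exact mul_le_mul (iha _) (ihb _) (norm_nonneg _) (Real.sqrt_nonneg _)

lemma addE_add (k : ℕ) (i j : ℤ) : addE k (i + j) = addE k i * addE k j := by
  rw [addE, addE, addE, ← Complex.exp_add]
  congr 1
  push_cast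
  ring

lemma addE_mul_natCast (k : ℕ) (j : ℤ) (n : ℕ) : addE k (j * n) = addE k j ^ n := by
  rw [addE, addE, ← Complex.exp_nat_mul]
  congr 1
  push_cast
  ring

lemma addE_eq_exp (k : ℕ) (j : ℤ) :
    addE k j = Complex.exp (Complex.I * ((2 * Real.pi * j / k : ℝ) : ℂ)) := by
  rw [addE]
  congr 1
  push_cast
  ring

lemma norm_addE (k : ℕ) (j : ℤ) : ‖addE k j‖ = 1 := by
  rw [addE_eq_exp, mul_comm, Complex.norm_exp_ofReal_mul_I]

lemma sum_addE (k : ℕ) (hk : k ≠ 0) (j : ℤ) :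
    ∑ h ∈ range k, addE k (h * j) = if (k : ℤ) ∣ j then (k : ℂ) else 0 := by
  have : NeZero k := ⟨hk⟩
  have h1 := AddChar.sum_mulShift (R := ZMod k) (R' := ℂ) (ψ := ZMod.stdAddChar (N := k))
    (j : ZMod k) (ZMod.isPrimitive_stdAddChar k)
  rw [← sum_range_natCast_zmod, ZMod.card] at h1
  simp only [addE_eq_stdAddChar]
  push_cast
  rw [h1]
  simp only [ZMod.intCast_zmod_eq_zero_iff_dvd, Nat.cast_ite, Nat.cast_zero]

lemma norm_addE_sub_one_ge (k h : ℕ) (h0 : 0 < h) (hk : h < k) :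
    2 / ‖addE k (-(h : ℤ)) - 1‖ ≤ k / (2 * h) + k / (2 * (k - h)) := by
  have hk0 : (0 : ℝ) < k := by exact_mod_cast h0.trans hk
  have hh : (0 : ℝ) < h := by exact_mod_cast h0
  have hkh : (0 : ℝ) < (k : ℝ) - h := by
    have : (h : ℝ) < k := by exact_mod_cast hk
    linarith
  have hpi := Real.pi_pos
  have e1 : ‖addE k (-(h : ℤ)) - 1‖ = 2 * |Real.sin (Real.pi * h / k)| := by
    rw [addE_eq_exp, Complex.norm_exp_I_mul_ofReal_sub_one, Real.norm_eq_abs, abs_mul]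
    rw [show 2 * Real.pi * ((-(h : ℤ) : ℤ) : ℝ) / k / 2 = -(Real.pi * h / k) by
      push_cast; ring]
    rw [Real.sin_neg, abs_neg, abs_of_pos (by norm_num : (0 : ℝ) < 2)]
  rw [e1]
  have a1 : (0 : ℝ) ≤ k / (2 * h) := by positivity
  have a2 : (0 : ℝ) ≤ k / (2 * (k - h)) := by positivity
  rcases le_total (2 * (h : ℝ)) k with hc | hc
  · have := Real.mul_le_sin (x := Real.pi * h / k) (by positivity) (by
      rw [div_le_div_iff₀ hk0 (by norm_num)]; nlinarith)
    have s : 2 * (h : ℝ) / k ≤ Real.sin (Real.pi * h / k) := by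
      refine le_trans (le_of_eq ?_) this
      field_simp
    have : 2 / (2 * |Real.sin (Real.pi * h / k)|) ≤ k / (2 * h) := by
      rw [abs_of_pos (lt_of_lt_of_le (by positivity) s)]
      rw [show (k : ℝ) / (2 * h) = 2 / (2 * (2 * (h : ℝ) / k)) by field_simp]
      gcongr
    linarith
  · have := Real.mul_le_sin (x := Real.pi * (k - h) / k) (by positivity) (by
      rw [div_le_div_iff₀ hk0 (by norm_num)]; nlinarith)
    have s : 2 * ((k : ℝ) - h) / k ≤ Real.sin (Real.pi * h / k) := by
      rw [← Real.sin_pi_sub, show Real.pi - Real.pi * h / k = Real.pi * (k - h) / k by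
        field_simp]
      refine le_trans (le_of_eq ?_) this
      field_simp
    have : 2 / (2 * |Real.sin (Real.pi * h / k)|) ≤ k / (2 * (k - h)) := by
      rw [abs_of_pos (lt_of_lt_of_le (by positivity) s)]
      rw [show (k : ℝ) / (2 * (k - h)) = 2 / (2 * (2 * ((k : ℝ) - h) / k)) by field_simp]
      gcongr
    linarith

lemma norm_sum_addE_le (k h : ℕ) (h0 : 0 < h) (hk : h < k) (N : ℤ) (X : ℕ) :
    ‖∑ i ∈ range X, addE k (-(h * (N + i)))‖ ≤ k / (2 * h) + k / (2 * (k - h)) := by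
  refine le_trans ?_ (norm_addE_sub_one_ge k h h0 hk)
  have hne : addE k (-(h : ℤ)) ≠ 1 := by
    intro h1
    have hk' : NeZero k := ⟨by omega⟩
    rw [addE_eq_stdAddChar, ← AddChar.map_zero_eq_one (ZMod.stdAddChar (N := k))] at h1
    have := ZMod.injective_stdAddChar h1
    rw [ZMod.intCast_zmod_eq_zero_iff_dvd, dvd_neg, Int.natCast_dvd_natCast] at this
    exact absurd (Nat.le_of_dvd h0 this) (by omega)
  have : ∀ i ∈ range X, addE k (-(h * (N + i))) = addE k (-(h * N)) * addE k (-(h : ℤ)) ^ i := by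
    intro i _
    rw [← addE_mul_natCast, ← addE_add]
    congr 1
    ring
  rw [sum_congr rfl this, ← mul_sum, geom_sum_eq hne, norm_mul, norm_addE, one_mul, norm_div]
  gcongr
  refine (norm_sub_le _ _).trans ?_
  rw [norm_pow, norm_addE]
  norm_num

/-- The Pólya–Vinogradov inequality for Jacobi symbols. -/
lemma abs_sum_jacobiSym_le_polya_vinogradov (k : ℕ) (hk : Odd k) (hs : Squarefree k) (h1 : 1 < k)
    (N : ℤ) (X : ℕ) :
    |∑ i ∈ range X, ((jacobiSym (N + i) k : ℤ) : ℝ)| ≤ Real.sqrt k * (1 + Real.log k) := by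
  have hk0 : (k : ℂ) ≠ 0 := by exact_mod_cast (by omega : k ≠ 0)
  have hkR : (0 : ℝ) < k := by exact_mod_cast (by omega : 0 < k)
  have key : (k : ℂ) * ∑ i ∈ range X, (jacobiSym (N + i) k : ℂ) =
      ∑ h ∈ range k, jacobiGauss k h * ∑ i ∈ range X, addE k (-(h * (N + i))) := by
    have : ∀ i ∈ range X, (k : ℂ) * (jacobiSym (N + i) k : ℂ) =
        ∑ x ∈ range k, (jacobiSym x k : ℂ) * ∑ h ∈ range k, addE k (h * (x - (N + i))) := by
      intro i _
      have hlt : ((N + i) % k).toNat < k := by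
        have := Int.emod_lt_of_pos (N + i) (by omega : (0 : ℤ) < k)
        have := Int.emod_nonneg (N + i) (by omega : (k : ℤ) ≠ 0)
        omega
      have hcast : ((((N + i) % k).toNat : ℕ) : ℤ) = (N + i) % k :=
        Int.toNat_of_nonneg (Int.emod_nonneg _ (by omega))
      rw [sum_eq_single_of_mem ((N + i) % k).toNat (mem_range.2 hlt)]
      · rw [sum_addE k (by omega), if_pos, hcast, ← jacobiSym.mod_left, mul_comm]
        rw [hcast]
        exact (Int.mod_modEq _ _).symm.dvd
      · intro x hx hne
        rw [sum_addE k (by omega), if_neg, mul_zero]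
        intro hd
        apply hne
        have : (N + i) % k = x % k := Int.modEq_iff_dvd.2 hd
        rw [Int.emod_eq_of_lt (a := (x : ℤ)) (by omega)
          (by exact_mod_cast mem_range.1 hx)] at this
        rw [this]; simp
    rw [mul_sum, sum_congr rfl this]
    simp only [jacobiGauss, sum_mul_sum]
    simp only [mul_sum]
    rw [sum_comm, sum_congr rfl fun x _ => sum_comm, sum_comm]
    refine sum_congr rfl fun h _ => ?_
    refine sum_congr rfl fun x _ => ?_
    refine sum_congr rfl fun i _ => ?_
    rw [mul_assoc, ← addE_add]
    congr 2
    ring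
  have hnorm : (k : ℝ) * |∑ i ∈ range X, ((jacobiSym (N + i) k : ℤ) : ℝ)| ≤
      ∑ h ∈ Ico 1 k, Real.sqrt k * (k / (2 * h) + k / (2 * (k - h))) := by
    have e : (k : ℝ) * |∑ i ∈ range X, ((jacobiSym (N + i) k : ℤ) : ℝ)| =
        ‖(k : ℂ) * ∑ i ∈ range X, (jacobiSym (N + i) k : ℂ)‖ := by
      rw [norm_mul, Complex.norm_natCast, ← Real.norm_eq_abs, ← Complex.norm_real]
      congr 2
      push_cast
      rfl
    rw [e, key, range_eq_Ico, sum_eq_sum_Ico_succ_bot (by omega)]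
    have z : jacobiGauss k ((0 : ℕ) : ℤ) = 0 := by
      have z := sum_jacobiSym_eq_zero k hk hs h1
      have z' : ∑ x ∈ range k, (jacobiSym x k : ℂ) = 0 := by exact_mod_cast z
      rw [← z', jacobiGauss]
      simp [addE]
    rw [z, zero_mul, zero_add]
    refine (norm_sum_le _ _).trans (sum_le_sum fun h hh => ?_)
    rw [mem_Ico] at hh
    rw [norm_mul]
    exact mul_le_mul (norm_jacobiGauss_le k hk hs h) (norm_sum_addE_le k h hh.1 hh.2 N X)
      (norm_nonneg _) (Real.sqrt_nonneg _)
  have hsum : ∑ h ∈ Ico 1 k, Real.sqrt k * ((k : ℝ) / (2 * h) + k / (2 * (k - h))) =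
      Real.sqrt k * k * ∑ h ∈ Ico 1 k, ((h : ℝ))⁻¹ := by
    have r : ∑ h ∈ Ico 1 k, ((k : ℝ) - h)⁻¹ = ∑ h ∈ Ico 1 k, ((h : ℝ))⁻¹ := by
      refine sum_nbij' (fun h => k - h) (fun h => k - h) ?_ ?_ ?_ ?_ ?_
      · intro h hh; simp only [mem_Ico] at hh ⊢; omega
      · intro h hh; simp only [mem_Ico] at hh ⊢; omega
      · intro h hh; simp only [mem_Ico] at hh; omega
      · intro h hh; simp only [mem_Ico] at hh; omega
      · intro h hh
        simp only [mem_Ico] at hh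
        rw [Nat.cast_sub hh.2.le]
    rw [← mul_sum, sum_add_distrib]
    have a : ∑ h ∈ Ico 1 k, (k : ℝ) / (2 * h) = k / 2 * ∑ h ∈ Ico 1 k, ((h : ℝ))⁻¹ := by
      rw [mul_sum]
      refine sum_congr rfl fun h _ => ?_
      rw [div_mul_eq_div_div, div_eq_mul_inv]
    have b : ∑ h ∈ Ico 1 k, (k : ℝ) / (2 * (k - h)) = k / 2 * ∑ h ∈ Ico 1 k, ((h : ℝ))⁻¹ := by
      rw [← r, mul_sum]
      refine sum_congr rfl fun h _ => ?_
      rw [div_mul_eq_div_div, div_eq_mul_inv]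
    rw [a, b]
    ring
  have hharm : ∑ h ∈ Ico 1 k, ((h : ℝ))⁻¹ ≤ 1 + Real.log k := by
    have := harmonic_le_one_add_log k
    refine le_trans ?_ this
    rw [harmonic_eq_sum_Icc]
    push_cast
    exact sum_le_sum_of_subset_of_nonneg Ico_subset_Icc_self fun _ _ _ => by positivity
  rw [hsum] at hnorm
  have : (k : ℝ) * |∑ i ∈ range X, ((jacobiSym (N + i) k : ℤ) : ℝ)| ≤
      k * (Real.sqrt k * (1 + Real.log k)) := by
    refine hnorm.trans ?_
    have := Real.sqrt_nonneg k
    calc Real.sqrt k * k * ∑ h ∈ Ico 1 k, ((h : ℝ))⁻¹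
        ≤ Real.sqrt k * k * (1 + Real.log k) := by gcongr
      _ = _ := by ring
  exact le_of_mul_le_mul_left this hkR

/-- The gcd with `k`, with the value `0` at `0`. -/
def gcdOff (k : ℕ) (u : ℤ) : ℕ := if u = 0 then 0 else Int.gcd k u

lemma gcd_mul_three_le (k : ℕ) (hk : k ≠ 0) (a b c : ℤ) (ha : a ≠ 0) (hb : b ≠ 0) (hc : c ≠ 0) :
    Int.gcd k (a * b * c) ≤ gcdOff k a * gcdOff k b * gcdOff k c := by
  rw [gcdOff, gcdOff, gcdOff, if_neg ha, if_neg hb, if_neg hc]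
  simp only [Int.gcd_eq_natAbs, Int.natAbs_natCast, Int.natAbs_mul]
  have h1 := Nat.gcd_mul_right_dvd_mul_gcd k (a.natAbs * b.natAbs) c.natAbs
  have h2 := Nat.gcd_mul_right_dvd_mul_gcd k a.natAbs b.natAbs
  have h3 := h1.trans (Nat.mul_dvd_mul_right h2 _)
  refine Nat.le_of_dvd ?_ h3
  have := Nat.pos_of_ne_zero hk
  exact Nat.mul_pos (Nat.mul_pos (Nat.gcd_pos_of_pos_left _ this)
    (Nat.gcd_pos_of_pos_left _ this)) (Nat.gcd_pos_of_pos_left _ this)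

lemma sum_gcdOff_le (k : ℕ) (hk : k ≠ 0) (V w : ℕ) (hw : w < V) :
    ∑ v ∈ range V, gcdOff k (w - v) ≤ V * k.divisors.card := by
  have h1 : ∀ v ∈ range V, gcdOff k (w - v) ≤
      ∑ d ∈ k.divisors, if v ≠ w ∧ v ≡ w [MOD d] then d else 0 := by
    intro v _
    rw [gcdOff]
    split_ifs with h
    · exact Nat.zero_le _
    · have hmem : Int.gcd k (w - v) ∈ k.divisors := by
        rw [Nat.mem_divisors]
        refine ⟨?_, hk⟩
        have := Int.gcd_dvd_left (k : ℤ) (w - v)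
        exact_mod_cast this
      refine le_trans ?_ (single_le_sum (fun _ _ => Nat.zero_le _) hmem)
      rw [if_pos]
      refine ⟨by rintro rfl; simp at h, ?_⟩
      rw [Nat.modEq_iff_dvd]
      exact Int.gcd_dvd_right _ _
  refine (sum_le_sum h1).trans ?_
  rw [sum_comm]
  have h2 : ∀ d ∈ k.divisors,
      ∑ v ∈ range V, (if v ≠ w ∧ v ≡ w [MOD d] then d else 0) ≤ V := by
    intro d hd
    have hd0 : 0 < d := Nat.pos_of_mem_divisors hd
    rw [← sum_filter, sum_const, smul_eq_mul]
    have hc := Nat.count_modEq_card V hd0 w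
    rw [Nat.count_eq_card_filter_range] at hc
    have he : {v ∈ range V | v ≠ w ∧ v ≡ w [MOD d]} = {v ∈ range V | v ≡ w [MOD d]}.erase w := by
      ext v
      simp only [mem_filter, mem_erase]
      tauto
    rw [he, card_erase_of_mem (by simp [hw, Nat.ModEq.refl])]
    have : #{v ∈ range V | v ≡ w [MOD d]} - 1 ≤ V / d := by
      rw [hc]
      generalize V / d = y
      split_ifs <;> omega
    calc _ ≤ V / d * d := Nat.mul_le_mul_right _ this
      _ ≤ V := Nat.div_mul_le_self V d
  refine (sum_le_sum h2).trans ?_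
  rw [sum_const, smul_eq_mul, mul_comm]

lemma abs_shiftSum_le_cases (k : ℕ) (hk : Odd k) (hs : Squarefree k) (a b c d : ℤ) :
    |((shiftSum k a b c d : ℤ) : ℝ)| ≤
      k * ((if a = b ∧ c = d then 1 else 0) + (if a = c ∧ b = d then 1 else 0) +
        (if a = d ∧ b = c then 1 else 0)) +
      42 ^ k.primeFactors.card * Real.sqrt k *
        (gcdOff k (a - b) * gcdOff k (a - c) * gcdOff k (a - d) +
          gcdOff k (b - a) * gcdOff k (b - c) * gcdOff k (b - d) +
          gcdOff k (c - a) * gcdOff k (c - b) * gcdOff k (c - d) +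
          gcdOff k (d - a) * gcdOff k (d - b) * gcdOff k (d - c)) := by
  set E : ℝ := 42 ^ k.primeFactors.card * Real.sqrt k with hE
  have hE0 : 0 ≤ E := by positivity
  have hk0 : k ≠ 0 := by rintro rfl; simp at hk
  have aux : ∀ a b c d : ℤ, a ≠ b → a ≠ c → a ≠ d → |((shiftSum k a b c d : ℤ) : ℝ)| ≤
      E * (gcdOff k (a - b) * gcdOff k (a - c) * gcdOff k (a - d)) := by
    intro a b c d hab hac had
    refine (abs_shiftSum_le k hk hs a b c d).trans ?_
    have := gcd_mul_three_le k hk0 (a - b) (a - c) (a - d) (sub_ne_zero.2 hab)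
      (sub_ne_zero.2 hac) (sub_ne_zero.2 had)
    gcongr
    exact_mod_cast this
  have pos : ∀ a b c d : ℤ,
      0 ≤ (gcdOff k (a - b) * gcdOff k (a - c) * gcdOff k (a - d) : ℝ) := by
    intros; positivity
  have i1 : (0 : ℝ) ≤ if a = b ∧ c = d then 1 else 0 := by split_ifs <;> norm_num
  have i2 : (0 : ℝ) ≤ if a = c ∧ b = d then 1 else 0 := by split_ifs <;> norm_num
  have i3 : (0 : ℝ) ≤ if a = d ∧ b = c then 1 else 0 := by split_ifs <;> norm_num
  have hkk : (0 : ℝ) ≤ k := by positivity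
  have p1 := mul_nonneg hE0 (pos a b c d)
  have p2 := mul_nonneg hE0 (pos b a c d)
  have p3 := mul_nonneg hE0 (pos c a b d)
  have p4 := mul_nonneg hE0 (pos d a b c)
  have q1 := mul_nonneg hkk i1
  have q2 := mul_nonneg hkk i2
  have q3 := mul_nonneg hkk i3
  rw [mul_add, mul_add, mul_add, mul_add, mul_add]
  by_cases ha : a ≠ b ∧ a ≠ c ∧ a ≠ d
  · linarith [aux a b c d ha.1 ha.2.1 ha.2.2]
  by_cases hb : b ≠ a ∧ b ≠ c ∧ b ≠ d
  · have e : shiftSum k a b c d = shiftSum k b a c d := by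
      simp only [shiftSum]
      exact sum_congr rfl fun x _ => by congr 1; ring
    rw [e]
    linarith [aux b a c d hb.1 hb.2.1 hb.2.2]
  by_cases hc : c ≠ a ∧ c ≠ b ∧ c ≠ d
  · have e : shiftSum k a b c d = shiftSum k c a b d := by
      simp only [shiftSum]
      exact sum_congr rfl fun x _ => by congr 1; ring
    rw [e]
    linarith [aux c a b d hc.1 hc.2.1 hc.2.2]
  by_cases hd : d ≠ a ∧ d ≠ b ∧ d ≠ c
  · have e : shiftSum k a b c d = shiftSum k d a b c := by
      simp only [shiftSum]
      exact sum_congr rfl fun x _ => by congr 1; ring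
    rw [e]
    linarith [aux d a b c hd.1 hd.2.1 hd.2.2]
  have triv := abs_shiftSum_le_self k a b c d
  have : (a = b ∧ c = d) ∨ (a = c ∧ b = d) ∨ (a = d ∧ b = c) := by omega
  rcases this with h | h | h
  · rw [if_pos h, mul_one] at q1 ⊢; linarith
  · rw [if_pos h, mul_one] at q2 ⊢; linarith
  · rw [if_pos h, mul_one] at q3 ⊢; linarith

lemma sum_gcdOff_triple_le (k : ℕ) (hk : k ≠ 0) (V : ℕ) :
    ∑ a ∈ range V, ∑ b ∈ range V, ∑ c ∈ range V, ∑ d ∈ range V,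
      ((gcdOff k (a - b) : ℝ) * gcdOff k (a - c) * gcdOff k (a - d)) ≤
      (k.divisors.card : ℝ) ^ 3 * V ^ 4 := by
  have : ∀ a ∈ range V, ∑ b ∈ range V, ∑ c ∈ range V, ∑ d ∈ range V,
      ((gcdOff k (a - b) : ℝ) * gcdOff k (a - c) * gcdOff k (a - d)) ≤
      (V * k.divisors.card : ℝ) ^ 3 := by
    intro a ha
    have e : ∑ b ∈ range V, ∑ c ∈ range V, ∑ d ∈ range V,
      ((gcdOff k (a - b) : ℝ) * gcdOff k (a - c) * gcdOff k (a - d)) =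
      (∑ b ∈ range V, (gcdOff k (a - b) : ℝ)) ^ 3 := by
      rw [pow_three', sum_mul_sum, sum_mul]
      refine sum_congr rfl fun b _ => ?_
      rw [sum_mul_sum]
    rw [e]
    have h := sum_gcdOff_le k hk V a (mem_range.1 ha)
    have h' : ∑ b ∈ range V, (gcdOff k (a - b) : ℝ) ≤ V * k.divisors.card := by exact_mod_cast h
    gcongr
  refine (sum_le_sum this).trans (le_of_eq ?_)
  rw [sum_const, card_range, nsmul_eq_mul]
  ring

/-- The fourth moment of short sums of the Jacobi symbol. -/
lemma fourth_moment_le (k : ℕ) (hk : Odd k) (hs : Squarefree k) (V : ℕ) :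
    ∑ x ∈ range k, (∑ v ∈ range V, ((jacobiSym (x + v) k : ℤ) : ℝ)) ^ 4 ≤
      3 * k * V ^ 2 + 4 * (42 ^ k.primeFactors.card * Real.sqrt k) *
        (k.divisors.card : ℝ) ^ 3 * V ^ 4 := by
  have hk0 : k ≠ 0 := by rintro rfl; simp at hk
  have e : ∑ x ∈ range k, (∑ v ∈ range V, ((jacobiSym (x + v) k : ℤ) : ℝ)) ^ 4 =
      ∑ a ∈ range V, ∑ b ∈ range V, ∑ c ∈ range V, ∑ d ∈ range V,
        ((shiftSum k a b c d : ℤ) : ℝ) := by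
    have : ∀ x ∈ range k, (∑ v ∈ range V, ((jacobiSym (x + v) k : ℤ) : ℝ)) ^ 4 =
        ∑ a ∈ range V, ∑ b ∈ range V, ∑ c ∈ range V, ∑ d ∈ range V,
        ((jacobiSym ((x + a) * (x + b) * (x + c) * (x + d)) k : ℤ) : ℝ) := by
      intro x _
      simp only [jacobiSym.mul_left, Int.cast_mul]
      rw [show ∀ y : ℝ, y ^ 4 = y * y * y * y by intro y; ring, sum_mul_sum, sum_mul, sum_mul]
      refine sum_congr rfl fun a _ => ?_
      rw [sum_mul_sum, sum_mul]
      refine sum_congr rfl fun b _ => ?_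
      rw [sum_mul_sum]
    rw [sum_congr rfl this, sum_comm]
    refine sum_congr rfl fun a _ => ?_
    rw [sum_comm]
    refine sum_congr rfl fun b _ => ?_
    rw [sum_comm]
    refine sum_congr rfl fun c _ => ?_
    rw [sum_comm]
    refine sum_congr rfl fun d _ => ?_
    rw [shiftSum]
    push_cast
    rfl
  rw [e]
  set E : ℝ := 42 ^ k.primeFactors.card * Real.sqrt k with hE
  have hE0 : 0 ≤ E := by positivity
  have bound : ∀ a ∈ range V, ∀ b ∈ range V, ∀ c ∈ range V, ∀ d ∈ range V,
    ((shiftSum k a b c d : ℤ) : ℝ) ≤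
      k * ((if a = b ∧ c = d then 1 else 0) + (if a = c ∧ b = d then 1 else 0) +
        (if a = d ∧ b = c then 1 else 0)) +
      E * (gcdOff k (a - b) * gcdOff k (a - c) * gcdOff k (a - d) +
          gcdOff k (b - a) * gcdOff k (b - c) * gcdOff k (b - d) +
          gcdOff k (c - a) * gcdOff k (c - b) * gcdOff k (c - d) +
          gcdOff k (d - a) * gcdOff k (d - b) * gcdOff k (d - c)) := by
    intro a _ b _ c _ d _
    have := (le_abs_self _).trans (abs_shiftSum_le_cases k hk hs a b c d)
    simpa only [Nat.cast_inj] using this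
  refine (sum_le_sum fun a ha => sum_le_sum fun b hb => sum_le_sum fun c hc =>
    sum_le_sum fun d hd => bound a ha b hb c hc d hd).trans ?_
  have pull : ∀ (y : ℝ) (f : ℕ → ℕ → ℕ → ℕ → ℝ),
      ∑ a ∈ range V, ∑ b ∈ range V, ∑ c ∈ range V, ∑ d ∈ range V, y * f a b c d =
      y * ∑ a ∈ range V, ∑ b ∈ range V, ∑ c ∈ range V, ∑ d ∈ range V, f a b c d := by
    intros
    simp only [mul_sum]
  simp only [mul_add, sum_add_distrib, pull]
  have d1 : ∑ a ∈ range V, ∑ b ∈ range V, ∑ c ∈ range V, ∑ d ∈ range V,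
      (if a = b ∧ c = d then (1 : ℝ) else 0) = V ^ 2 := by
    simp only [ite_and, sum_ite_irrel, sum_const_zero, sum_ite_eq, mem_range]
    simp +contextual [sum_ite, sq, filter_true_of_mem (s := range V) (p := fun x => x < V)]
  have d2 : ∑ a ∈ range V, ∑ b ∈ range V, ∑ c ∈ range V, ∑ d ∈ range V,
      (if a = c ∧ b = d then (1 : ℝ) else 0) = V ^ 2 := by
    rw [← d1]
    refine sum_congr rfl fun a _ => ?_
    rw [sum_comm]
  have d3 : ∑ a ∈ range V, ∑ b ∈ range V, ∑ c ∈ range V, ∑ d ∈ range V,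
      (if a = d ∧ b = c then (1 : ℝ) else 0) = V ^ 2 := by
    rw [← d2]
    refine sum_congr rfl fun a _ => sum_congr rfl fun b _ => ?_
    rw [sum_comm]
  rw [d1, d2, d3]
  have g1 := sum_gcdOff_triple_le k hk0 V
  have g2 : ∑ a ∈ range V, ∑ b ∈ range V, ∑ c ∈ range V, ∑ d ∈ range V,
      ((gcdOff k (b - a) : ℝ) * gcdOff k (b - c) * gcdOff k (b - d)) ≤
      (k.divisors.card : ℝ) ^ 3 * V ^ 4 := by
    rw [sum_comm]; exact g1
  have g3 : ∑ a ∈ range V, ∑ b ∈ range V, ∑ c ∈ range V, ∑ d ∈ range V,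
      ((gcdOff k (c - a) : ℝ) * gcdOff k (c - b) * gcdOff k (c - d)) ≤
      (k.divisors.card : ℝ) ^ 3 * V ^ 4 := by
    refine le_trans (le_of_eq ?_) g2
    refine sum_congr rfl fun a _ => ?_
    rw [sum_comm]
  have g4 : ∑ a ∈ range V, ∑ b ∈ range V, ∑ c ∈ range V, ∑ d ∈ range V,
      ((gcdOff k (d - a) : ℝ) * gcdOff k (d - b) * gcdOff k (d - c)) ≤
      (k.divisors.card : ℝ) ^ 3 * V ^ 4 := by
    refine le_trans (le_of_eq ?_) g3
    refine sum_congr rfl fun a _ => sum_congr rfl fun b _ => ?_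
    rw [sum_comm]
  have := mul_le_mul_of_nonneg_left (add_le_add (add_le_add (add_le_add g1 g2) g3) g4) hE0
  linarith

lemma exists_prod_primeFactors_le (C ε : ℝ) (hC : 1 ≤ C) (hε : 0 < ε) :
    ∃ K : ℝ, 1 ≤ K ∧ ∀ n : ℕ, n ≠ 0 →
      ∏ p ∈ n.primeFactors, (C * (n.factorization p + 1)) ≤ K * (n : ℝ) ^ ε := by
  set P := ⌈(2 * C) ^ (1 / ε)⌉₊ with hP
  have hl2 : 0 < Real.log 2 := Real.log_pos (by norm_num)
  set M := C * (1 + 1 / (ε * Real.log 2)) with hM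
  have hM1 : 1 ≤ M := by
    have : 0 < 1 / (ε * Real.log 2) := by positivity
    nlinarith
  refine ⟨M ^ P, one_le_pow₀ hM1, fun n hn => ?_⟩
  have hfac : (n : ℝ) ^ ε = ∏ p ∈ n.primeFactors, (p : ℝ) ^ (ε * n.factorization p) := by
    conv_lhs => rw [← Nat.prod_factorization_pow_eq_self hn]
    rw [Finsupp.prod, Nat.support_factorization, Nat.cast_prod,
      ← Real.finsetProd_rpow _ _ (fun _ _ => by positivity)]
    refine prod_congr rfl fun p _ => ?_
    rw [Nat.cast_pow, ← Real.rpow_natCast, ← Real.rpow_mul (by positivity), mul_comm]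
  have hloc : ∀ p ∈ n.primeFactors, C * (n.factorization p + 1) ≤
      (if p < P then M else 1) * (p : ℝ) ^ (ε * n.factorization p) := by
    intro p hp
    have hpp := Nat.prime_of_mem_primeFactors hp
    set v := n.factorization p with hv
    have hp2 : (2 : ℝ) ≤ p := by exact_mod_cast hpp.two_le
    split_ifs with hlt
    · have h1 : (2 : ℝ) ^ (ε * v) ≤ (p : ℝ) ^ (ε * v) :=
        Real.rpow_le_rpow (by norm_num) hp2 (by positivity)
      have h2 : 1 + ε * v * Real.log 2 ≤ (2 : ℝ) ^ (ε * v) := by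
        rw [Real.rpow_def_of_pos (by norm_num)]
        have := Real.add_one_le_exp (Real.log 2 * (ε * v))
        linarith
      have h3 : (v : ℝ) + 1 ≤ (1 + 1 / (ε * Real.log 2)) * (1 + ε * v * Real.log 2) := by
        have : (1 + 1 / (ε * Real.log 2)) * (1 + ε * v * Real.log 2) =
          1 + v + ε * v * Real.log 2 + 1 / (ε * Real.log 2) := by
            field_simp
            ring
        rw [this]
        have a1 : 0 ≤ ε * v * Real.log 2 := by positivity
        have a2 : 0 ≤ 1 / (ε * Real.log 2) := by positivity
        linarith
      calc C * (v + 1) ≤ C * ((1 + 1 / (ε * Real.log 2)) * (1 + ε * v * Real.log 2)) := by gcongr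
        _ = M * (1 + ε * v * Real.log 2) := by rw [hM]; ring
        _ ≤ M * (p : ℝ) ^ (ε * v) := by gcongr; linarith
    · rw [one_mul]
      push Not at hlt
      have h1 : 2 * C ≤ (p : ℝ) ^ ε := by
        have h2 : (2 * C) ^ (1 / ε) ≤ (p : ℝ) := (Nat.le_ceil _).trans (by exact_mod_cast hlt)
        have h3 := Real.rpow_le_rpow (by positivity) h2 hε.le
        rwa [← Real.rpow_mul (by positivity), one_div_mul_cancel hε.ne', Real.rpow_one] at h3
      have hv1 : 1 ≤ v := (hpp.dvd_iff_one_le_factorization hn).1 (Nat.dvd_of_mem_primeFactors hp)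
      rw [Real.rpow_mul (by positivity), Real.rpow_natCast]
      calc C * (v + 1) ≤ C ^ v * 2 ^ v := by
            have h4 : (v : ℝ) + 1 ≤ 2 ^ v := by
              exact_mod_cast (Nat.lt_two_pow_self (n := v))
            have h5 : C ≤ C ^ v := le_self_pow₀ hC (by omega)
            gcongr
        _ = (2 * C) ^ v := by rw [mul_pow]; ring
        _ ≤ _ := by gcongr
  calc ∏ p ∈ n.primeFactors, (C * (n.factorization p + 1))
      ≤ ∏ p ∈ n.primeFactors, ((if p < P then M else 1) * (p : ℝ) ^ (ε * n.factorization p)) :=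
        prod_le_prod (fun _ _ => by positivity) hloc
    _ = (∏ p ∈ n.primeFactors, if p < P then M else 1) * (n : ℝ) ^ ε := by
        rw [prod_mul_distrib, hfac]
    _ ≤ M ^ P * (n : ℝ) ^ ε := by
        gcongr
        rw [prod_ite, prod_const, prod_const_one, mul_one]
        refine pow_le_pow_right₀ hM1 ?_
        calc _ ≤ #(range P) := card_le_card fun p hp => by
              simp only [mem_filter] at hp; simpa using hp.2
          _ = P := card_range P

lemma exists_pow_card_primeFactors_le (C ε : ℝ) (hC : 1 ≤ C) (hε : 0 < ε) :
    ∃ K : ℝ, 1 ≤ K ∧ ∀ n : ℕ, n ≠ 0 → C ^ n.primeFactors.card ≤ K * (n : ℝ) ^ ε := by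
  obtain ⟨K, hK, h⟩ := exists_prod_primeFactors_le C ε hC hε
  refine ⟨K, hK, fun n hn => le_trans ?_ (h n hn)⟩
  rw [← prod_const]
  refine prod_le_prod (fun _ _ => by positivity) fun p _ => ?_
  have : (0 : ℝ) ≤ n.factorization p := by positivity
  nlinarith

lemma exists_card_divisors_le (ε : ℝ) (hε : 0 < ε) :
    ∃ K : ℝ, 1 ≤ K ∧ ∀ n : ℕ, n ≠ 0 → (n.divisors.card : ℝ) ≤ K * (n : ℝ) ^ ε := by
  obtain ⟨K, hK, h⟩ := exists_prod_primeFactors_le 1 ε le_rfl hε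
  refine ⟨K, hK, fun n hn => le_trans (le_of_eq ?_) (h n hn)⟩
  rw [Nat.card_divisors hn]
  push_cast
  simp

lemma one_add_log_le (ε : ℝ) (hε : 0 < ε) (k : ℕ) (hk : 1 ≤ k) :
    1 + Real.log k ≤ (1 + 1 / ε) * (k : ℝ) ^ ε := by
  have h := Real.log_le_rpow_div (x := k) (by positivity) hε
  have h1 : (1 : ℝ) ≤ (k : ℝ) ^ ε := Real.one_le_rpow (by exact_mod_cast hk) hε.le
  calc 1 + Real.log k ≤ (k : ℝ) ^ ε + (k : ℝ) ^ ε / ε := by linarith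
    _ = _ := by ring

lemma pow_four_sum_mul_le {ι : Type*} (s : Finset ι) (f g : ι → ℝ) (hf : ∀ x, 0 ≤ f x)
    (hg : ∀ x, 0 ≤ g x) :
    (∑ x ∈ s, f x * g x) ^ 4 ≤
      (∑ x ∈ s, f x) ^ 2 * (∑ x ∈ s, f x ^ 2) * ∑ x ∈ s, g x ^ 4 := by
  have h1 : (∑ x ∈ s, f x * g x) ^ 2 ≤ (∑ x ∈ s, f x) * ∑ x ∈ s, f x * g x ^ 2 := by
    have := sum_mul_sq_le_sq_mul_sq s (fun x => √(f x)) (fun x => √(f x) * g x)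
    refine le_trans (le_of_eq ?_) (this.trans (le_of_eq ?_))
    · congr 1
      refine sum_congr rfl fun x _ => ?_
      rw [← mul_assoc, Real.mul_self_sqrt (hf x)]
    · congr 1
      · exact sum_congr rfl fun x _ => Real.sq_sqrt (hf x)
      · exact sum_congr rfl fun x _ => by rw [mul_pow, Real.sq_sqrt (hf x)]
  have h2 : (∑ x ∈ s, f x * g x ^ 2) ^ 2 ≤ (∑ x ∈ s, f x ^ 2) * ∑ x ∈ s, g x ^ 4 := by
    have := sum_mul_sq_le_sq_mul_sq s f (fun x => g x ^ 2)
    simpa only [← pow_mul] using this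
  have h0 : 0 ≤ ∑ x ∈ s, f x * g x := sum_nonneg fun x _ => mul_nonneg (hf x) (hg x)
  calc (∑ x ∈ s, f x * g x) ^ 4 = ((∑ x ∈ s, f x * g x) ^ 2) ^ 2 := by ring
    _ ≤ ((∑ x ∈ s, f x) * ∑ x ∈ s, f x * g x ^ 2) ^ 2 := by gcongr
    _ = (∑ x ∈ s, f x) ^ 2 * (∑ x ∈ s, f x * g x ^ 2) ^ 2 := by ring
    _ ≤ (∑ x ∈ s, f x) ^ 2 * ((∑ x ∈ s, f x ^ 2) * ∑ x ∈ s, g x ^ 4) := by gcongr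
    _ = _ := by ring

lemma two_pow_card_primeFactors_le (k : ℕ) (hk : k ≠ 0) :
    2 ^ k.primeFactors.card ≤ k.divisors.card := by
  rw [Nat.card_divisors hk, ← prod_const]
  refine prod_le_prod' fun p hp => ?_
  have := ((Nat.prime_of_mem_primeFactors hp).dvd_iff_one_le_factorization hk).1
    (Nat.dvd_of_mem_primeFactors hp)
  omega

lemma sum_divisors_moebius (n : ℕ) :
    ∑ d ∈ n.divisors, ArithmeticFunction.moebius d = if n = 1 then 1 else 0 := by
  rw [← ArithmeticFunction.coe_mul_zeta_apply, ArithmeticFunction.moebius_mul_coe_zeta,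
    ArithmeticFunction.one_apply]

lemma card_coprime_Ioc_ge (k : ℕ) (hs : Squarefree k) (A : ℕ)
    (hA : 2 * k.divisors.card ^ 2 ≤ A) :
    (A : ℝ) / (2 * k.divisors.card) ≤ #{a ∈ Ioc A (2 * A) | a.Coprime k} := by
  have hk : k ≠ 0 := hs.ne_zero
  set t := k.divisors.card with ht
  have ht1 : (1 : ℝ) ≤ t := by
    have : 0 < t := card_pos.2 ⟨1, by simp [hk]⟩
    exact_mod_cast this
  have e1 : (#{a ∈ Ioc A (2 * A) | a.Coprime k} : ℤ) =
      ∑ d ∈ k.divisors, ArithmeticFunction.moebius d * #{a ∈ Ioc A (2 * A) | d ∣ a} := by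
    have : ∀ a ∈ Ioc A (2 * A), (if a.Coprime k then (1 : ℤ) else 0) =
        ∑ d ∈ k.divisors, if d ∣ a then ArithmeticFunction.moebius d else 0 := by
      intro a ha
      have hz := sum_divisors_moebius (a.gcd k)
      simp only [Nat.coprime_iff_gcd_eq_one]
      rw [← hz, ← sum_filter]
      refine sum_congr ?_ fun _ _ => rfl
      ext d
      simp only [Nat.mem_divisors, mem_filter, Nat.dvd_gcd_iff, ne_eq, Nat.gcd_eq_zero_iff]
      tauto
    rw [card_filter]
    push_cast
    rw [sum_congr rfl this, sum_comm]
    refine sum_congr rfl fun d _ => ?_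
    rw [← sum_filter, sum_const, nsmul_eq_mul, mul_comm]
  have e2 : ∀ d ∈ k.divisors, ((A : ℝ) * ((ArithmeticFunction.moebius d : ℝ) * ((d : ℝ)⁻¹)) - 1 ≤
      (ArithmeticFunction.moebius d : ℝ) * #{a ∈ Ioc A (2 * A) | d ∣ a}) := by
    intro d hd
    have hd0 : 0 < d := Nat.pos_of_mem_divisors hd
    have hc : (#{a ∈ Ioc A (2 * A) | d ∣ a} : ℕ) + A / d = 2 * A / d := by
      rw [← Nat.Ioc_filter_dvd_card_eq_div, ← Nat.Ioc_filter_dvd_card_eq_div,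
        ← card_union_of_disjoint, ← filter_union, union_comm, Ioc_union_Ioc_eq_Ioc (by omega)
        (by omega)]
      refine disjoint_filter_filter ?_
      rw [disjoint_left]
      intro x hx hy
      rw [mem_Ioc] at hx hy
      omega
    have hc' : (#{a ∈ Ioc A (2 * A) | d ∣ a} : ℝ) + (A / d : ℕ) = (2 * A / d : ℕ) := by
      exact_mod_cast hc
    have hdR : (0 : ℝ) < d := by exact_mod_cast hd0
    have b1 : ((A / d : ℕ) : ℝ) ≤ A / d := Nat.cast_div_le
    have b2 : ((2 * A / d : ℕ) : ℝ) ≤ 2 * A / d := by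
      have := Nat.cast_div_le (α := ℝ) (m := 2 * A) (n := d)
      push_cast at this; exact this
    have b3 : (A : ℝ) / d < (A / d : ℕ) + 1 := by
      rw [div_lt_iff₀ hdR]
      have := Nat.lt_div_mul_add (a := A) hd0
      have h : A < (A / d + 1) * d := by linarith
      exact_mod_cast h
    have b4 : 2 * (A : ℝ) / d < (2 * A / d : ℕ) + 1 := by
      rw [div_lt_iff₀ hdR]
      have := Nat.lt_div_mul_add (a := 2 * A) hd0
      have h : 2 * A < (2 * A / d + 1) * d := by linarith
      exact_mod_cast h
    have e : (A : ℝ) * ((d : ℝ)⁻¹) = A / d := by rw [div_eq_mul_inv]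
    have hm := ArithmeticFunction.abs_moebius_le_one (n := d)
    have hm' : (ArithmeticFunction.moebius d : ℤ) = 0 ∨ ArithmeticFunction.moebius d = 1 ∨
        ArithmeticFunction.moebius d = -1 := by rw [abs_le] at hm; omega
    have e' : 2 * (A : ℝ) / d = A / d + A / d := by ring
    rcases hm' with h | h | h <;> rw [h] <;> push_cast <;> nlinarith
  have e3 : ∑ d ∈ k.divisors, (ArithmeticFunction.moebius d : ℝ) * ((d : ℝ)⁻¹) =
      ∏ p ∈ k.primeFactors, (1 - ((p : ℝ)⁻¹)) := by
    have hmul : ArithmeticFunction.IsMultiplicative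
        (⟨fun n => ((n : ℝ)⁻¹), by simp⟩ : ArithmeticFunction ℝ) := by
      refine ⟨by simp, fun {m n} _ => ?_⟩
      simp [mul_comm]
    have := hmul.prodPrimeFactors_one_sub_of_squarefree _ hs
    simpa using this.symm
  have e4 : (1 : ℝ) / t ≤ ∏ p ∈ k.primeFactors, (1 - ((p : ℝ)⁻¹)) := by
    have h1 : ∏ p ∈ k.primeFactors, (1 / 2 : ℝ) ≤ ∏ p ∈ k.primeFactors, (1 - ((p : ℝ)⁻¹)) := by
      refine prod_le_prod (fun _ _ => by norm_num) fun p hp => ?_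
      have : (2 : ℝ) ≤ p := by exact_mod_cast (Nat.prime_of_mem_primeFactors hp).two_le
      have : (p : ℝ)⁻¹ ≤ 2⁻¹ := by gcongr
      linarith
    refine le_trans ?_ h1
    rw [prod_const, one_div_pow]
    have := two_pow_card_primeFactors_le k hk
    have h2 : (2 : ℝ) ^ k.primeFactors.card ≤ t := by exact_mod_cast this
    gcongr
  have e5 : (A : ℝ) * (1 / t) - t ≤ #{a ∈ Ioc A (2 * A) | a.Coprime k} := by
    have e1' : (#{a ∈ Ioc A (2 * A) | a.Coprime k} : ℝ) =
      ∑ d ∈ k.divisors, (ArithmeticFunction.moebius d : ℝ) * #{a ∈ Ioc A (2 * A) | d ∣ a} := by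
      exact_mod_cast e1
    rw [e1']
    refine le_trans ?_ (sum_le_sum e2)
    rw [sum_sub_distrib, ← mul_sum, e3, sum_const, nsmul_eq_mul, mul_one]
    gcongr
  refine le_trans ?_ e5
  have hA' : 2 * (t : ℝ) ^ 2 ≤ A := by exact_mod_cast hA
  have : (t : ℝ) ≤ A / (2 * t) := by
    rw [le_div_iff₀ (by positivity)]; nlinarith
  have e : (A : ℝ) * (1 / t) = A / (2 * t) + A / (2 * t) := by field_simp; ring
  linarith

/-- The sum of the Jacobi symbol modulo `k` over the `X` integers from `N` on. -/
noncomputable def charSum (k : ℕ) (N : ℤ) (X : ℕ) : ℝ :=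
  ∑ i ∈ range X, ((jacobiSym (N + i) k : ℤ) : ℝ)

lemma charSum_add (k : ℕ) (N : ℤ) (X Y : ℕ) :
    charSum k N (X + Y) = charSum k N X + charSum k (N + X) Y := by
  rw [charSum, sum_range_add]
  congr 1
  refine sum_congr rfl fun i _ => ?_
  push_cast
  rw [add_assoc]

lemma charSum_shift (k : ℕ) (N : ℤ) (X h : ℕ) :
    charSum k N X = charSum k (N + h) X + (charSum k N h - charSum k (N + X) h) := by
  have h1 := charSum_add k N X h
  have h2 := charSum_add k N h X
  rw [add_comm h X] at h2
  linarith

lemma abs_charSum_le (k : ℕ) (N : ℤ) (X : ℕ) : |charSum k N X| ≤ X := by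
  refine (abs_sum_le_sum_abs _ _).trans ((sum_le_sum fun i _ => abs_jacobiSym_le _ _).trans ?_)
  simp

lemma sum_gcd_Ioc_le (A : ℕ) (T : ℝ)
    (hT : ∀ a ∈ Ioc A (2 * A), (a.divisors.card : ℝ) ≤ T) :
    ∑ a ∈ Ioc A (2 * A), ∑ b ∈ Ioc A (2 * A), (Nat.gcd a b : ℝ) ≤ 2 * A ^ 2 * T := by
  have h : ∀ a ∈ Ioc A (2 * A), ∑ b ∈ Ioc A (2 * A), (Nat.gcd a b : ℝ) ≤ 2 * A * T := by
    intro a ha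
    have ha0 : a ≠ 0 := by rw [mem_Ioc] at ha; omega
    have h1 : ∑ b ∈ Ioc A (2 * A), Nat.gcd a b ≤ a.divisors.card * (2 * A) := by
      calc ∑ b ∈ Ioc A (2 * A), Nat.gcd a b
          ≤ ∑ b ∈ Ioc A (2 * A), ∑ d ∈ a.divisors, if d ∣ b then d else 0 := by
            refine sum_le_sum fun b _ => ?_
            refine le_trans ?_ (single_le_sum (fun _ _ => Nat.zero_le _)
              (Nat.mem_divisors.2 ⟨Nat.gcd_dvd_left a b, ha0⟩))
            rw [if_pos (Nat.gcd_dvd_right a b)]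
        _ = ∑ d ∈ a.divisors, ∑ b ∈ Ioc A (2 * A), if d ∣ b then d else 0 := sum_comm
        _ ≤ ∑ d ∈ a.divisors, 2 * A := by
            refine sum_le_sum fun d _ => ?_
            rw [← sum_filter, sum_const, smul_eq_mul]
            calc _ ≤ #{b ∈ Ioc 0 (2 * A) | d ∣ b} * d := by
                  gcongr
                  omega
              _ ≤ 2 * A := by
                  rw [Nat.Ioc_filter_dvd_card_eq_div]
                  exact Nat.div_mul_le_self _ _
        _ = _ := by rw [sum_const, smul_eq_mul]
    have h2 : ∑ b ∈ Ioc A (2 * A), (Nat.gcd a b : ℝ) ≤ a.divisors.card * (2 * A) := by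
      exact_mod_cast h1
    have := hT a ha
    have hA : (0 : ℝ) ≤ A := by positivity
    nlinarith
  refine (sum_le_sum h).trans (le_of_eq ?_)
  rw [sum_const, Nat.card_Ioc, nsmul_eq_mul, show 2 * A - A = A by omega]
  ring

lemma card_window_le (k A X : ℕ) (hk : 4 * A * X < k) (N : ℤ) (a b : ℕ)
    (ha : a ∈ Ioc A (2 * A)) (hb : b ∈ Ioc A (2 * A)) :
    (#{p ∈ range X ×ˢ range X | (k : ℤ) ∣ b * (N + (p.1 : ℕ)) - a * (N + (p.2 : ℕ))} : ℝ) ≤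
      X * Nat.gcd a b / A + 1 := by
  rw [mem_Ioc] at ha hb
  set S := {p ∈ range X ×ˢ range X | (k : ℤ) ∣ b * (N + (p.1 : ℕ)) - a * (N + (p.2 : ℕ))} with hS
  have hA0 : 0 < A := by omega
  rcases S.eq_empty_or_nonempty with he | ⟨⟨i₀, j₀⟩, h₀⟩
  · rw [he]; simp only [card_empty, Nat.cast_zero]; positivity
  have key : ∀ p ∈ S, (b : ℤ) * ((p.1 : ℤ) - i₀) = a * ((p.2 : ℤ) - j₀) := by
    rintro ⟨i, j⟩ hp
    simp only [hS, mem_filter, mem_product, mem_range] at hp h₀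
    have hd := dvd_sub hp.2 h₀.2
    have e : (b : ℤ) * (N + i) - a * (N + j) - (b * (N + i₀) - a * (N + j₀)) =
      b * ((i : ℤ) - i₀) - a * ((j : ℤ) - j₀) := by ring
    rw [e] at hd
    have hlt : |(b : ℤ) * ((i : ℤ) - i₀) - a * ((j : ℤ) - j₀)| < k := by
      have b1 : |(i : ℤ) - i₀| ≤ X := by rw [abs_le]; constructor <;> omega
      have b2 : |(j : ℤ) - j₀| ≤ X := by rw [abs_le]; constructor <;> omega
      calc |(b : ℤ) * ((i : ℤ) - i₀) - a * ((j : ℤ) - j₀)|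
          ≤ |(b : ℤ) * ((i : ℤ) - i₀)| + |(a : ℤ) * ((j : ℤ) - j₀)| := abs_sub _ _
        _ ≤ 2 * A * X + 2 * A * X := by
            rw [abs_mul, abs_mul, Nat.abs_cast, Nat.abs_cast]
            have : (a : ℤ) ≤ 2 * A := by exact_mod_cast ha.2
            have : (b : ℤ) ≤ 2 * A := by exact_mod_cast hb.2
            gcongr
        _ < k := by
            have : (4 * A * X : ℤ) < k := by exact_mod_cast hk
            linarith
    have := Int.eq_zero_of_abs_lt_dvd hd hlt
    linarith
  set g := Nat.gcd a b with hg
  have hg0 : 0 < g := Nat.gcd_pos_of_pos_left _ (by omega)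
  obtain ⟨a', ha'⟩ : g ∣ a := Nat.gcd_dvd_left a b
  obtain ⟨b', hb'⟩ : g ∣ b := Nat.gcd_dvd_right a b
  have hcop : a'.Coprime b' := by
    have := Nat.coprime_div_gcd_div_gcd (m := a) (n := b) hg0
    rw [← hg] at this
    rwa [show a / g = a' from Nat.div_eq_of_eq_mul_right hg0 ha',
      show b / g = b' from Nat.div_eq_of_eq_mul_right hg0 hb'] at this
  have ha'0 : 0 < a' := by
    rcases Nat.eq_zero_or_pos a' with h | h
    · rw [h] at ha'; omega
    · exact h
  have hcard : #S ≤ #{i ∈ range X | i ≡ i₀ [MOD a']} := by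
    refine card_le_card_of_injOn Prod.fst ?_ ?_
    · intro p hp
      have hk' := key p hp
      simp only [hS, coe_filter, Set.mem_ofPred_eq, mem_product, mem_range] at hp
      simp only [coe_filter, Set.mem_ofPred_eq, mem_range]
      refine ⟨hp.1.1, ?_⟩
      have h1 : (b' : ℤ) * ((p.1 : ℤ) - i₀) = a' * ((p.2 : ℤ) - j₀) := by
        have hgz : (g : ℤ) ≠ 0 := by exact_mod_cast hg0.ne'
        rw [ha', hb'] at hk'
        push_cast at hk'
        apply mul_left_cancel₀ hgz
        linarith
      have h2 : (a' : ℤ) ∣ b' * ((p.1 : ℤ) - i₀) := ⟨_, h1⟩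
      have h3 : IsCoprime (a' : ℤ) b' := Nat.isCoprime_iff_coprime.2 hcop
      have h4 := h3.dvd_of_dvd_mul_left h2
      exact (Nat.modEq_iff_dvd.2 h4).symm
    · rintro ⟨i, j⟩ hp ⟨i', j'⟩ hp' (h : i = i')
      have h1 := key _ hp
      have h2 := key _ hp'
      simp only at h1 h2
      rw [← h, h1] at h2
      have haz : (a : ℤ) ≠ 0 := by omega
      have := mul_left_cancel₀ haz h2
      have : j = j' := by omega
      rw [h, this]
  have hc := Nat.count_modEq_card X ha'0 i₀
  rw [Nat.count_eq_card_filter_range] at hc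
  have h1 : #S ≤ X / a' + 1 := by
    refine hcard.trans ?_
    rw [hc]
    generalize X / a' = y
    split_ifs <;> omega
  have h2 : (#S : ℝ) ≤ (X / a' : ℕ) + 1 := by exact_mod_cast h1
  refine h2.trans ?_
  have h3 : ((X / a' : ℕ) : ℝ) ≤ X / a' := Nat.cast_div_le
  have h4 : (X : ℝ) / a' = X * g / a := by
    rw [ha']; push_cast
    have : (g : ℝ) ≠ 0 := by exact_mod_cast hg0.ne'
    have : (a' : ℝ) ≠ 0 := by exact_mod_cast ha'0.ne'
    field_simp
  have h5 : (X : ℝ) * g / a ≤ X * g / A := by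
    have : (A : ℝ) ≤ a := by exact_mod_cast ha.1.le
    have : (0 : ℝ) < A := by exact_mod_cast hA0
    gcongr
  linarith

/-- The residue `(N + i) / a` attached to the pair `(a, i)`. -/
def quotRes (k : ℕ) (N : ℤ) (p : ℕ × ℕ) : ZMod k := (p.1 : ZMod k)⁻¹ * ((N + p.2 : ℤ) : ZMod k)

/-- The number of representations as a quotient. -/
noncomputable def repCount (k : ℕ) (N : ℤ) (S : Finset ℕ) (X : ℕ) (x : ZMod k) : ℝ :=
  (#{p ∈ S ×ˢ range X | quotRes k N p = x} : ℝ)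

lemma sum_repCount (k : ℕ) [NeZero k] (N : ℤ) (S : Finset ℕ) (X : ℕ) :
    ∑ x, repCount k N S X x = S.card * X := by
  have := sum_fiberwise (s := S ×ˢ range X) (g := quotRes k N) (f := fun _ => (1 : ℝ))
  simp only [sum_const, nsmul_eq_mul, mul_one, card_product, card_range] at this
  rw [← Nat.cast_mul, ← this]
  rfl

lemma mul_quotRes (k : ℕ) (N : ℤ) (a i : ℕ) (ha : a.Coprime k) :
    (a : ZMod k) * quotRes k N (a, i) = ((N + i : ℤ) : ZMod k) := by
  rw [quotRes, ← mul_assoc, ZMod.coe_mul_inv_eq_one a ha, one_mul]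

lemma sum_repCount_sq_le (k A X : ℕ) [NeZero k] (hk : 4 * A * X < k) (hAX : A ≤ X) (hA : 0 < A)
    (N : ℤ) (T : ℝ)
    (hT : ∀ a ∈ Ioc A (2 * A), (a.divisors.card : ℝ) ≤ T) :
    ∑ x, repCount k N {a ∈ Ioc A (2 * A) | a.Coprime k} X x ^ 2 ≤ 3 * A * X * T := by
  set S := {a ∈ Ioc A (2 * A) | a.Coprime k} with hS
  have e1 : ∑ x, repCount k N S X x ^ 2 =
      ∑ p ∈ S ×ˢ range X, ∑ q ∈ S ×ˢ range X,
        if quotRes k N p = quotRes k N q then (1 : ℝ) else 0 := by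
    have : ∀ x, repCount k N S X x ^ 2 = ∑ p ∈ S ×ˢ range X, ∑ q ∈ S ×ˢ range X,
        if quotRes k N p = x ∧ quotRes k N q = x then (1 : ℝ) else 0 := by
      intro x
      rw [repCount, card_filter, sq]
      push_cast
      rw [sum_mul_sum]
      refine sum_congr rfl fun p _ => sum_congr rfl fun q _ => ?_
      rw [ite_and]
      split_ifs <;> simp
    rw [sum_congr rfl fun x _ => this x, sum_comm]
    refine sum_congr rfl fun p _ => ?_
    rw [sum_comm]
    refine sum_congr rfl fun q _ => ?_
    simp only [ite_and, sum_ite_eq, mem_univ, if_true]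
    simp only [eq_comm]
  rw [e1]
  have e2 : ∑ p ∈ S ×ˢ range X, ∑ q ∈ S ×ˢ range X,
        (if quotRes k N p = quotRes k N q then (1 : ℝ) else 0) =
      ∑ a ∈ S, ∑ b ∈ S, ∑ i ∈ range X, ∑ j ∈ range X,
        if quotRes k N (a, i) = quotRes k N (b, j) then (1 : ℝ) else 0 := by
    rw [sum_product]
    refine sum_congr rfl fun a _ => ?_
    rw [sum_congr rfl fun i _ => sum_product _ _ _, sum_comm]
  have e3 : ∀ a ∈ S, ∀ b ∈ S, ∑ i ∈ range X, ∑ j ∈ range X,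
        (if quotRes k N (a, i) = quotRes k N (b, j) then (1 : ℝ) else 0) ≤
        X * Nat.gcd a b / A + 1 := by
    intro a ha b hb
    rw [hS, mem_filter] at ha hb
    refine le_trans ?_ (card_window_le k A X hk N a b ha.1 hb.1)
    rw [card_filter, sum_product]
    push_cast
    refine sum_le_sum fun i _ => sum_le_sum fun j _ => ?_
    split_ifs with h1 h2 h2
    · exact le_rfl
    · exfalso
      apply h2
      rw [← ZMod.intCast_zmod_eq_zero_iff_dvd]
      push_cast
      have hi := mul_quotRes k N a i ha.2
      have hj := mul_quotRes k N b j hb.2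
      push_cast at hi hj
      rw [← hi, ← hj, h1]
      ring
    · norm_num
    · exact le_rfl
  have hX0 : (0 : ℝ) < A := by exact_mod_cast hA
  have hT0 : 1 ≤ T := by
    refine le_trans ?_ (hT (2 * A) (by rw [mem_Ioc]; omega))
    have : 0 < (2 * A).divisors.card := card_pos.2 ⟨1, by simp; omega⟩
    exact_mod_cast this
  have hAX' : (A : ℝ) ≤ X := by exact_mod_cast hAX
  calc _ = _ := e2
    _ ≤ ∑ a ∈ S, ∑ b ∈ S, ((X : ℝ) * Nat.gcd a b / A + 1) :=
        sum_le_sum fun a ha => sum_le_sum fun b hb => e3 a ha b hb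
    _ ≤ ∑ a ∈ Ioc A (2 * A), ∑ b ∈ Ioc A (2 * A), ((X : ℝ) * Nat.gcd a b / A + 1) := by
        have hsub : S ⊆ Ioc A (2 * A) := filter_subset _ _
        calc _ ≤ ∑ a ∈ S, ∑ b ∈ Ioc A (2 * A), ((X : ℝ) * Nat.gcd a b / A + 1) :=
              sum_le_sum fun a _ => sum_le_sum_of_subset_of_nonneg hsub
                fun _ _ _ => by positivity
          _ ≤ _ := sum_le_sum_of_subset_of_nonneg hsub
              fun _ _ _ => sum_nonneg fun _ _ => by positivity
    _ = X / A * (∑ a ∈ Ioc A (2 * A), ∑ b ∈ Ioc A (2 * A), (Nat.gcd a b : ℝ)) + A * A := by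
        simp only [sum_add_distrib, mul_sum]
        congr 1
        · exact sum_congr rfl fun a _ => sum_congr rfl fun b _ => by ring
        · simp only [sum_const, Nat.card_Ioc, nsmul_eq_mul, mul_one]
          rw [show 2 * A - A = A by omega]
    _ ≤ X / A * (2 * A ^ 2 * T) + A * A := by
        gcongr
        exact sum_gcd_Ioc_le A T hT
    _ = 2 * A * X * T + A * A := by field_simp
    _ ≤ 3 * A * X * T := by nlinarith [mul_le_mul hAX' hT0 (by norm_num) (by positivity)]

/-- Averaging a character sum over the shifts by products. -/
lemma charSum_average_le (k : ℕ) [NeZero k] (N : ℤ) (S : Finset ℕ) (X B : ℕ)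
    (hS : ∀ a ∈ S, a.Coprime k) (E : ℝ)
    (hE : ∀ a ∈ S, ∀ b ∈ range B, ∀ N, |charSum k N (a * b)| ≤ E) :
    S.card * B * |charSum k N X| ≤ S.card * B * (2 * E) +
      ∑ x, repCount k N S X x * |charSum k (x.val : ℤ) B| := by
  have h1 : (S.card : ℝ) * B * charSum k N X =
      ∑ a ∈ S, ∑ b ∈ range B, charSum k (N + (a * b : ℕ)) X +
      ∑ a ∈ S, ∑ b ∈ range B, (charSum k N (a * b) - charSum k (N + X) (a * b)) := by
    rw [← sum_add_distrib]
    simp only [← sum_add_distrib]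
    rw [sum_congr rfl fun a _ => sum_congr rfl fun b _ => (charSum_shift k N X (a * b)).symm]
    simp only [sum_const, card_range, nsmul_eq_mul]
    ring
  have h2 : |∑ a ∈ S, ∑ b ∈ range B, (charSum k N (a * b) - charSum k (N + X) (a * b))| ≤
      S.card * B * (2 * E) := by
    refine (abs_sum_le_sum_abs _ _).trans ?_
    have : ∀ a ∈ S, |∑ b ∈ range B, (charSum k N (a * b) - charSum k (N + X) (a * b))| ≤
        B * (2 * E) := by
      intro a ha
      refine (abs_sum_le_sum_abs _ _).trans ?_
      refine (sum_le_sum fun b hb => (abs_sub _ _).trans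
        (add_le_add (hE a ha b hb N) (hE a ha b hb (N + X)))).trans (le_of_eq ?_)
      rw [sum_const, card_range, nsmul_eq_mul, two_mul]
    refine (sum_le_sum this).trans (le_of_eq ?_)
    rw [sum_const, nsmul_eq_mul, mul_assoc]
  have h3 : |∑ a ∈ S, ∑ b ∈ range B, charSum k (N + (a * b : ℕ)) X| ≤
      ∑ x, repCount k N S X x * |charSum k (x.val : ℤ) B| := by
    have e : ∀ a ∈ S, ∑ b ∈ range B, charSum k (N + (a * b : ℕ)) X =
        ∑ i ∈ range X, ((jacobiSym a k : ℤ) : ℝ) * charSum k ((quotRes k N (a, i)).val : ℤ) B := by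
      intro a ha
      simp only [charSum, mul_sum]
      rw [sum_comm]
      refine sum_congr rfl fun i _ => sum_congr rfl fun b _ => ?_
      rw [← Int.cast_mul, ← jacobiSym.mul_left]
      congr 1
      apply jacobiSym_congr
      have := mul_quotRes k N a i (hS a ha)
      push_cast at this ⊢
      rw [ZMod.natCast_zmod_val, mul_add, this]
      ring
    rw [sum_congr rfl e]
    have e' : ∑ x, repCount k N S X x * |charSum k (x.val : ℤ) B| =
        ∑ p ∈ S ×ˢ range X, |charSum k ((quotRes k N p).val : ℤ) B| := by
      rw [← sum_fiberwise (s := S ×ˢ range X) (g := quotRes k N)]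
      refine sum_congr rfl fun x _ => ?_
      rw [repCount, ← nsmul_eq_mul, ← sum_const]
      refine sum_congr rfl fun p hp => ?_
      rw [(mem_filter.1 hp).2]
    rw [e', sum_product]
    refine (abs_sum_le_sum_abs _ _).trans (sum_le_sum fun a _ => ?_)
    refine (abs_sum_le_sum_abs _ _).trans (sum_le_sum fun i _ => ?_)
    rw [abs_mul]
    have := abs_jacobiSym_le a k
    have := abs_nonneg (charSum k ((quotRes k N (a, i)).val : ℤ) B)
    nlinarith
  have h0 : (0 : ℝ) ≤ S.card * B := by positivity
  calc S.card * B * |charSum k N X| = |S.card * B * charSum k N X| := by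
        rw [abs_mul, abs_of_nonneg h0]
    _ ≤ _ := by
        rw [h1]
        refine (abs_add_le _ _).trans ?_
        linarith

lemma sum_charSum_pow_four_le (k : ℕ) [NeZero k] (hk : Odd k) (hs : Squarefree k) (V : ℕ) :
    ∑ x : ZMod k, |charSum k (x.val : ℤ) V| ^ 4 ≤
      3 * k * V ^ 2 + 4 * (42 ^ k.primeFactors.card * Real.sqrt k) *
        (k.divisors.card : ℝ) ^ 3 * V ^ 4 := by
  refine le_trans (le_of_eq ?_) (fourth_moment_le k hk hs V)
  rw [← sum_range_natCast_zmod]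
  refine sum_congr rfl fun x hx => ?_
  rw [ZMod.val_cast_of_lt (mem_range.1 hx), Even.pow_abs (by decide)]
  rfl

set_option maxHeartbeats 1000000 in
/-- The Burgess bound for Jacobi symbols, with second-moment amplification. -/
theorem abs_charSum_le_burgess (k : ℕ) (hk : Odd k) (hs : Squarefree k) (h1 : 1 < k) (T M : ℝ)
    (hT : ∀ a, 1 ≤ a → a ≤ k → (a.divisors.card : ℝ) ≤ T) (hM1 : 1 + Real.log k ≤ M)
    (hM2 : 10 ^ 6 * (T * 42 ^ k.primeFactors.card * (k.divisors.card : ℝ) ^ 5) ≤ M) :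
    ∀ (X : ℕ) (N : ℤ),
      |charSum k N X| ≤ M * ((k : ℝ) ^ ((1 : ℝ) / 16)) ^ 3 * Real.sqrt X := by
  have hNZ : NeZero k := ⟨by omega⟩
  set r : ℝ := (k : ℝ) ^ ((1 : ℝ) / 16) with hr
  have hk1 : (1 : ℝ) ≤ k := by exact_mod_cast h1.le
  have hr1 : 1 ≤ r := Real.one_le_rpow hk1 (by norm_num)
  have hrk : r ^ 16 = k := by
    rw [hr, ← Real.rpow_natCast, ← Real.rpow_mul (by positivity)]
    norm_num
  have hsqrt : Real.sqrt k = r ^ 8 := by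
    rw [← hrk, show r ^ 16 = (r ^ 8) ^ 2 by ring]
    exact Real.sqrt_sq (by positivity)
  set t : ℝ := (k.divisors.card : ℝ) with ht
  set w : ℝ := 42 ^ k.primeFactors.card with hw
  have ht1 : (1 : ℝ) ≤ t := by
    have : 0 < k.divisors.card := card_pos.2 ⟨1, by simp; omega⟩
    rw [ht]; exact_mod_cast this
  have hw1 : (1 : ℝ) ≤ w := one_le_pow₀ (by norm_num)
  have hT1 : (1 : ℝ) ≤ T := ht1.trans (hT k h1.le le_rfl)
  have ht5 : t ^ 2 ≤ t ^ 5 := pow_le_pow_right₀ ht1 (by norm_num)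
  set L : ℝ := T * w * t ^ 5 with hL
  have hLt : t ^ 2 ≤ L := by
    have : 1 ≤ T * w := one_le_mul_of_one_le_of_one_le hT1 hw1
    have h0 : 0 ≤ t ^ 5 := by positivity
    rw [hL]; nlinarith
  have ht21 : 1 ≤ t ^ 2 := one_le_pow₀ ht1
  have hM1' : 1 ≤ M := by linarith [Real.log_nonneg hk1]
  intro X
  induction X using Nat.strong_induction_on with
  | _ X ih =>
  intro N
  set y : ℝ := Real.sqrt X with hy
  have hy2 : y ^ 2 = X := Real.sq_sqrt (by positivity)
  have hy0 : 0 ≤ y := Real.sqrt_nonneg _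
  rcases le_or_gt (r ^ 5) y with hbig | hbig
  · refine (abs_sum_jacobiSym_le_polya_vinogradov k hk hs h1 N X).trans ?_
    rw [hsqrt]
    have hlog : 0 ≤ 1 + Real.log k := by linarith [Real.log_nonneg hk1]
    calc r ^ 8 * (1 + Real.log k) = (1 + Real.log k) * r ^ 3 * r ^ 5 := by ring
      _ ≤ M * r ^ 3 * y := by gcongr
  rcases le_or_gt y (M * r ^ 3) with hsmall | hsmall
  · refine (abs_charSum_le k N X).trans ?_
    rw [← hy2]
    nlinarith
  set B := Nat.sqrt (Nat.sqrt k) with hB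
  have hB4 : B ^ 4 ≤ k := by
    have a1 := Nat.sqrt_le' k
    have a2 := Nat.sqrt_le' (Nat.sqrt k)
    calc B ^ 4 = (B ^ 2) ^ 2 := by ring
      _ ≤ (Nat.sqrt k) ^ 2 := Nat.pow_le_pow_left a2 2
      _ ≤ k := a1
  have hB1 : 1 ≤ B := by
    rw [hB, Nat.le_sqrt, Nat.le_sqrt]; omega
  have hB4' : k < (2 * B) ^ 4 := by
    have a1 := Nat.lt_succ_sqrt' k
    have a2 := Nat.lt_succ_sqrt' (Nat.sqrt k)
    calc k < (Nat.sqrt k + 1) ^ 2 := a1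
      _ ≤ ((B + 1) ^ 2) ^ 2 := Nat.pow_le_pow_left a2 2
      _ ≤ ((2 * B) ^ 2) ^ 2 := by gcongr; omega
      _ = _ := by ring
  have hBr : (B : ℝ) ≤ r ^ 4 := by
    refine le_of_pow_le_pow_left₀ (n := 4) (by norm_num) (by positivity) ?_
    rw [← pow_mul, hrk]; exact_mod_cast hB4
  have hBr' : r ^ 4 ≤ 2 * B := by
    refine le_of_pow_le_pow_left₀ (n := 4) (by norm_num) (by positivity) ?_
    rw [← pow_mul, hrk]; exact_mod_cast hB4'.le
  have hB1' : (1 : ℝ) ≤ B := by exact_mod_cast hB1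
  set A := X / (32 * B) with hA
  have hA1 : 32 * A * B ≤ X := by
    have := Nat.div_mul_le_self X (32 * B)
    calc 32 * A * B = X / (32 * B) * (32 * B) := by rw [hA]; ring
      _ ≤ X := this
  have hA2 : X < 32 * B * (A + 1) := by
    have := Nat.lt_div_mul_add (a := X) (b := 32 * B) (by omega)
    rw [hA]; linarith
  have hA1' : 32 * (A : ℝ) * B ≤ X := by exact_mod_cast hA1
  have hA2' : (X : ℝ) < 32 * B * (A + 1) := by exact_mod_cast hA2
  have hXlow : M ^ 2 * r ^ 6 < X := by
    rw [← hy2]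
    calc M ^ 2 * r ^ 6 = (M * r ^ 3) ^ 2 := by ring
      _ < y ^ 2 := by gcongr
  have hXhigh : (X : ℝ) < r ^ 10 := by
    rw [← hy2]
    calc y ^ 2 < (r ^ 5) ^ 2 := by gcongr
      _ = _ := by ring
  have hAlow : M ^ 2 < 32 * ((A : ℝ) + 1) := by
    have a1 : M ^ 2 * r ^ 4 ≤ M ^ 2 * r ^ 6 := by gcongr; norm_num
    have a2 : 32 * (B : ℝ) * (A + 1) ≤ 32 * (A + 1) * r ^ 4 := by
      calc 32 * (B : ℝ) * (A + 1) = 32 * (A + 1) * B := by ring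
        _ ≤ _ := by gcongr
    have a3 : M ^ 2 * r ^ 4 < 32 * (A + 1) * r ^ 4 := by linarith
    exact lt_of_mul_lt_mul_right a3 (by positivity)
  have hMM : M ≤ M ^ 2 := by nlinarith
  have hAt : 2 * t ^ 2 ≤ A := by linarith
  have hA1'' : (1 : ℝ) ≤ A := by linarith
  have hApos : 0 < A := by exact_mod_cast (by linarith : (0 : ℝ) < A)
  have hX64 : (X : ℝ) ≤ 64 * A * B := by
    calc (X : ℝ) ≤ 32 * B * (A + 1) := hA2'.le
      _ ≤ 32 * B * (A + A) := by gcongr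
      _ = _ := by ring
  have hX1 : 1 ≤ X := by
    have : 0 < A * B := Nat.mul_pos hApos hB1
    rw [mul_assoc] at hA1
    omega
  have hX1' : (1 : ℝ) ≤ X := by exact_mod_cast hX1
  have hwin : 4 * A * X < k := by
    have : (4 * (A : ℝ) * X) < k := by
      rw [← hrk]
      by_contra! hcon
      have b1 : r ^ 16 * (8 * B) ≤ 4 * (A : ℝ) * X * (8 * B) := by gcongr
      have b2 : 4 * (A : ℝ) * X * (8 * B) ≤ X * X := by
        calc 4 * (A : ℝ) * X * (8 * B) = 32 * A * B * X := by ring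
          _ ≤ X * X := by gcongr
      have b3 : (X : ℝ) * X < r ^ 10 * r ^ 10 := by gcongr
      have b4 : r ^ 16 * (4 * r ^ 4) ≤ r ^ 16 * (8 * B) :=
        mul_le_mul_of_nonneg_left (by linarith) (by positivity)
      have b5 : 0 < r ^ 20 := by positivity
      have b6 : r ^ 10 * r ^ 10 = r ^ 20 := by ring
      have b7 : r ^ 16 * (4 * r ^ 4) = 4 * r ^ 20 := by ring
      rw [b7] at b4
      rw [b6] at b3
      linarith
    exact_mod_cast this
  have hAX : A ≤ X := by
    calc A = A * 1 := (mul_one A).symm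
      _ ≤ 32 * A * B := by gcongr; omega
      _ ≤ X := hA1
  set S := {a ∈ Ioc A (2 * A) | a.Coprime k} with hS
  have hTA : ∀ a ∈ Ioc A (2 * A), (a.divisors.card : ℝ) ≤ T := by
    intro a ha
    rw [mem_Ioc] at ha
    refine hT a (by omega) ?_
    calc a ≤ 2 * A := ha.2
      _ ≤ 4 * A * 1 := by omega
      _ ≤ 4 * A * X := by gcongr
      _ ≤ k := hwin.le
  have hcard : (A : ℝ) / (2 * t) ≤ S.card := card_coprime_Ioc_ge k hs A (by
    rw [ht] at hAt; exact_mod_cast hAt)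
  have hcard' : (A : ℝ) ≤ 2 * t * S.card := by
    rw [div_le_iff₀ (by positivity)] at hcard; linarith
  have hspos : (0 : ℝ) < S.card := lt_of_lt_of_le (by positivity) hcard
  have avg := charSum_average_le k N S X B (fun a ha => (mem_filter.1 ha).2) (M * r ^ 3 * (y / 4))
    (by
      intro a ha b hb N
      rw [hS, mem_filter, mem_Ioc] at ha
      rw [mem_range] at hb
      have hab : 16 * (a * b) ≤ X := by
        have : a * b ≤ 2 * A * B := Nat.mul_le_mul ha.1.2 hb.le
        linarith
      refine (ih (a * b) (by omega) N).trans ?_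
      have hab' : 16 * ((a * b : ℕ) : ℝ) ≤ X := by exact_mod_cast hab
      have : Real.sqrt ((a * b : ℕ) : ℝ) ≤ y / 4 := by
        rw [Real.sqrt_le_left (by positivity)]
        rw [div_pow, hy2]; linarith
      gcongr)
  have holder := pow_four_sum_mul_le univ (repCount k N S X)
    (fun x => |charSum k (x.val : ℤ) B|) (fun x => Nat.cast_nonneg _) (fun x => abs_nonneg _)
  rw [sum_repCount] at holder
  have energy := sum_repCount_sq_le k A X hwin hAX hApos N T hTA
  have mom := sum_charSum_pow_four_le k hk hs B
  rw [hsqrt] at mom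
  have mom' : ∑ x : ZMod k, |charSum k (x.val : ℤ) B| ^ 4 ≤ 7 * w * t ^ 3 * r ^ 24 := by
    refine mom.trans ?_
    have c1 : (B : ℝ) ^ 2 ≤ r ^ 8 := by
      calc (B : ℝ) ^ 2 ≤ (r ^ 4) ^ 2 := by gcongr
        _ = _ := by ring
    have c2 : (B : ℝ) ^ 4 ≤ r ^ 16 := by rw [hrk]; exact_mod_cast hB4
    have c3 : 3 * (k : ℝ) * B ^ 2 ≤ 3 * (w * t ^ 3) * r ^ 24 := by
      rw [← hrk]
      have : 1 ≤ w * t ^ 3 := one_le_mul_of_one_le_of_one_le hw1 (one_le_pow₀ ht1)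
      calc 3 * r ^ 16 * (B : ℝ) ^ 2 ≤ 3 * r ^ 16 * r ^ 8 := by gcongr
        _ = 3 * 1 * r ^ 24 := by ring
        _ ≤ _ := by gcongr
    have c4 : 4 * (w * r ^ 8) * t ^ 3 * (B : ℝ) ^ 4 ≤ 4 * (w * r ^ 8) * t ^ 3 * r ^ 16 := by gcongr
    calc _ ≤ 3 * (w * t ^ 3) * r ^ 24 + 4 * (w * r ^ 8) * t ^ 3 * r ^ 16 := add_le_add c3 c4
      _ = _ := by ring
  set Z := ∑ x : ZMod k, repCount k N S X x * |charSum k (x.val : ℤ) B| with hZ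
  set s : ℝ := (S.card : ℝ) with hsdef
  have hT0 : 0 ≤ T := by linarith
  have hZ4 : Z ^ 4 ≤ (s * B * (M * r ^ 3 * (y / 2))) ^ 4 := by
    calc Z ^ 4 ≤ (s * X) ^ 2 * (3 * A * X * T) * (7 * w * t ^ 3 * r ^ 24) := by
          refine holder.trans ?_
          gcongr
      _ = (s ^ 2 * X ^ 2 * r ^ 12) * (21 * A * X * T * w * t ^ 3 * r ^ 12) := by ring
      _ ≤ (s ^ 2 * X ^ 2 * r ^ 12) * (s ^ 2 * B ^ 4 * M ^ 4 / 16) := by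
          gcongr
          have d1 : r ^ 12 ≤ 8 * (B : ℝ) ^ 3 := by
            calc r ^ 12 = (r ^ 4) ^ 3 := by ring
              _ ≤ (2 * (B : ℝ)) ^ 3 := by gcongr
              _ = _ := by ring
          have d2 : 688128 * L ≤ M ^ 4 := by
            have : M ≤ M ^ 4 := le_self_pow₀ hM1' (by norm_num)
            have : 0 ≤ L := by positivity
            linarith
          have d3 : (A : ℝ) * A ≤ 4 * t ^ 2 * s ^ 2 := by
            calc (A : ℝ) * A ≤ (2 * t * s) * (2 * t * s) := by gcongr
              _ = _ := by ring
          refine le_of_mul_le_mul_left ?_ (by positivity : (0 : ℝ) < 16 * 4 * t ^ 2)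
          calc 16 * 4 * t ^ 2 * (21 * A * X * T * w * t ^ 3 * r ^ 12)
              = 1344 * A * X * L * r ^ 12 := by rw [hL]; ring
            _ ≤ 1344 * A * (64 * A * B) * L * (8 * B ^ 3) := by
                have : 0 ≤ L := by positivity
                gcongr
            _ = A * A * B ^ 4 * (688128 * L) := by ring
            _ ≤ (4 * t ^ 2 * s ^ 2) * B ^ 4 * M ^ 4 := by
                gcongr
            _ = _ := by ring
      _ = (s * B * (M * r ^ 3 * (y / 2))) ^ 4 := by
          rw [← hy2]; ring
  have hZ1 : Z ≤ s * B * (M * r ^ 3 * (y / 2)) :=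
    le_of_pow_le_pow_left₀ (n := 4) (by norm_num) (by positivity) hZ4
  have hfin : s * B * |charSum k N X| ≤ s * B * (M * r ^ 3 * y) := by
    refine avg.trans ?_
    calc s * B * (2 * (M * r ^ 3 * (y / 4))) + Z
        ≤ s * B * (2 * (M * r ^ 3 * (y / 4))) + s * B * (M * r ^ 3 * (y / 2)) := by gcongr
      _ = _ := by ring
  exact le_of_mul_le_mul_left hfin (by positivity)

/-- The Burgess bound with an unspecified constant. -/
theorem exists_abs_charSum_le (ε : ℝ) (hε : 0 < ε) : ∃ K : ℝ, 1 ≤ K ∧ ∀ k : ℕ, Odd k →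
    Squarefree k → 1 < k → ∀ (N : ℤ) (X : ℕ),
      |charSum k N X| ≤ K * (k : ℝ) ^ ((3 : ℝ) / 16 + ε) * Real.sqrt X := by
  obtain ⟨K₁, hK₁, h₁⟩ := exists_card_divisors_le (ε / 7) (by positivity)
  obtain ⟨K₂, hK₂, h₂⟩ := exists_pow_card_primeFactors_le 42 (ε / 7) (by norm_num) (by positivity)
  set K := 10 ^ 6 * (K₁ * K₂ * K₁ ^ 5) + (1 + 1 / ε) with hK
  have hK1 : 1 ≤ K := by
    have : 0 ≤ 1 / ε := by positivity
    have : 0 ≤ 10 ^ 6 * (K₁ * K₂ * K₁ ^ 5) := by positivity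
    linarith
  refine ⟨K, hK1, fun k hk hs h1 N X => ?_⟩
  have hk1 : (1 : ℝ) ≤ k := by exact_mod_cast h1.le
  have hk0 : k ≠ 0 := by omega
  set u : ℝ := (k : ℝ) ^ (ε / 7) with hu
  have hu1 : 1 ≤ u := Real.one_le_rpow hk1 (by positivity)
  have hu7 : u ^ 7 = (k : ℝ) ^ ε := by
    rw [hu, ← Real.rpow_natCast, ← Real.rpow_mul (by positivity)]
    congr 1
    push_cast
    field_simp
  have := abs_charSum_le_burgess k hk hs h1 (K₁ * u) (K * (k : ℝ) ^ ε) ?_ ?_ ?_ X N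
  · refine this.trans (le_of_eq ?_)
    rw [← Real.rpow_natCast, ← Real.rpow_mul (by positivity), mul_assoc K,
      ← Real.rpow_add (by positivity)]
    congr 3
    push_cast
    ring
  · intro a ha hak
    refine (h₁ a (by omega)).trans ?_
    have : (a : ℝ) ≤ k := by exact_mod_cast hak
    rw [hu]
    gcongr
  · refine (one_add_log_le ε hε k h1.le).trans ?_
    have : 0 ≤ 10 ^ 6 * (K₁ * K₂ * K₁ ^ 5) := by positivity
    gcongr
    linarith
  · rw [← hu7]
    have a1 := h₁ k hk0
    have a2 := h₂ k hk0
    rw [← hu] at a1 a2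
    calc 10 ^ 6 * (K₁ * u * 42 ^ k.primeFactors.card * (k.divisors.card : ℝ) ^ 5)
        ≤ 10 ^ 6 * (K₁ * u * (K₂ * u) * (K₁ * u) ^ 5) := by gcongr
      _ = 10 ^ 6 * (K₁ * K₂ * K₁ ^ 5) * u ^ 7 := by ring
      _ ≤ _ := by
        have : 0 ≤ 1 / ε := by positivity
        gcongr
        linarith

/-- The quadratic character attached to `D`, extended by zero to even integers. -/
noncomputable def chi (D : ℤ) (m : ℕ) : ℝ := if Odd m then (jacobiSym D m : ℝ) else 0

lemma chi_one (D : ℤ) : chi D 1 = 1 := by simp [chi]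

lemma chi_mul (D : ℤ) (m n : ℕ) : chi D (m * n) = chi D m * chi D n := by
  unfold chi
  by_cases hm : Odd m
  · by_cases hn : Odd n
    · rw [if_pos hm, if_pos hn, if_pos (hm.mul hn),
        jacobiSym.mul_right' D hm.pos.ne' hn.pos.ne']
      push_cast; rfl
    · rw [if_neg hn, mul_zero, if_neg (fun h => hn (Nat.odd_mul.1 h).2)]
  · rw [if_neg hm, zero_mul, if_neg (fun h => hm (Nat.odd_mul.1 h).1)]

lemma abs_chi_le (D : ℤ) (m : ℕ) : |chi D m| ≤ 1 := by
  unfold chi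
  split_ifs
  · exact_mod_cast abs_jacobiSym_le D m
  · simp

lemma sum_range_mul_eight (f : ℕ → ℝ) (Y : ℕ) :
    ∑ i ∈ range (8 * Y), f i = ∑ s ∈ range 8, ∑ t ∈ range Y, f (8 * t + s) := by
  induction Y with
  | zero => simp
  | succ Y ih =>
    rw [show 8 * (Y + 1) = 8 * Y + 8 by ring, sum_range_add, ih, ← sum_add_distrib]
    exact sum_congr rfl fun s _ => (sum_range_succ _ _).symm

lemma jacobiSym_add_eight {u : ℤ} (hu : 4 * u.natAbs ∣ 8) {m : ℕ} (hm : Odd m) :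
    jacobiSym u (m + 8) = jacobiSym u m := by
  have hm' : Odd (m + 8) := hm.add_even (by decide)
  rw [jacobiSym.mod_right u hm', jacobiSym.mod_right u hm]
  congr 1
  obtain ⟨c, hc⟩ := hu
  rw [hc, Nat.add_mul_mod_self_left]

/-- Quadratic reciprocity turns `chi` into a Jacobi symbol in the variable, up to a factor of
period eight. -/
lemma exists_chi_eq {u : ℤ} (hu : 4 * u.natAbs ∣ 8) {k : ℕ} (hk : Odd k) :
    ∃ c : ℕ → ℝ, (∀ m, |c m| ≤ 1) ∧ (∀ m, c (m + 8) = c m) ∧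
      ∀ m : ℕ, chi (u * k) m = c m * (jacobiSym m k : ℝ) := by
  refine ⟨fun m => if Odd m then (jacobiSym u m : ℝ) * (-1) ^ (k / 2 * (m / 2)) else 0,
    fun m => ?_, fun m => ?_, fun m => ?_⟩
  · dsimp only
    split_ifs
    · rw [abs_mul, abs_pow, abs_neg, abs_one, one_pow, mul_one]
      exact_mod_cast abs_jacobiSym_le u m
    · simp
  · have : Odd (m + 8) ↔ Odd m := by
      simp only [Nat.odd_iff]
      omega
    dsimp only
    by_cases hm : Odd m
    · rw [if_pos hm, if_pos (this.2 hm), jacobiSym_add_eight hu hm,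
        show (m + 8) / 2 = m / 2 + 4 by omega, mul_add, pow_add _ (k / 2 * (m / 2)),
        (show Even (k / 2 * 4) from (by decide : Even 4).mul_left _).neg_one_pow, mul_one]
    · rw [if_neg hm, if_neg (fun h => hm (this.1 h))]
  · unfold chi
    dsimp only
    split_ifs with hm
    · rw [jacobiSym.mul_left, jacobiSym.quadratic_reciprocity hk hm]
      push_cast; ring
    · simp

lemma sum_chi_period_eq_zero {u : ℤ} (hu : u = -1 ∨ u = 2 ∨ u = -2) (a : ℕ) :
    ∑ s ∈ range 8, chi u (a + s) = 0 := by
  have key : ∀ (n : ℕ) [NeZero n] (χ : MulChar (ZMod n) ℤ), (∀ m : ℕ, Odd m → jacobiSym u m = χ m) →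
      (∀ m : ℕ, ¬ Odd m → χ m = 0) → (∀ x : ZMod n, ∑ s ∈ range 8, χ (x + s) = 0) →
      ∑ s ∈ range 8, chi u (a + s) = 0 := by
    intro n _ χ h1 h2 h3
    have : ∀ m : ℕ, chi u m = (χ m : ℝ) := by
      intro m
      unfold chi
      split_ifs with h
      · rw [h1 m h]
      · rw [h2 m h, Int.cast_zero]
    simp only [this, Nat.cast_add]
    exact_mod_cast h3 a
  rcases hu with rfl | rfl | rfl
  · refine key 4 ZMod.χ₄ (fun m hm => jacobiSym.at_neg_one hm) (fun m hm => ?_) (by decide)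
    rw [ZMod.χ₄_nat_eq_if_mod_four, if_pos (by rw [Nat.odd_iff] at hm; omega)]
  · refine key 8 ZMod.χ₈ (fun m hm => jacobiSym.at_two hm) (fun m hm => ?_) (by decide)
    rw [ZMod.χ₈_nat_eq_if_mod_eight, if_pos (by rw [Nat.odd_iff] at hm; omega)]
  · refine key 8 ZMod.χ₈' (fun m hm => jacobiSym.at_neg_two hm) (fun m hm => ?_) (by decide)
    rw [ZMod.χ₈'_nat_eq_if_mod_eight, if_pos (by rw [Nat.odd_iff] at hm; omega)]

lemma exists_eq_unit_mul_odd {D : ℤ} (hD : Squarefree D) :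
    ∃ (u : ℤ) (k : ℕ), (u = 1 ∨ u = -1 ∨ u = 2 ∨ u = -2) ∧ Odd k ∧ Squarefree k ∧ D = u * k := by
  have hN : Squarefree D.natAbs := Int.squarefree_natAbs.2 hD
  have : ∃ (v : ℤ) (k : ℕ), (v = 1 ∨ v = 2) ∧ Odd k ∧ Squarefree k ∧ (D.natAbs : ℤ) = v * k := by
    rcases Nat.even_or_odd D.natAbs with h | h
    · obtain ⟨k, hk⟩ := even_iff_two_dvd.1 h
      have hks : Squarefree k := hN.squarefree_of_dvd ⟨2, by rw [hk]; ring⟩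
      refine ⟨2, k, Or.inr rfl, ?_, hks, by rw [hk]; push_cast; ring⟩
      by_contra hodd
      rw [Nat.not_odd_iff_even] at hodd
      obtain ⟨j, hj⟩ := even_iff_two_dvd.1 hodd
      have := hN 2 ⟨j, by rw [hk, hj]; ring⟩
      rw [Nat.isUnit_iff] at this
      omega
    · exact ⟨1, _, Or.inl rfl, h, hN, by ring⟩
  obtain ⟨v, k, hv, hk, hks, h⟩ := this
  rcases Int.natAbs_eq D with h' | h'
  · exact ⟨v, k, by tauto, hk, hks, by rw [h', h]⟩
  · refine ⟨-v, k, ?_, hk, hks, by rw [h', h]; ring⟩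
    rcases hv with rfl | rfl <;> simp

/-- The Burgess bound for quadratic characters of arbitrary squarefree discriminant. -/
theorem exists_abs_sum_chi_le (ε : ℝ) (hε : 0 < ε) : ∃ K : ℝ, 1 ≤ K ∧ ∀ D : ℤ, Squarefree D →
    D ≠ 1 → ∀ a X : ℕ, |∑ i ∈ range X, chi D (a + i)| ≤
      K * ((|D| : ℤ) : ℝ) ^ ((3 : ℝ) / 16 + ε) * Real.sqrt X := by
  obtain ⟨K, hK, hB⟩ := exists_abs_charSum_le ε hε
  refine ⟨15 * K, by linarith, fun D hD hD1 a X => ?_⟩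
  rcases Nat.eq_zero_or_pos X with rfl | hX
  · simp
  have hX1 : 1 ≤ Real.sqrt X := by
    rw [Real.one_le_sqrt]; exact_mod_cast hX
  set P : ℝ := ((|D| : ℤ) : ℝ) ^ ((3 : ℝ) / 16 + ε) with hP
  have hDabs : (1 : ℝ) ≤ ((|D| : ℤ) : ℝ) := by
    exact_mod_cast Int.one_le_abs hD.ne_zero
  have hP1 : 1 ≤ P := Real.one_le_rpow hDabs (by positivity)
  set Y := X / 8 with hY
  set Z := X % 8 with hZ
  have hXYZ : X = 8 * Y + Z := (Nat.div_add_mod X 8).symm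
  have hZ8 : Z ≤ 7 := by omega
  have hYX : Real.sqrt Y ≤ Real.sqrt X := Real.sqrt_le_sqrt (by exact_mod_cast Nat.div_le_self X 8)
  have hmain : |∑ i ∈ range (8 * Y), chi D (a + i)| ≤ 8 * (K * P * Real.sqrt Y) := by
    obtain ⟨u, k, hu, hk, hks, hDu⟩ := exists_eq_unit_mul_odd hD
    rw [sum_range_mul_eight]
    rcases Nat.lt_or_ge 1 k with hk1 | hk1
    · obtain ⟨c, hc1, hc8, hc⟩ := exists_chi_eq (u := u)
        (by rcases hu with rfl | rfl | rfl | rfl <;> decide) hk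
      have hc8' : ∀ t m, c (8 * t + m) = c m := by
        intro t m
        induction t with
        | zero => simp
        | succ t ih => rw [← ih, ← hc8 (8 * t + m)]; congr 1; ring
      have hcop : Nat.Coprime 8 k := by
        rw [show 8 = 2 ^ 3 by norm_num]
        exact Nat.Coprime.pow_left 3 (Nat.coprime_two_left.2 hk)
      have hinv : (8 : ZMod k) * (8 : ZMod k)⁻¹ = 1 := by
        have := ZMod.coe_mul_inv_eq_one 8 hcop
        exact_mod_cast this
      have hNZ : NeZero k := ⟨by omega⟩
      have each : ∀ s ∈ range 8,
          |∑ t ∈ range Y, chi D (a + (8 * t + s))| ≤ K * P * Real.sqrt Y := by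
        intro s _
        set b : ℤ := ((((a + s : ℕ) : ZMod k) * (8 : ZMod k)⁻¹).val : ℤ) with hb
        have e : ∀ t, chi D (a + (8 * t + s)) =
            c (a + s) * (jacobiSym 8 k : ℝ) * (jacobiSym (b + t) k : ℝ) := by
          intro t
          rw [hDu, hc, show a + (8 * t + s) = 8 * t + (a + s) by ring, hc8', mul_assoc,
            ← Int.cast_mul, ← jacobiSym.mul_left]
          congr 2
          refine jacobiSym_congr ?_
          rw [hb]
          push_cast
          rw [ZMod.natCast_zmod_val]
          linear_combination -((a : ZMod k) + s) * hinv
        rw [sum_congr rfl fun t _ => e t, ← mul_sum, abs_mul, abs_mul]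
        have h8 : |(jacobiSym 8 k : ℝ)| ≤ 1 := by exact_mod_cast abs_jacobiSym_le 8 k
        have hkD : (k : ℝ) ≤ ((|D| : ℤ) : ℝ) := by
          have : (k : ℤ) ≤ |D| := by
            rw [hDu, abs_mul, Nat.abs_cast]
            have : 1 ≤ |u| := by rcases hu with rfl | rfl | rfl | rfl <;> decide
            nlinarith [Int.natCast_nonneg k]
          exact_mod_cast this
        calc |c (a + s)| * |(jacobiSym 8 k : ℝ)| * |charSum k b Y|
            ≤ 1 * 1 * (K * (k : ℝ) ^ ((3 : ℝ) / 16 + ε) * Real.sqrt Y) := by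
              gcongr
              · exact hc1 _
              · exact hB k hk hks hk1 b Y
          _ ≤ 1 * 1 * (K * P * Real.sqrt Y) := by
              rw [hP]
              gcongr
          _ = _ := by ring
      refine (abs_sum_le_sum_abs _ _).trans ((sum_le_sum each).trans ?_)
      simp
    · have hk1' : k = 1 := le_antisymm hk1 hk.pos
      subst hk1'
      rw [Nat.cast_one, mul_one] at hDu
      subst hDu
      rw [sum_comm]
      have : ∀ t ∈ range Y, ∑ s ∈ range 8, chi D (a + (8 * t + s)) = 0 := by
        intro t _
        have := sum_chi_period_eq_zero (u := D) (by tauto) (a + 8 * t)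
        simpa only [add_assoc] using this
      rw [sum_eq_zero this, abs_zero]
      positivity
  have htail : |∑ i ∈ range Z, chi D (a + (8 * Y + i))| ≤ 7 := by
    refine (abs_sum_le_sum_abs _ _).trans ?_
    refine (sum_le_sum fun i _ => abs_chi_le D _).trans ?_
    simp only [sum_const, card_range, nsmul_eq_mul, mul_one]
    exact_mod_cast hZ8
  have hKP : 1 ≤ K * P := one_le_mul_of_one_le_of_one_le hK hP1
  conv_lhs => rw [hXYZ, sum_range_add]
  refine (abs_add_le _ _).trans ((add_le_add hmain htail).trans ?_)
  have h1 : K * P * Real.sqrt Y ≤ K * P * Real.sqrt X := by gcongr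
  have h2 : 1 ≤ K * P * Real.sqrt X := one_le_mul_of_one_le_of_one_le hKP hX1
  linarith

/-- Abel's inequality. -/
lemma abs_sum_mul_le_of_antitone (f g : ℕ → ℝ) (hf : Antitone f) (hf0 : ∀ i, 0 ≤ f i) (B : ℝ)
    (X : ℕ) (hB : ∀ j ≤ X, |∑ i ∈ range j, g i| ≤ B) : |∑ i ∈ range X, f i * g i| ≤ f 0 * B := by
  have hB0 : 0 ≤ B := (abs_nonneg _).trans (hB 0 (Nat.zero_le _))
  have key : ∀ j, ∑ i ∈ range j, f i * g i = f j * (∑ i ∈ range j, g i) +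
      ∑ i ∈ range j, (f i - f (i + 1)) * ∑ l ∈ range (i + 1), g l := by
    intro j
    induction j with
    | zero => simp
    | succ j ih =>
      rw [sum_range_succ, ih, sum_range_succ g, sum_range_succ _ j, sum_range_succ g]
      ring
  rw [key]
  have tele : ∑ i ∈ range X, (f i - f (i + 1)) = f 0 - f X := sum_range_sub' f X
  calc _ ≤ |f X * (∑ i ∈ range X, g i)| +
        |∑ i ∈ range X, (f i - f (i + 1)) * ∑ l ∈ range (i + 1), g l| := abs_add_le _ _
    _ ≤ f X * B + ∑ i ∈ range X, (f i - f (i + 1)) * B := by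
        refine add_le_add ?_ ?_
        · rw [abs_mul, abs_of_nonneg (hf0 X)]
          exact mul_le_mul_of_nonneg_left (hB X le_rfl) (hf0 X)
        · refine (abs_sum_le_sum_abs _ _).trans (sum_le_sum fun i hi => ?_)
          have : 0 ≤ f i - f (i + 1) := sub_nonneg.2 (hf (Nat.le_succ i))
          rw [abs_mul, abs_of_nonneg this]
          exact mul_le_mul_of_nonneg_left (hB (i + 1) (mem_range.1 hi)) this
    _ = _ := by rw [← sum_mul, tele]; ring

lemma abs_sum_chi_div_le (D : ℤ) (M : ℝ)
    (hM : ∀ a X : ℕ, |∑ i ∈ range X, chi D (a + i)| ≤ M * Real.sqrt X) (H d : ℕ) (hH : 1 ≤ H)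
    (hd : 1 ≤ d) : |∑ m ∈ range (2 * H) with H ≤ d * m ∧ d * m < 2 * H, chi D m / m| ≤
      M * Real.sqrt (d / H) := by
  have hM0 : 0 ≤ M := by
    have := (abs_nonneg _).trans (hM 0 1)
    simpa using this
  set a := H ⌈/⌉ d with ha
  set b := (2 * H) ⌈/⌉ d with hb
  have ha1 : 1 ≤ a := by
    by_contra! h
    have : a ≤ 0 := by omega
    rw [ha, ceilDiv_le_iff_le_mul (by omega)] at this
    omega
  have hba : b ≤ 2 * a := by
    rw [hb, ceilDiv_le_iff_le_mul (by omega)]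
    have : H ≤ d * a := (ceilDiv_le_iff_le_mul (by omega)).1 le_rfl
    linarith
  have hab : a ≤ b := by
    rw [ha, ceilDiv_le_iff_le_mul (by omega)]
    have : 2 * H ≤ d * b := (ceilDiv_le_iff_le_mul (by omega)).1 le_rfl
    linarith
  have hset : (range (2 * H)).filter (fun m => H ≤ d * m ∧ d * m < 2 * H) = Ico a b := by
    ext m
    simp only [mem_filter, mem_range, mem_Ico]
    have e1 : a ≤ m ↔ H ≤ d * m := ceilDiv_le_iff_le_mul (by omega)
    have e2 : b ≤ m ↔ 2 * H ≤ d * m := ceilDiv_le_iff_le_mul (by omega)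
    rw [e1, ← not_le (b := m), ← not_le (b := m), e2, not_le, not_le]
    refine ⟨fun h => h.2, fun h => ⟨?_, h⟩⟩
    exact lt_of_le_of_lt (Nat.le_mul_of_pos_left m (by omega)) h.2
  rw [hset, sum_Ico_eq_sum_range]
  have hsum : ∑ i ∈ range (b - a), chi D (a + i) / ((a + i : ℕ) : ℝ) =
      ∑ i ∈ range (b - a), (1 / ((a + i : ℕ) : ℝ)) * chi D (a + i) :=
    sum_congr rfl fun i _ => by ring
  rw [hsum]
  refine (abs_sum_mul_le_of_antitone _ _ ?_ (fun i => by positivity) (M * Real.sqrt a)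
    _ ?_).trans ?_
  · intro i j hij
    have : (0 : ℝ) < ((a + i : ℕ) : ℝ) := by exact_mod_cast (by omega : 0 < a + i)
    dsimp only
    gcongr
  · intro j hj
    refine (hM a j).trans ?_
    have : (j : ℝ) ≤ a := by exact_mod_cast (by omega : j ≤ a)
    gcongr
  · have ha0 : (0 : ℝ) < a := by exact_mod_cast ha1
    have hH0 : (0 : ℝ) < H := by exact_mod_cast hH
    have hHa : (H : ℝ) ≤ d * a := by
      exact_mod_cast (ceilDiv_le_iff_le_mul (by omega)).1 (le_refl (H ⌈/⌉ d))
    have h1 : Real.sqrt a / a ≤ Real.sqrt (d / H) := by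
      rw [Real.sqrt_div_self']
      rw [one_div, ← Real.sqrt_inv]
      apply Real.sqrt_le_sqrt
      rw [inv_eq_one_div, div_le_div_iff₀ ha0 hH0]
      linarith
    calc 1 / ((a + 0 : ℕ) : ℝ) * (M * Real.sqrt a) = M * (Real.sqrt a / a) := by
          rw [Nat.add_zero]; ring
      _ ≤ _ := by gcongr

lemma sum_range_exp_eq (e : ℕ) (he : e ≠ 0) (x : ℕ) :
    ∑ s ∈ range e, Complex.exp (2 * Real.pi * Complex.I * ((s * x : ℕ) : ℂ) / e) =
      if e ∣ x then (e : ℂ) else 0 := by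
  set ζ := Complex.exp (2 * Real.pi * Complex.I / e) with hζ
  have hprim : IsPrimitiveRoot ζ e := Complex.isPrimitiveRoot_exp e he
  have hs : ∀ s : ℕ, Complex.exp (2 * Real.pi * Complex.I * ((s * x : ℕ) : ℂ) / e) =
      (ζ ^ x) ^ s := by
    intro s
    rw [hζ, ← Complex.exp_nat_mul, ← Complex.exp_nat_mul]
    congr 1
    push_cast
    ring
  simp only [hs]
  split_ifs with h
  · rw [(hprim.pow_eq_one_iff_dvd x).2 h]
    simp
  · have hne : ζ ^ x ≠ 1 := fun h1 => h ((hprim.pow_eq_one_iff_dvd x).1 h1)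
    rw [geom_sum_eq hne, ← pow_mul, mul_comm x e, pow_mul, hprim.pow_eq_one, one_pow, sub_self,
      zero_div]

lemma ramanujanSum_eq (q : ℕ) (hq : q ≠ 0) (x : ZMod q) :
    ramanujanSum q x = ∑ d ∈ q.divisors, (ArithmeticFunction.moebius d : ℂ) *
      (if q / d ∣ x.val then ((q / d : ℕ) : ℂ) else 0) := by
  unfold ramanujanSum
  set f : ℕ → ℂ := fun r => Complex.exp (2 * Real.pi * Complex.I * ((r * x.val : ℕ) : ℂ) / q)
    with hf
  have h1 : ∀ r ∈ range q, (if Nat.Coprime r q then f r else 0) =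
      ∑ d ∈ q.divisors, if d ∣ r then (ArithmeticFunction.moebius d : ℂ) * f r else 0 := by
    intro r _
    have hz := sum_divisors_moebius (r.gcd q)
    rw [← sum_filter, ← sum_mul]
    have hset : q.divisors.filter (fun d => d ∣ r) = (r.gcd q).divisors := by
      ext d
      simp only [Nat.mem_divisors, mem_filter, Nat.dvd_gcd_iff, ne_eq, Nat.gcd_eq_zero_iff]
      tauto
    rw [hset, ← Int.cast_sum, hz]
    simp only [Nat.coprime_iff_gcd_eq_one]
    split_ifs <;> simp
  rw [sum_filter, sum_congr rfl h1, sum_comm]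
  refine sum_congr rfl fun d hd => ?_
  obtain ⟨hdq, -⟩ := Nat.mem_divisors.1 hd
  obtain ⟨e, rfl⟩ := hdq
  have hd0 : d ≠ 0 := fun h => hq (by rw [h, zero_mul])
  have he0 : e ≠ 0 := fun h => hq (by rw [h, mul_zero])
  rw [Nat.mul_div_cancel_left e (Nat.pos_of_ne_zero hd0), ← sum_filter, ← mul_sum,
    ← sum_range_exp_eq e he0]
  congr 1
  symm
  refine sum_bij (fun s _ => d * s) ?_ ?_ ?_ ?_
  · intro s hs
    rw [mem_range] at hs
    simp only [mem_filter, mem_range, dvd_mul_right, and_true]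
    exact Nat.mul_lt_mul_of_pos_left hs (Nat.pos_of_ne_zero hd0)
  · intro a _ b _ h
    exact Nat.eq_of_mul_eq_mul_left (Nat.pos_of_ne_zero hd0) h
  · intro r hr
    simp only [mem_filter, mem_range] at hr
    obtain ⟨h, s, rfl⟩ := hr
    exact ⟨s, mem_range.2 (lt_of_mul_lt_mul_left h (Nat.zero_le _)), rfl⟩
  · intro s _
    rw [hf]
    dsimp only
    congr 1
    have : (d : ℂ) ≠ 0 := by exact_mod_cast hd0
    have : (e : ℂ) ≠ 0 := by exact_mod_cast he0
    push_cast
    field_simp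

/-- A residue coprime to the modulus in the generalised sense can be lifted to an integer coprime
to a given nonzero integer. -/
lemma exists_isCoprime_add_mul (a b g : ℤ) (ha : a ≠ 0) (hg : ∀ p : ℤ, p ∣ a → p ∣ b → p ∣ g →
    IsUnit p) : ∃ t : ℤ, IsCoprime a (b + g * t) := by
  classical
  set t : ℕ := ∏ p ∈ a.natAbs.primeFactors.filter (fun p : ℕ => ¬ ((p : ℤ) ∣ b)), p with ht
  refine ⟨t, ?_⟩
  rw [Int.isCoprime_iff_gcd_eq_one]
  by_contra hne
  obtain ⟨p, hp, hpd⟩ := Nat.exists_prime_and_dvd hne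
  have hpd' : (p : ℤ) ∣ (Int.gcd a (b + g * t) : ℤ) := Int.natCast_dvd_natCast.2 hpd
  have hpa : (p : ℤ) ∣ a := hpd'.trans (Int.gcd_dvd_left ..)
  have hpb : (p : ℤ) ∣ b + g * t := hpd'.trans (Int.gcd_dvd_right ..)
  have hpp : Prime (p : ℤ) := Nat.prime_iff_prime_int.1 hp
  have hpaf : p ∈ a.natAbs.primeFactors := by
    rw [Nat.mem_primeFactors]
    exact ⟨hp, Int.natCast_dvd.1 hpa, by simpa using ha⟩
  by_cases hb : (p : ℤ) ∣ b
  · have h1 : (p : ℤ) ∣ g * t := (dvd_add_right hb).1 hpb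
    rcases hpp.dvd_or_dvd h1 with h2 | h2
    · exact hpp.not_isUnit (hg p hpa hb h2)
    · rw [Int.natCast_dvd_natCast, ht, hp.prime.dvd_finsetProd_iff] at h2
      obtain ⟨r, hr, hpr⟩ := h2
      rw [mem_filter, Nat.mem_primeFactors] at hr
      rw [(Nat.prime_dvd_prime_iff_eq hp hr.1.1).1 hpr] at hb
      exact hr.2 hb
  · have h1 : (p : ℤ) ∣ t := by
      rw [Int.natCast_dvd_natCast, ht]
      exact dvd_prod_of_mem _ (mem_filter.2 ⟨hpaf, hb⟩)
    exact hb ((dvd_add_left (h1.mul_left g)).1 hpb)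

/-- Every matrix of determinant one over `ZMod e` lifts to an integral one. -/
lemma exists_int_lift (e : ℕ) (he : e ≠ 0) (γ : Matrix.SpecialLinearGroup (Fin 2) (ZMod e)) :
    ∃ δ : Matrix.SpecialLinearGroup (Fin 2) ℤ,
      Matrix.SpecialLinearGroup.map (Int.castRingHom (ZMod e)) δ = γ := by
  obtain ⟨a, ha⟩ := ZMod.intCast_surjective (γ.1 0 0)
  obtain ⟨b, hb⟩ := ZMod.intCast_surjective (γ.1 0 1)
  obtain ⟨c, hc, hc0⟩ : ∃ c : ℤ, (c : ZMod e) = γ.1 1 0 ∧ c ≠ 0 := by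
    obtain ⟨c, hc⟩ := ZMod.intCast_surjective (γ.1 1 0)
    by_cases h : c = 0
    · exact ⟨e, by rw [← hc, h]; simp, by exact_mod_cast he⟩
    · exact ⟨c, hc, h⟩
  obtain ⟨d, hd⟩ := ZMod.intCast_surjective (γ.1 1 1)
  have hdet : γ.1 0 0 * γ.1 1 1 - γ.1 0 1 * γ.1 1 0 = 1 := by
    rw [← Matrix.det_fin_two]; exact γ.2
  have hdet' : (((a * d - b * c - 1 : ℤ)) : ZMod e) = 0 := by
    push_cast
    rw [ha, hb, hc, hd, hdet, sub_self]
  rw [ZMod.intCast_zmod_eq_zero_iff_dvd] at hdet'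
  obtain ⟨t, x, y, ht⟩ := exists_isCoprime_add_mul c d e hc0 (fun p h1 h2 h3 => by
    refine isUnit_of_dvd_one ?_
    have : (1 : ℤ) = a * d - b * c - (a * d - b * c - 1) := by ring
    rw [this]
    exact dvd_sub (dvd_sub (h2.mul_left a) (h1.mul_left b)) (h3.trans hdet'))
  obtain ⟨m, hm⟩ := hdet'
  set M := m + a * t with hM
  have hMdet : a * (d + e * t) - b * c = 1 + e * M := by
    rw [hM]; linear_combination hm
  obtain ⟨δ, hδ⟩ : ∃ δ : Matrix.SpecialLinearGroup (Fin 2) ℤ,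
      δ.1 = !![a - M * e * y, b + M * e * x; c, d + e * t] := by
    refine ⟨⟨!![a - M * e * y, b + M * e * x; c, d + e * t], ?_⟩, rfl⟩
    rw [Matrix.det_fin_two_of]
    linear_combination hMdet - M * e * ht
  · refine ⟨δ, ?_⟩
    ext i j
    rw [Matrix.SpecialLinearGroup.map_apply_coe, RingHom.mapMatrix_apply, Matrix.map_apply, hδ]
    fin_cases i <;> fin_cases j <;> simp [← ha, ← hb, ← hc, ← hd]

lemma map_castHom_surjective {e q : ℕ} (h : e ∣ q) (he : e ≠ 0) :
    Function.Surjective (Matrix.SpecialLinearGroup.map (n := Fin 2) (ZMod.castHom h (ZMod e))) := by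
  intro γ
  obtain ⟨δ, hδ⟩ := exists_int_lift e he γ
  refine ⟨Matrix.SpecialLinearGroup.map (Int.castRingHom (ZMod q)) δ, ?_⟩
  rw [← hδ]
  ext i j
  simp [Matrix.SpecialLinearGroup.map_apply_coe]

/-- The number of matrices in `SL₂(ℤ/e)` representing `n`. -/
noncomputable def formCount (A B C D : ℤ) (e : ℕ) (n : ℤ) : ℕ :=
  Nat.card {γ : Matrix.SpecialLinearGroup (Fin 2) (ZMod e) // Lform A B C D γ = (n : ZMod e)}

/-- The order of `SL₂(ℤ/e)`. -/
noncomputable def slCount (e : ℕ) : ℕ := Nat.card (Matrix.SpecialLinearGroup (Fin 2) (ZMod e))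

lemma sum_comp_of_surjective {G M : Type*} [Group G] [Group M] [Fintype G] [Fintype M]
    [DecidableEq M] (π : G →* M) (hπ : Function.Surjective π) :
    ∃ c : ℕ, c ≠ 0 ∧ ∀ f : M → ℂ, ∑ g, f (π g) = c * ∑ m, f m := by
  refine ⟨#{g | π g = 1}, ?_, fun f => ?_⟩
  · exact card_ne_zero.2 ⟨1, by simp⟩
  · rw [← sum_fiberwise univ π, mul_sum]
    refine sum_congr rfl fun m _ => ?_
    rw [sum_congr rfl (fun g hg => by rw [(mem_filter.1 hg).2]), sum_const, nsmul_eq_mul,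
      MonoidHom.card_fiber_eq_of_mem_range π (hπ m) (hπ 1)]

lemma sum_ite_dvd_eq (A B C D n : ℤ) {e q : ℕ} [NeZero q] [NeZero e] (h : e ∣ q) :
    (Fintype.card (Matrix.SpecialLinearGroup (Fin 2) (ZMod q)) : ℂ)⁻¹ *
      ∑ γ : Matrix.SpecialLinearGroup (Fin 2) (ZMod q),
        (if e ∣ (Lform A B C D γ - (n : ZMod q)).val then (1 : ℂ) else 0) =
      (formCount A B C D e n : ℂ) / slCount e := by
  set π := Matrix.SpecialLinearGroup.map (n := Fin 2) (ZMod.castHom h (ZMod e)) with hπ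
  obtain ⟨c, hc0, hc⟩ := sum_comp_of_surjective π (map_castHom_surjective h (NeZero.ne e))
  have h1 : ∀ γ : Matrix.SpecialLinearGroup (Fin 2) (ZMod q),
      (if e ∣ (Lform A B C D γ - (n : ZMod q)).val then (1 : ℂ) else 0) =
        (fun δ => if Lform A B C D δ = (n : ZMod e) then (1 : ℂ) else 0) (π γ) := by
    intro γ
    have : e ∣ (Lform A B C D γ - (n : ZMod q)).val ↔ Lform A B C D (π γ) = (n : ZMod e) := by
      rw [← ZMod.natCast_eq_zero_iff, ZMod.natCast_val, ← ZMod.castHom_apply (h := h), map_sub,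
        map_intCast, sub_eq_zero]
      unfold Lform
      simp only [map_add, map_mul, map_intCast]
      rfl
    simp only [this]
  have hcard := hc (fun _ => 1)
  simp only [sum_const, card_univ, nsmul_eq_mul, mul_one] at hcard
  rw [sum_congr rfl fun γ _ => h1 γ,
    hc (fun δ => if Lform A B C D δ = (n : ZMod e) then (1 : ℂ) else 0), hcard, sum_boole]
  unfold formCount slCount
  rw [Nat.card_eq_fintype_card, Nat.card_eq_fintype_card, Fintype.card_subtype]
  have : (c : ℂ) ≠ 0 := by exact_mod_cast hc0
  have h0 : (Fintype.card (Matrix.SpecialLinearGroup (Fin 2) (ZMod e)) : ℂ) ≠ 0 := by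
    exact_mod_cast Fintype.card_ne_zero
  field_simp

lemma singSeriesTerm_eq (A B C D n : ℤ) (q : ℕ) (hq : q ≠ 0) :
    singSeriesTerm A B C D q n = ∑ d ∈ q.divisors, (ArithmeticFunction.moebius d : ℝ) *
      (((q / d : ℕ) : ℝ) * (formCount A B C D (q / d) n : ℝ) / slCount (q / d)) := by
  have hNZ : NeZero q := ⟨hq⟩
  unfold singSeriesTerm
  rw [dif_neg hq]
  have key : (Fintype.card (Matrix.SpecialLinearGroup (Fin 2) (ZMod q)) : ℂ)⁻¹ *
      ∑ γ : Matrix.SpecialLinearGroup (Fin 2) (ZMod q),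
        ramanujanSum q (Lform A B C D γ - (n : ZMod q)) =
      ((∑ d ∈ q.divisors, (ArithmeticFunction.moebius d : ℝ) *
        (((q / d : ℕ) : ℝ) * (formCount A B C D (q / d) n : ℝ) / slCount (q / d)) : ℝ) : ℂ) := by
    simp only [ramanujanSum_eq q hq]
    rw [sum_comm, mul_sum]
    push_cast
    refine sum_congr rfl fun d hd => ?_
    obtain ⟨hdq, -⟩ := Nat.mem_divisors.1 hd
    have hed : q / d ∣ q := Nat.div_dvd_of_dvd hdq
    have he0 : NeZero (q / d) := ⟨fun h0 => hq (Nat.eq_zero_of_zero_dvd (h0 ▸ hed))⟩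
    have := sum_ite_dvd_eq A B C D n hed
    rw [mul_div_assoc, ← this, ← mul_sum]
    simp only [mul_sum]
    refine sum_congr rfl fun γ _ => ?_
    rw [Nat.cast_div hdq (by
      have : d ≠ 0 := fun h => hq (Nat.eq_zero_of_zero_dvd (h ▸ hdq))
      exact_mod_cast this)]
    split_ifs <;> ring
  exact (congrArg Complex.re key).trans (Complex.ofReal_re _)

open Matrix in
lemma formCount_mul_right (A B C D A' B' C' D' : ℤ) (e : ℕ) (n : ℤ)
    (g : SpecialLinearGroup (Fin 2) (ZMod e))
    (h : ∀ γ : SpecialLinearGroup (Fin 2) (ZMod e), Lform A B C D (γ * g) = Lform A' B' C' D' γ) :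
    formCount A B C D e n = formCount A' B' C' D' e n := by
  refine (Nat.card_congr (Equiv.subtypeEquiv (Equiv.mulRight g) fun γ => ?_)).symm
  rw [Equiv.coe_mulRight, h]

open Matrix in
lemma formCount_mul_left (A B C D A' B' C' D' : ℤ) (e : ℕ) (n : ℤ)
    (g : SpecialLinearGroup (Fin 2) (ZMod e))
    (h : ∀ γ : SpecialLinearGroup (Fin 2) (ZMod e), Lform A B C D (g * γ) = Lform A' B' C' D' γ) :
    formCount A B C D e n = formCount A' B' C' D' e n := by
  refine (Nat.card_congr (Equiv.subtypeEquiv (Equiv.mulLeft g) fun γ => ?_)).symm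
  rw [Equiv.coe_mulLeft, h]

/-- Reduction of a primitive integral two-by-two matrix to diagonal form. -/
lemma eq_diagonal_of_invariant (f : ℤ → ℤ → ℤ → ℤ → ℕ)
    (hc : ∀ A B C D t, f A B C D = f A (B + t * A) C (D + t * C))
    (hr : ∀ A B C D t, f A B C D = f A B (C + t * A) (D + t * B))
    (hu : ∀ A B C D t, f A B C D = f (A + t * C) (B + t * D) C D)
    (hw : ∀ A B C D, f A B C D = f B (-A) D (-C))
    (hw' : ∀ A B C D, f A B C D = f (-C) (-D) A B) (N : ℕ) :
    ∀ A B C D : ℤ, A.natAbs = N → A ≠ 0 →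
      (∀ p : ℤ, p ∣ A → p ∣ B → p ∣ C → p ∣ D → IsUnit p) →
      f A B C D = f 1 0 0 (A * D - B * C) := by
  induction N using Nat.strong_induction_on with
  | _ N ih =>
  intro A B C D hN hA hp
  have step : ∀ B C D : ℤ, (∀ p : ℤ, p ∣ A → p ∣ B → p ∣ C → p ∣ D → IsUnit p) → ¬ A ∣ B →
      f A B C D = f 1 0 0 (A * D - B * C) := by
    intro B C D hp hB
    have hB' : B % A ≠ 0 := fun h => hB (Int.dvd_of_emod_eq_zero h)
    have hBA : B + -(B / A) * A = B % A := by rw [Int.emod_def]; ring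
    rw [hc A B C D (-(B / A)), hw, hBA]
    rw [ih (B % A).natAbs ?_ _ _ _ _ rfl hB' ?_]
    · congr 1
      rw [Int.emod_def]; ring
    · rw [← hN]
      zify
      rw [abs_of_nonneg (Int.emod_nonneg B hA)]
      exact Int.emod_lt_abs B hA
    · intro p h1 h2 h3 h4
      have hpA := (dvd_neg.1 h2)
      have hpC := (dvd_neg.1 h4)
      refine hp p hpA ?_ hpC ?_
      · rw [← hBA] at h1
        exact (dvd_add_left (hpA.mul_left _)).1 h1
      · exact (dvd_add_left (hpC.mul_left _)).1 h3
  by_cases hB : A ∣ B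
  swap
  · exact step B C D hp hB
  obtain ⟨b, rfl⟩ := hB
  have e1 : f A (A * b) C D = f A 0 C (D - b * C) := by
    rw [hc A (A * b) C D (-b)]
    congr 1 <;> ring
  have hp1 : ∀ p : ℤ, p ∣ A → p ∣ C → p ∣ D - b * C → IsUnit p := fun p h1 h2 h3 =>
    hp p h1 (h1.mul_right _) h2 (by
      have := dvd_add h3 (h2.mul_left b)
      rwa [sub_add_cancel] at this)
  rw [e1, show A * D - A * b * C = A * (D - b * C) by ring]
  generalize D - b * C = D at *
  by_cases hC : A ∣ C
  swap
  · have hC' : C % A ≠ 0 := fun h => hC (Int.dvd_of_emod_eq_zero h)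
    have hCA : C + -(C / A) * A = C % A := by rw [Int.emod_def]; ring
    rw [hr A 0 C D (-(C / A)), hw', hCA]
    rw [ih (-(C % A)).natAbs ?_ _ _ _ _ rfl (neg_ne_zero.2 hC') ?_]
    · congr 1
      ring
    · rw [← hN, Int.natAbs_neg]
      zify
      rw [abs_of_nonneg (Int.emod_nonneg C hA)]
      exact Int.emod_lt_abs C hA
    · intro p h1 h2 h3 h4
      refine hp1 p h3 ?_ ?_
      · rw [dvd_neg, ← hCA] at h1
        exact (dvd_add_left (h3.mul_left _)).1 h1
      · rw [dvd_neg, mul_zero, add_zero] at h2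
        exact h2
  obtain ⟨c, rfl⟩ := hC
  have e2 : f A 0 (A * c) D = f A 0 0 D := by
    rw [hr A 0 (A * c) D (-c)]
    congr 1 <;> ring
  have hp2 : ∀ p : ℤ, p ∣ A → p ∣ D → IsUnit p := fun p h1 h2 => hp1 p h1 (h1.mul_right _) h2
  rw [e2]
  by_cases hD : A ∣ D
  swap
  · rw [hu A 0 0 D 1, show A + 1 * 0 = A by ring, show 0 + 1 * D = D by ring, step D 0 D ?_ hD]
    · congr 1
      ring
    · exact fun p h1 h2 _ _ => hp2 p h1 h2
  have hunit : IsUnit A := hp2 A dvd_rfl hD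
  rcases Int.isUnit_iff.1 hunit with rfl | rfl
  · rw [one_mul]
  · rw [hw, hw, neg_one_mul, neg_neg, neg_zero]

lemma formCount_eq_diagonal (A B C D : ℤ) (hgcd : Int.gcd A (Int.gcd B (Int.gcd C D)) = 1)
    (hΔ : A * D - B * C ≠ 0) (e : ℕ) (n : ℤ) :
    formCount A B C D e n = formCount 1 0 0 (A * D - B * C) e n := by
  have hprim : ∀ p : ℤ, p ∣ A → p ∣ B → p ∣ C → p ∣ D → IsUnit p := by
    intro p h1 h2 h3 h4
    refine isUnit_of_dvd_one ?_
    have := Int.dvd_coe_gcd h1 (Int.dvd_coe_gcd h2 (Int.dvd_coe_gcd h3 h4))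
    rwa [hgcd] at this
  have hc : ∀ A B C D t, formCount A B C D e n = formCount A (B + t * A) C (D + t * C) e n := by
    intro A B C D t
    obtain ⟨g, hg⟩ : ∃ g : Matrix.SpecialLinearGroup (Fin 2) (ZMod e),
        g.1 = !![1, 0; (t : ZMod e), 1] :=
      ⟨⟨!![1, 0; (t : ZMod e), 1], by simp⟩, rfl⟩
    refine formCount_mul_right _ _ _ _ _ _ _ _ e n g fun γ => ?_
    unfold Lform
    simp [Matrix.SpecialLinearGroup.coe_mul, Matrix.mul_apply, Fin.sum_univ_two, hg]
    ring
  have hr : ∀ A B C D t, formCount A B C D e n = formCount A B (C + t * A) (D + t * B) e n := by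
    intro A B C D t
    obtain ⟨g, hg⟩ : ∃ g : Matrix.SpecialLinearGroup (Fin 2) (ZMod e),
        g.1 = !![1, (t : ZMod e); 0, 1] :=
      ⟨⟨!![1, (t : ZMod e); 0, 1], by simp⟩, rfl⟩
    refine formCount_mul_left _ _ _ _ _ _ _ _ e n g fun γ => ?_
    unfold Lform
    simp [Matrix.SpecialLinearGroup.coe_mul, Matrix.mul_apply, Fin.sum_univ_two, hg]
    ring
  have hu : ∀ A B C D t, formCount A B C D e n = formCount (A + t * C) (B + t * D) C D e n := by
    intro A B C D t
    obtain ⟨g, hg⟩ : ∃ g : Matrix.SpecialLinearGroup (Fin 2) (ZMod e),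
        g.1 = !![1, 0; (t : ZMod e), 1] :=
      ⟨⟨!![1, 0; (t : ZMod e), 1], by simp⟩, rfl⟩
    refine formCount_mul_left _ _ _ _ _ _ _ _ e n g fun γ => ?_
    unfold Lform
    simp [Matrix.SpecialLinearGroup.coe_mul, Matrix.mul_apply, Fin.sum_univ_two, hg]
    ring
  have hw : ∀ A B C D, formCount A B C D e n = formCount B (-A) D (-C) e n := by
    intro A B C D
    obtain ⟨g, hg⟩ : ∃ g : Matrix.SpecialLinearGroup (Fin 2) (ZMod e),
        g.1 = !![0, 1; -1, 0] :=
      ⟨⟨!![0, 1; -1, 0], by simp⟩, rfl⟩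
    refine formCount_mul_right _ _ _ _ _ _ _ _ e n g fun γ => ?_
    unfold Lform
    simp [Matrix.SpecialLinearGroup.coe_mul, Matrix.mul_apply, Fin.sum_univ_two, hg]
    ring
  have hw' : ∀ A B C D, formCount A B C D e n = formCount (-C) (-D) A B e n := by
    intro A B C D
    obtain ⟨g, hg⟩ : ∃ g : Matrix.SpecialLinearGroup (Fin 2) (ZMod e),
        g.1 = !![0, 1; -1, 0] :=
      ⟨⟨!![0, 1; -1, 0], by simp⟩, rfl⟩
    refine formCount_mul_left _ _ _ _ _ _ _ _ e n g fun γ => ?_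
    unfold Lform
    simp [Matrix.SpecialLinearGroup.coe_mul, Matrix.mul_apply, Fin.sum_univ_two, hg]
    ring
  have key := eq_diagonal_of_invariant (fun A B C D => formCount A B C D e n) hc hr hu hw hw'
  by_cases hA : A = 0
  · have hB : B ≠ 0 := by rintro rfl; exact hΔ (by rw [hA]; ring)
    have h1 := hw A B C D
    have h2 := key B.natAbs B (-A) D (-C) rfl hB fun p h1 h2 h3 h4 =>
      hprim p (dvd_neg.1 h2) h1 (dvd_neg.1 h4) h3
    rw [h1, h2]
    congr 1
    ring
  · exact key A.natAbs A B C D rfl hA hprim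

lemma sum_zmod_val_cast (e h : ℕ) [NeZero e] [NeZero h] (f : ZMod e → ℕ) :
    ∑ x : ZMod (e * h), f (x.val : ZMod e) = h * ∑ y, f y := by
  have hNZ : NeZero (e * h) := ⟨mul_ne_zero (NeZero.ne e) (NeZero.ne h)⟩
  rw [← sum_range_natCast_zmod, ← sum_range_natCast_zmod e]
  have h1 : ∀ x ∈ range (e * h), f (((x : ZMod (e * h)).val : ℕ) : ZMod e) = f (x : ZMod e) := by
    intro x hx
    rw [ZMod.val_cast_of_lt (mem_range.1 hx)]
  rw [sum_congr rfl h1]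
  have : ∀ k, ∑ x ∈ range (e * k), f (x : ZMod e) = k * ∑ y ∈ range e, f (y : ZMod e) := by
    intro k
    induction k with
    | zero => simp
    | succ k ih =>
      rw [Nat.mul_succ, sum_range_add, ih]
      simp
      ring
  exact this h

/-- The number of solutions of a linear congruence. -/
lemma card_mul_eq (g : ℕ) [NeZero g] (b m : ZMod g) :
    #{c : ZMod g | b * c = m} = if g.gcd b.val ∣ m.val then g.gcd b.val else 0 := by
  set e := g.gcd b.val with he
  have he0 : e ≠ 0 := fun h => NeZero.ne g (Nat.eq_zero_of_gcd_eq_zero_left h)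
  obtain ⟨h, hg⟩ : e ∣ g := Nat.gcd_dvd_left _ _
  obtain ⟨b', hb⟩ : e ∣ b.val := Nat.gcd_dvd_right _ _
  have hh0 : h ≠ 0 := fun h0 => NeZero.ne g (by rw [hg, h0, mul_zero])
  have hcop : b'.Coprime h := by
    have : e * Nat.gcd b' h = e * 1 := by
      rw [← Nat.gcd_mul_left, ← hb, ← hg, Nat.gcd_comm, mul_one]
    exact Nat.eq_of_mul_eq_mul_left (Nat.pos_of_ne_zero he0) this
  have heq : ∀ c : ZMod g, b * c = m ↔ (g : ℤ) ∣ (b.val : ℤ) * c.val - m.val := by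
    intro c
    rw [← ZMod.intCast_zmod_eq_zero_iff_dvd]
    push_cast
    simp only [ZMod.natCast_val, ZMod.cast_id', id_eq, sub_eq_zero]
  split_ifs with hm
  · obtain ⟨m', hm'⟩ := hm
    have hNZe : NeZero e := ⟨he0⟩
    have hNZh : NeZero h := ⟨hh0⟩
    have heq2 : ∀ c : ZMod g, b * c = m ↔ (b' : ZMod h) * (c.val : ZMod h) = (m' : ZMod h) := by
      intro c
      have e3 : (b.val : ℤ) * c.val - m.val = e * (b' * c.val - m') := by
        rw [hb, hm']; push_cast; ring
      rw [heq, e3, show (g : ℤ) = e * h by exact_mod_cast hg,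
        mul_dvd_mul_iff_left (by exact_mod_cast he0), ← ZMod.intCast_zmod_eq_zero_iff_dvd]
      push_cast
      rw [sub_eq_zero]
    simp only [heq2]
    rw [card_filter]
    have hsub : ∀ (g' : ℕ) [NeZero g'], g' = h * e →
        ∑ c : ZMod g', (if (b' : ZMod h) * (c.val : ZMod h) = (m' : ZMod h) then 1 else 0) =
        e * ∑ y : ZMod h, (if (b' : ZMod h) * y = (m' : ZMod h) then 1 else 0) := by
      intro g' _ hg'
      subst hg'
      exact sum_zmod_val_cast h e (fun y => if (b' : ZMod h) * y = (m' : ZMod h) then 1 else 0)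
    rw [hsub g (by rw [hg, mul_comm])]
    have hu : (b' : ZMod h) * (b' : ZMod h)⁻¹ = 1 := ZMod.coe_mul_inv_eq_one b' hcop
    have : ∀ y : ZMod h, (b' : ZMod h) * y = m' ↔ y = (b' : ZMod h)⁻¹ * m' := by
      intro y
      constructor
      · intro hy; rw [← hy]; linear_combination -y * hu
      · intro hy; rw [hy]; linear_combination (m' : ZMod h) * hu
    simp [this]
  · rw [card_eq_zero, filter_eq_empty_iff]
    intro c _ hc
    rw [heq] at hc
    refine hm ?_
    have h1 : (e : ℤ) ∣ (b.val : ℤ) * c.val - m.val :=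
      (Int.natCast_dvd_natCast.2 ⟨h, hg⟩ : (e : ℤ) ∣ g).trans hc
    have h2 : (e : ℤ) ∣ (b.val : ℤ) * c.val :=
      (Int.natCast_dvd_natCast.2 ⟨b', hb⟩ : (e : ℤ) ∣ b.val).mul_right _
    have := dvd_sub h2 h1
    rw [sub_sub_cancel] at this
    exact_mod_cast this

/-- The number of factorisations of a residue class. -/
lemma card_mul_eq_sum (g : ℕ) [NeZero g] (m : ZMod g) :
    #{x : ZMod g × ZMod g | x.1 * x.2 = m} =
      ∑ e ∈ g.divisors, if e ∣ m.val then e * (g / e).totient else 0 := by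
  have h1 : #{x : ZMod g × ZMod g | x.1 * x.2 = m} = ∑ b : ZMod g, #{c : ZMod g | b * c = m} := by
    simp only [card_filter]
    rw [Fintype.sum_prod_type]
  rw [h1]
  simp only [card_mul_eq]
  rw [← sum_range_natCast_zmod]
  have h2 : ∀ b ∈ range g, (if g.gcd (b : ZMod g).val ∣ m.val then g.gcd (b : ZMod g).val else 0) =
      if g.gcd b ∣ m.val then g.gcd b else 0 := by
    intro b hb
    rw [ZMod.val_cast_of_lt (mem_range.1 hb)]
  rw [sum_congr rfl h2, ← sum_fiberwise_of_maps_to (t := g.divisors) (g := fun b => g.gcd b)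
    (fun b _ => Nat.mem_divisors.2 ⟨Nat.gcd_dvd_left _ _, NeZero.ne g⟩)]
  refine sum_congr rfl fun e he => ?_
  rw [Nat.totient_div_of_dvd (Nat.mem_divisors.1 he).1]
  rw [sum_congr rfl (g := fun _ => if e ∣ m.val then e else 0)
    (fun b hb => by rw [(mem_filter.1 hb).2]), sum_const, smul_eq_mul]
  split_ifs
  · rw [mul_comm]
  · rw [mul_zero]

open Matrix in
/-- Counting matrices of determinant one with prescribed diagonal entries. -/
lemma card_sl_diagonal (g : ℕ) [NeZero g] (P : ZMod g → ZMod g → Prop)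
    [∀ a d, Decidable (P a d)] :
    Nat.card {γ : SpecialLinearGroup (Fin 2) (ZMod g) // P (γ.1 0 0) (γ.1 1 1)} =
      ∑ e ∈ g.divisors, e * (g / e).totient *
        ∑ a : ZMod g, ∑ d : ZMod g, if P a d ∧ e ∣ (a * d - 1).val then 1 else 0 := by
  have h1 : Nat.card {γ : SpecialLinearGroup (Fin 2) (ZMod g) // P (γ.1 0 0) (γ.1 1 1)} =
      Nat.card {x : ZMod g × ZMod g × (ZMod g × ZMod g) //
        P x.1 x.2.1 ∧ x.2.2.1 * x.2.2.2 = x.1 * x.2.1 - 1} := by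
    refine Nat.card_congr
      { toFun := fun γ => ⟨(γ.1.1 0 0, γ.1.1 1 1, γ.1.1 0 1, γ.1.1 1 0), γ.2, ?_⟩
        invFun := fun x => ⟨⟨!![x.1.1, x.1.2.2.1; x.1.2.2.2, x.1.2.1], ?_⟩, ?_⟩
        left_inv := ?_
        right_inv := ?_ }
    · have := γ.1.2
      rw [det_fin_two] at this
      linear_combination -this
    · rw [det_fin_two_of]
      linear_combination -x.2.2
    · simpa using x.2.1
    · rintro ⟨γ, hγ⟩
      ext i j
      fin_cases i <;> fin_cases j <;> rfl
    · rintro ⟨⟨a, d, b, c⟩, hx⟩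
      rfl
  rw [h1, Nat.card_eq_fintype_card, Fintype.card_subtype, card_filter, Fintype.sum_prod_type]
  simp only [Fintype.sum_prod_type (α₁ := ZMod g) (α₂ := ZMod g × ZMod g)]
  have h2 : ∀ a d : ZMod g, ∑ y : ZMod g × ZMod g,
      (if P a d ∧ y.1 * y.2 = a * d - 1 then 1 else 0) =
      ∑ e ∈ g.divisors, e * (g / e).totient * if P a d ∧ e ∣ (a * d - 1).val then 1 else 0 := by
    intro a d
    by_cases hP : P a d
    · simp only [hP, true_and]
      rw [← card_filter, card_mul_eq_sum]
      refine sum_congr rfl fun e _ => ?_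
      split_ifs <;> simp
    · simp [hP]
  simp only [h2]
  rw [sum_congr rfl fun a _ => sum_comm, sum_comm]
  simp only [mul_sum]

/-- The number of solutions of `(n - Δ d) d = 1` modulo `e`. -/
noncomputable def rootCount (Δ n : ℤ) (e : ℕ) : ℕ :=
  Nat.card {d : ZMod e // ((n : ZMod e) - Δ * d) * d - 1 = 0}

lemma dvd_val_iff (e h : ℕ) [NeZero e] [NeZero h] (x : ZMod (e * h)) :
    e ∣ x.val ↔ ZMod.castHom (dvd_mul_right e h) (ZMod e) x = 0 := by
  rw [← ZMod.natCast_eq_zero_iff, ZMod.natCast_val, ZMod.castHom_apply]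

lemma sum_dvd_val (e h : ℕ) [NeZero e] [NeZero h] (Δ n : ℤ) :
    ∑ a : ZMod (e * h), ∑ d : ZMod (e * h),
      (if a + (Δ : ZMod (e * h)) * d = n ∧ e ∣ (a * d - 1).val then 1 else 0) =
      h * rootCount Δ n e := by
  have hNZ : NeZero (e * h) := ⟨mul_ne_zero (NeZero.ne e) (NeZero.ne h)⟩
  rw [sum_comm]
  have h1 : ∀ d : ZMod (e * h), ∑ a : ZMod (e * h),
      (if a + (Δ : ZMod (e * h)) * d = n ∧ e ∣ (a * d - 1).val then 1 else 0) =
      (fun y : ZMod e => if ((n : ZMod e) - Δ * y) * y - 1 = 0 then 1 else 0) (d.val : ZMod e) := by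
    intro d
    rw [sum_eq_single ((n : ZMod (e * h)) - Δ * d)]
    · simp [dvd_val_iff, ZMod.natCast_val]
    · intro a _ ha
      rw [if_neg]
      rintro ⟨h1, _⟩
      exact ha (by rw [← h1]; ring)
    · simp
  have h2 := sum_zmod_val_cast e h
    fun y : ZMod e => if ((n : ZMod e) - Δ * y) * y - 1 = 0 then 1 else 0
  rw [sum_congr rfl fun d _ => h1 d, h2, rootCount, Nat.card_eq_fintype_card,
    Fintype.card_subtype, card_filter]

lemma formCount_diagonal (Δ n : ℤ) (g : ℕ) (hg : g ≠ 0) :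
    formCount 1 0 0 Δ g n = g * ∑ e ∈ g.divisors, (g / e).totient * rootCount Δ n e := by
  have hNZ : NeZero g := ⟨hg⟩
  have h1 : formCount 1 0 0 Δ g n = Nat.card {γ : Matrix.SpecialLinearGroup (Fin 2) (ZMod g) //
      γ.1 0 0 + (Δ : ZMod g) * γ.1 1 1 = n} := by
    unfold formCount Lform
    simp
  rw [h1, card_sl_diagonal g (fun a d => a + (Δ : ZMod g) * d = n), mul_sum]
  refine sum_congr rfl fun e he => ?_
  obtain ⟨h, rfl⟩ := (Nat.mem_divisors.1 he).1
  have hNZe : NeZero e := ⟨left_ne_zero_of_mul hg⟩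
  have hNZh : NeZero h := ⟨right_ne_zero_of_mul hg⟩
  rw [sum_dvd_val, Nat.mul_div_cancel_left _ (Nat.pos_of_ne_zero hNZe.ne)]
  ring

lemma card_mul_eq_one (e : ℕ) [NeZero e] :
    ∑ a : ZMod e, ∑ d : ZMod e, (if a * d - 1 = 0 then 1 else 0) = e.totient := by
  have h1 := card_mul_eq_sum e 1
  rw [card_filter, Fintype.sum_prod_type] at h1
  simp only [sub_eq_zero]
  rw [h1]
  rcases (Nat.one_le_iff_ne_zero.2 (NeZero.ne e)).eq_or_lt with rfl | he
  · simp
  · have : Fact (1 < e) := ⟨he⟩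
    rw [ZMod.val_one]
    simp [NeZero.ne e]

lemma sum_dvd_val_mul_sub_one (e h : ℕ) [NeZero e] [NeZero h] :
    ∑ a : ZMod (e * h), ∑ d : ZMod (e * h), (if e ∣ (a * d - 1).val then 1 else 0) =
      h * (h * e.totient) := by
  have hNZ : NeZero (e * h) := ⟨mul_ne_zero (NeZero.ne e) (NeZero.ne h)⟩
  have h1 : ∀ a : ZMod (e * h), ∑ d : ZMod (e * h), (if e ∣ (a * d - 1).val then 1 else 0) =
      (fun x : ZMod e => h * ∑ y : ZMod e, if x * y - 1 = 0 then 1 else 0) (a.val : ZMod e) := by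
    intro a
    have h2 := sum_zmod_val_cast e h fun y : ZMod e => if (a.val : ZMod e) * y - 1 = 0 then 1 else 0
    refine Eq.trans (sum_congr rfl fun d _ => ?_) h2
    simp [dvd_val_iff, ZMod.natCast_val]
  have h3 := sum_zmod_val_cast e h
    fun x : ZMod e => h * ∑ y : ZMod e, if x * y - 1 = 0 then 1 else 0
  rw [sum_congr rfl fun d _ => h1 d, h3, ← mul_sum, card_mul_eq_one]

lemma slCount_eq (g : ℕ) (hg : g ≠ 0) :
    slCount g = g * ∑ e ∈ g.divisors, (g / e) * (g / e).totient * e.totient := by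
  have hNZ : NeZero g := ⟨hg⟩
  have h1 : slCount g = Nat.card {γ : Matrix.SpecialLinearGroup (Fin 2) (ZMod g) // True} :=
    (Nat.card_congr (Equiv.subtypeUnivEquiv fun _ => trivial)).symm
  rw [h1, card_sl_diagonal g (fun _ _ => True), mul_sum]
  refine sum_congr rfl fun e he => ?_
  obtain ⟨h, rfl⟩ := (Nat.mem_divisors.1 he).1
  have hNZe : NeZero e := ⟨left_ne_zero_of_mul hg⟩
  have hNZh : NeZero h := ⟨right_ne_zero_of_mul hg⟩
  simp only [true_and]
  rw [sum_dvd_val_mul_sub_one, Nat.mul_div_cancel_left _ (Nat.pos_of_ne_zero hNZe.ne)]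
  ring

lemma rootCount_one (Δ n : ℤ) : rootCount Δ n 1 = 1 := by
  unfold rootCount
  rw [Nat.card_eq_one_iff_unique]
  refine ⟨⟨fun a b => Subtype.ext (Subsingleton.elim _ _)⟩, ⟨⟨0, Subsingleton.elim _ _⟩⟩⟩

lemma rootCount_mul (Δ n : ℤ) {a b : ℕ} (h : a.Coprime b) :
    rootCount Δ n (a * b) = rootCount Δ n a * rootCount Δ n b := by
  unfold rootCount
  rw [← Nat.card_prod]
  let f := ZMod.chineseRemainder h
  refine Nat.card_congr (((f.toEquiv.subtypeEquiv (q := fun x =>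
    ((n : ZMod a) - Δ * x.1) * x.1 - 1 = 0 ∧ ((n : ZMod b) - Δ * x.2) * x.2 - 1 = 0)
    fun x => ?_)).trans (Equiv.subtypeProdEquivProd
    (p := fun x : ZMod a => ((n : ZMod a) - Δ * x) * x - 1 = 0)
    (q := fun x : ZMod b => ((n : ZMod b) - Δ * x) * x - 1 = 0)))
  rw [← f.map_eq_zero_iff, Prod.ext_iff]
  simp [f]

/-- The local root counts as an arithmetic function. -/
noncomputable def rootFn (Δ n : ℤ) : ArithmeticFunction ℝ :=
  ⟨fun e => if e = 0 then 0 else (rootCount Δ n e : ℝ), by simp⟩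

/-- Euler's totient as an arithmetic function. -/
def totientFn : ArithmeticFunction ℝ := ⟨fun e => (e.totient : ℝ), by simp⟩

/-- Jordan's totient of order two, written as a convolution. -/
noncomputable def jordanFn : ArithmeticFunction ℝ :=
  totientFn * ArithmeticFunction.pmul
    ((ArithmeticFunction.id : ArithmeticFunction ℕ) : ArithmeticFunction ℝ) totientFn

/-- The normalised number of matrices on which a form takes a prescribed value. -/
noncomputable def ratioFn (Δ n : ℤ) : ArithmeticFunction ℝ :=
  ArithmeticFunction.pdiv (ArithmeticFunction.pmul
    ((ArithmeticFunction.id : ArithmeticFunction ℕ) : ArithmeticFunction ℝ)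
    (rootFn Δ n * totientFn)) jordanFn

/-- The singular series as an arithmetic function. -/
noncomputable def singFn (Δ n : ℤ) : ArithmeticFunction ℝ :=
  (ArithmeticFunction.moebius : ArithmeticFunction ℤ) * ratioFn Δ n

lemma rootFn_apply (Δ n : ℤ) {e : ℕ} (he : e ≠ 0) : rootFn Δ n e = rootCount Δ n e := by
  simp [rootFn, he]

lemma totientFn_apply (e : ℕ) : totientFn e = e.totient := rfl

lemma isMultiplicative_rootFn (Δ n : ℤ) : (rootFn Δ n).IsMultiplicative := by
  rw [ArithmeticFunction.IsMultiplicative.iff_ne_zero]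
  refine ⟨by rw [rootFn_apply _ _ one_ne_zero, rootCount_one, Nat.cast_one], fun hm hn h => ?_⟩
  rw [rootFn_apply _ _ hm, rootFn_apply _ _ hn, rootFn_apply _ _ (mul_ne_zero hm hn),
    rootCount_mul Δ n h, Nat.cast_mul]

lemma isMultiplicative_totientFn : totientFn.IsMultiplicative := by
  rw [ArithmeticFunction.IsMultiplicative.iff_ne_zero]
  refine ⟨by simp [totientFn_apply], fun _ _ h => ?_⟩
  rw [totientFn_apply, totientFn_apply, totientFn_apply, Nat.totient_mul h, Nat.cast_mul]

lemma isMultiplicative_jordanFn : jordanFn.IsMultiplicative :=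
  isMultiplicative_totientFn.mul
    (ArithmeticFunction.isMultiplicative_id.natCast.pmul isMultiplicative_totientFn)

lemma isMultiplicative_ratioFn (Δ n : ℤ) : (ratioFn Δ n).IsMultiplicative :=
  (ArithmeticFunction.isMultiplicative_id.natCast.pmul
    ((isMultiplicative_rootFn Δ n).mul isMultiplicative_totientFn)).pdiv isMultiplicative_jordanFn

lemma isMultiplicative_singFn (Δ n : ℤ) : (singFn Δ n).IsMultiplicative :=
  ArithmeticFunction.isMultiplicative_moebius.intCast.mul (isMultiplicative_ratioFn Δ n)

lemma jordanFn_apply (g : ℕ) :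
    jordanFn g = ∑ e ∈ g.divisors, ((g / e : ℕ) : ℝ) * (g / e).totient * e.totient := by
  rw [jordanFn, ArithmeticFunction.mul_apply, Nat.sum_divisorsAntidiagonal
    (f := fun a b => totientFn a *
      (ArithmeticFunction.pmul
        ((ArithmeticFunction.id : ArithmeticFunction ℕ) : ArithmeticFunction ℝ) totientFn) b)]
  refine sum_congr rfl fun e _ => ?_
  rw [ArithmeticFunction.pmul_apply, totientFn_apply, totientFn_apply,
    ArithmeticFunction.natCoe_apply, ArithmeticFunction.id_apply]
  ring

lemma ratioFn_apply (Δ n : ℤ) {g : ℕ} (hg : g ≠ 0) :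
    ratioFn Δ n g = (g : ℝ) * formCount 1 0 0 Δ g n / slCount g := by
  rw [formCount_diagonal Δ n g hg, slCount_eq g hg]
  push_cast
  rw [← jordanFn_apply, ratioFn, ArithmeticFunction.pdiv_apply, ArithmeticFunction.pmul_apply,
    ArithmeticFunction.natCoe_apply, ArithmeticFunction.id_apply, ArithmeticFunction.mul_apply,
    Nat.sum_divisorsAntidiagonal (f := fun a b => rootFn Δ n a * totientFn b), mul_div_mul_left]
  · congr 2
    refine sum_congr rfl fun e he => ?_
    rw [rootFn_apply _ _ (Nat.pos_of_mem_divisors he).ne', totientFn_apply, mul_comm]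
  · exact_mod_cast hg

lemma singSeriesTerm_eq_singFn (A B C D : ℤ)
    (hgcd : Int.gcd A (Int.gcd B (Int.gcd C D)) = 1) (hΔ : A * D - B * C ≠ 0)
    (n : ℤ) {q : ℕ} (hq : q ≠ 0) :
    singSeriesTerm A B C D q n = singFn (A * D - B * C) n q := by
  rw [singSeriesTerm_eq A B C D n q hq, singFn, ArithmeticFunction.mul_apply,
    Nat.sum_divisorsAntidiagonal (f := fun a b =>
      ((ArithmeticFunction.moebius : ArithmeticFunction ℤ) : ArithmeticFunction ℝ) a *
      ratioFn (A * D - B * C) n b)]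
  refine sum_congr rfl fun d hd => ?_
  have hqd : q / d ≠ 0 :=
    (Nat.div_pos (Nat.divisor_le hd) (Nat.pos_of_mem_divisors hd)).ne'
  rw [ratioFn_apply _ _ hqd, formCount_eq_diagonal A B C D hgcd hΔ,
    ArithmeticFunction.intCoe_apply]

lemma mul_apply_prime_pow {R : Type*} [CommSemiring R] (f g : ArithmeticFunction R) {p : ℕ}
    (hp : p.Prime) (k : ℕ) :
    (f * g) (p ^ k) = ∑ j ∈ range (k + 1), f (p ^ j) * g (p ^ (k - j)) := by
  rw [ArithmeticFunction.mul_apply, Nat.sum_divisorsAntidiagonal (f := fun a b => f a * g b),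
    Nat.sum_divisors_prime_pow hp]
  refine sum_congr rfl fun j hj => ?_
  rw [Nat.pow_div (Nat.lt_succ_iff.1 (mem_range.1 hj)) hp.pos]

lemma mul_totientFn_prime_pow_succ (f : ArithmeticFunction ℝ) {p : ℕ} (hp : p.Prime) (k : ℕ) :
    (f * totientFn) (p ^ (k + 1)) =
      p * (f * totientFn) (p ^ k) + f (p ^ (k + 1)) - f (p ^ k) := by
  rw [mul_apply_prime_pow f _ hp, mul_apply_prime_pow f _ hp, sum_range_succ, sum_range_succ,
    sum_range_succ, mul_add, mul_sum]
  have h1 : ∀ j ∈ range k, f (p ^ j) * totientFn (p ^ (k + 1 - j)) =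
      p * (f (p ^ j) * totientFn (p ^ (k - j))) := by
    intro j hj
    obtain ⟨m, rfl⟩ := Nat.exists_eq_add_of_lt (mem_range.1 hj)
    rw [show j + m + 1 + 1 - j = m + 2 by omega, show j + m + 1 - j = m + 1 by omega,
      totientFn_apply, totientFn_apply, Nat.totient_prime_pow_succ hp,
      Nat.totient_prime_pow_succ hp]
    push_cast
    ring
  rw [sum_congr rfl h1, Nat.sub_self, Nat.sub_self, show k + 1 - k = 0 + 1 by omega,
    totientFn_apply, totientFn_apply, Nat.totient_prime_pow_succ hp]
  have : ((p - 1 : ℕ) : ℝ) = p - 1 := by rw [Nat.cast_sub hp.one_le, Nat.cast_one]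
  push_cast [this]
  simp
  ring

lemma jordanFn_prime_pow_succ {p : ℕ} (hp : p.Prime) (k : ℕ) :
    jordanFn (p ^ (k + 1)) = (p : ℝ) ^ (2 * k) * (p ^ 2 - 1) := by
  have hc : ((p - 1 : ℕ) : ℝ) = p - 1 := by rw [Nat.cast_sub hp.one_le, Nat.cast_one]
  have h1 : ∀ k, jordanFn (p ^ (k + 1)) = p * jordanFn (p ^ k) +
      (p : ℝ) ^ (k + 1) * ((p ^ (k + 1)).totient : ℕ) - (p : ℝ) ^ k * ((p ^ k).totient : ℕ) := by
    intro k
    rw [jordanFn, mul_comm totientFn, mul_totientFn_prime_pow_succ _ hp]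
    simp [ArithmeticFunction.pmul_apply, ArithmeticFunction.natCoe_apply, totientFn_apply]
  induction k with
  | zero =>
    rw [h1, pow_zero, isMultiplicative_jordanFn.map_one, Nat.totient_prime_pow_succ hp]
    push_cast [hc]
    simp
    ring
  | succ k ih =>
    rw [h1, ih, Nat.totient_prime_pow_succ hp, Nat.totient_prime_pow_succ hp]
    push_cast [hc]
    ring

/-- The local factor `(1 - p⁻²)⁻¹`. -/
noncomputable def localWeight (p : ℕ) : ℝ := (1 - ((p : ℝ) ^ 2)⁻¹)⁻¹

lemma localWeight_pos {p : ℕ} (hp : p.Prime) : 0 < localWeight p := by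
  have h2 : (2 : ℝ) ≤ p := by exact_mod_cast hp.two_le
  refine inv_pos.2 (sub_pos.2 (inv_lt_one_of_one_lt₀ (by nlinarith)))

lemma localWeight_le {p : ℕ} (hp : p.Prime) : localWeight p ≤ 4 / 3 := by
  have h2 : (2 : ℝ) ≤ p := by exact_mod_cast hp.two_le
  have h4 : ((p : ℝ) ^ 2)⁻¹ ≤ 4⁻¹ := inv_anti₀ (by norm_num) (by nlinarith)
  rw [localWeight, show (4 / 3 : ℝ) = (3 / 4)⁻¹ by norm_num]
  exact inv_anti₀ (by norm_num) (by linarith)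

lemma ratioFn_prime_pow_succ (Δ n : ℤ) {p : ℕ} (hp : p.Prime) (k : ℕ) :
    ratioFn Δ n (p ^ (k + 1)) =
      localWeight p * ((rootFn Δ n * totientFn) (p ^ (k + 1)) / (p : ℝ) ^ (k + 1)) := by
  have h2 : (2 : ℝ) ≤ p := by exact_mod_cast hp.two_le
  have h3 : (p : ℝ) ^ 2 - 1 ≠ 0 := by nlinarith
  rw [ratioFn, ArithmeticFunction.pdiv_apply, ArithmeticFunction.pmul_apply,
    ArithmeticFunction.natCoe_apply, ArithmeticFunction.id_apply, jordanFn_prime_pow_succ hp,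
    localWeight]
  have h4 : 1 - ((p : ℝ) ^ 2)⁻¹ = (p ^ 2 - 1) / p ^ 2 := by field_simp
  rw [h4, inv_div]
  push_cast
  field_simp
  ring

lemma singFn_prime_pow_succ (Δ n : ℤ) {p : ℕ} (hp : p.Prime) (k : ℕ) :
    singFn Δ n (p ^ (k + 1)) = ratioFn Δ n (p ^ (k + 1)) - ratioFn Δ n (p ^ k) := by
  rw [singFn, mul_comm, mul_apply_prime_pow _ _ hp, sum_range_succ, sum_range_succ,
    sum_eq_zero]
  · have : k + 1 - k = 1 := by omega
    rw [Nat.sub_self, this]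
    simp [ArithmeticFunction.moebius_apply_prime hp]
    ring
  · intro j hj
    obtain ⟨m, rfl⟩ := Nat.exists_eq_add_of_lt (mem_range.1 hj)
    rw [show j + m + 1 + 1 - j = m + 2 by omega, ArithmeticFunction.intCoe_apply,
      ArithmeticFunction.moebius_apply_prime_pow hp (by omega), if_neg (by omega)]
    simp

lemma singFn_prime_pow_add_two (Δ n : ℤ) {p : ℕ} (hp : p.Prime) (k : ℕ) :
    singFn Δ n (p ^ (k + 2)) = localWeight p *
      (((rootCount Δ n (p ^ (k + 2)) : ℝ) - rootCount Δ n (p ^ (k + 1))) / (p : ℝ) ^ (k + 2)) := by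
  have hp0 : (p : ℝ) ≠ 0 := by exact_mod_cast hp.ne_zero
  rw [singFn_prime_pow_succ Δ n hp, ratioFn_prime_pow_succ Δ n hp, ratioFn_prime_pow_succ Δ n hp,
    mul_totientFn_prime_pow_succ _ hp, rootFn_apply _ _ (pow_ne_zero _ hp.ne_zero),
    rootFn_apply _ _ (pow_ne_zero _ hp.ne_zero), ← mul_sub]
  congr 1
  field_simp
  ring

lemma singFn_prime (Δ n : ℤ) {p : ℕ} (hp : p.Prime) :
    singFn Δ n p = localWeight p *
      (((rootCount Δ n p : ℝ) - 1) / p + ((p : ℝ) ^ 2)⁻¹) := by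
  have hp0 : (p : ℝ) ≠ 0 := by exact_mod_cast hp.ne_zero
  have h1 := singFn_prime_pow_succ Δ n hp 0
  rw [ratioFn_prime_pow_succ Δ n hp, mul_totientFn_prime_pow_succ _ hp, pow_zero,
    (isMultiplicative_ratioFn Δ n).map_one,
    ((isMultiplicative_rootFn Δ n).mul isMultiplicative_totientFn).map_one,
    (isMultiplicative_rootFn Δ n).map_one, zero_add, pow_one, pow_one,
    rootFn_apply _ _ hp.ne_zero] at h1
  have h2 : localWeight p * (1 - ((p : ℝ) ^ 2)⁻¹) = 1 := by
    have h2 : (2 : ℝ) ≤ p := by exact_mod_cast hp.two_le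
    exact inv_mul_cancel₀ (sub_pos.2 (inv_lt_one_of_one_lt₀ (by nlinarith))).ne'
  rw [h1]
  have h3 : ((p : ℝ) * 1 + rootCount Δ n p - 1) / p = 1 + ((rootCount Δ n p : ℝ) - 1) / p := by
    field_simp
    ring
  rw [h3]
  linear_combination h2

lemma dvd_or_dvd_of_pow_dvd_mul {p : ℕ} (hp : p.Prime) {k v : ℕ} {x z y Δ D : ℤ}
    (hv : ∀ i, (p : ℤ) ^ i ∣ D → i ≤ v) (hxz : (p : ℤ) ^ k ∣ x * z)
    (hy : Δ * x + z = -y) (hD : (p : ℤ) ^ k ∣ y ^ 2 - D) :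
    (p : ℤ) ^ (k - min v k / 2) ∣ x ∨ (p : ℤ) ^ (k - min v k / 2) ∣ z := by
  obtain ⟨i, j, hij, hx, hz⟩ : ∃ i j, i + j = k ∧ (p : ℤ) ^ i ∣ x ∧ (p : ℤ) ^ j ∣ z := by
    have h1 : p ^ k ∣ x.natAbs * z.natAbs := by
      rw [← Int.natAbs_mul, ← Int.natCast_dvd]
      exact_mod_cast hxz
    obtain ⟨a, b, ha, hb, hab⟩ := exists_dvd_and_dvd_of_dvd_mul h1
    obtain ⟨i, hi, rfl⟩ := (Nat.dvd_prime_pow hp).1 (⟨b, hab⟩ : a ∣ p ^ k)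
    have hb' : b = p ^ (k - i) := by
      have h2 : p ^ i * b = p ^ i * p ^ (k - i) := by
        rw [← hab, ← pow_add, Nat.add_sub_cancel' hi]
      exact Nat.eq_of_mul_eq_mul_left (pow_pos hp.pos i) h2
    refine ⟨i, k - i, by omega, ?_, ?_⟩
    · rw [← Int.natCast_pow, Int.natCast_dvd]; exact ha
    · rw [← Int.natCast_pow, Int.natCast_dvd, ← hb']; exact hb
  by_cases h1 : k - min v k / 2 ≤ i
  · exact Or.inl ((pow_dvd_pow _ h1).trans hx)
  by_cases h2 : k - min v k / 2 ≤ j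
  · exact Or.inr ((pow_dvd_pow _ h2).trans hz)
  exfalso
  set m := min v k / 2 with hm
  have hx' : (p : ℤ) ^ (m + 1) ∣ x := (pow_dvd_pow _ (by omega)).trans hx
  have hz' : (p : ℤ) ^ (m + 1) ∣ z := (pow_dvd_pow _ (by omega)).trans hz
  have hy' : (p : ℤ) ^ (m + 1) ∣ y := by
    rw [← dvd_neg, ← hy]
    exact dvd_add (hx'.mul_left _) hz'
  have hy2 : (p : ℤ) ^ (2 * m + 2) ∣ y ^ 2 := by
    have := pow_dvd_pow_of_dvd hy' 2
    rwa [← pow_mul, show (m + 1) * 2 = 2 * m + 2 by ring] at this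
  have hD' : (p : ℤ) ^ (2 * m + 2) ∣ y ^ 2 - D := (pow_dvd_pow _ (by omega)).trans hD
  have := hv _ ((dvd_sub_right hy2).1 hD')
  omega

lemma card_linear_le (e : ℕ) [NeZero e] {Δ : ℤ} (hΔ : Δ ≠ 0) (c : ZMod e) :
    #{x : ZMod e | (Δ : ZMod e) * x = c} ≤ Δ.natAbs := by
  rw [card_mul_eq]
  split_ifs
  · refine Nat.le_of_dvd (Int.natAbs_pos.2 hΔ) ?_
    rw [← Int.natCast_dvd]
    have h1 : ((e.gcd (Δ : ZMod e).val : ℕ) : ℤ) ∣ ((Δ : ZMod e).val : ℤ) :=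
      Int.natCast_dvd_natCast.2 (Nat.gcd_dvd_right _ _)
    have h2 : ((e.gcd (Δ : ZMod e).val : ℕ) : ℤ) ∣ (e : ℤ) :=
      Int.natCast_dvd_natCast.2 (Nat.gcd_dvd_left _ _)
    rw [ZMod.val_intCast] at h1
    exact (Int.dvd_iff_dvd_of_dvd_sub (by
      have := h2.trans (Int.dvd_self_sub_emod (x := Δ) (m := (e : ℤ)))
      exact this)).2 h1
  · exact Nat.zero_le _

lemma rootCount_prime_pow_le {Δ n : ℤ} (hΔ : Δ ≠ 0) {p : ℕ} (hp : p.Prime) {k v : ℕ}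
    (hv : ∀ i, (p : ℤ) ^ i ∣ n ^ 2 - 4 * Δ → i ≤ v) :
    rootCount Δ n (p ^ k) ≤ p ^ (min v k / 2) * (1 + Δ.natAbs) := by
  set m := min v k / 2 with hm
  have hk : p ^ k = p ^ (k - m) * p ^ m := by
    rw [← pow_add]; congr 1; omega
  have hNZe : NeZero (p ^ (k - m)) := ⟨pow_ne_zero _ hp.ne_zero⟩
  have hNZh : NeZero (p ^ m) := ⟨pow_ne_zero _ hp.ne_zero⟩
  rw [hk, rootCount, Nat.card_eq_fintype_card, Fintype.card_subtype]
  set e := p ^ (k - m) with he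
  set h := p ^ m with hh
  rcases (univ.filter fun d : ZMod (e * h) =>
    ((n : ZMod (e * h)) - Δ * d) * d - 1 = 0).eq_empty_or_nonempty with h0 | ⟨d₀, hd₀⟩
  · rw [h0]; simp
  have hroot : ∀ d : ZMod (e * h), ((n : ZMod (e * h)) - Δ * d) * d - 1 = 0 →
      (p : ℤ) ^ k ∣ (n - Δ * (d.val : ℤ)) * d.val - 1 := by
    intro d hd
    have : ((e * h : ℕ) : ℤ) ∣ (n - Δ * (d.val : ℤ)) * d.val - 1 := by
      rw [← ZMod.intCast_zmod_eq_zero_iff_dvd]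
      push_cast
      simpa [ZMod.natCast_val] using hd
    have hk' : (p : ℤ) ^ k = ((e * h : ℕ) : ℤ) := by rw [← hk, Int.natCast_pow]
    rw [hk']
    exact this
  have hr₀ := hroot d₀ (mem_filter.1 hd₀).2
  let f₁ : ZMod e → ℕ := fun y => if y = (d₀.val : ZMod e) then 1 else 0
  let f₂ : ZMod e → ℕ := fun y => if (Δ : ZMod e) * y = n - Δ * (d₀.val : ZMod e) then 1 else 0
  have hle : ∀ d : ZMod (e * h), (if ((n : ZMod (e * h)) - Δ * d) * d - 1 = 0 then 1 else 0) ≤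
      f₁ (d.val : ZMod e) + f₂ (d.val : ZMod e) := by
    intro d
    split_ifs with hd
    swap
    · exact Nat.zero_le _
    have hr := hroot d hd
    have h3 := dvd_or_dvd_of_pow_dvd_mul hp hv (k := k) (x := (d.val : ℤ) - d₀.val)
      (z := n - Δ * (d.val + d₀.val)) (y := 2 * Δ * d₀.val - n) (Δ := Δ) ?_ (by ring) ?_
    · rw [← hm] at h3
      have hcast : ∀ t : ℤ, (p : ℤ) ^ (k - m) ∣ t ↔ (t : ZMod e) = 0 := by
        intro t
        rw [ZMod.intCast_zmod_eq_zero_iff_dvd, he, Int.natCast_pow]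
      rw [hcast, hcast] at h3
      push_cast at h3
      rcases h3 with h3 | h3
      · have : f₁ (d.val : ZMod e) = 1 := if_pos (sub_eq_zero.1 h3)
        omega
      · have : f₂ (d.val : ZMod e) = 1 := if_pos (by linear_combination -h3)
        omega
    · refine (dvd_sub hr hr₀).trans (dvd_of_eq ?_)
      ring
    · refine (hr₀.mul_left (-4 * Δ)).trans (dvd_of_eq ?_)
      ring
  have hf₁ : ∑ y, f₁ y = 1 := by simp [f₁]
  have hf₂ : ∑ y, f₂ y ≤ Δ.natAbs := by
    rw [← card_filter]
    exact card_linear_le e hΔ _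
  rw [card_filter]
  calc _ ≤ ∑ d : ZMod (e * h), (f₁ (d.val : ZMod e) + f₂ (d.val : ZMod e)) :=
        sum_le_sum fun d _ => hle d
    _ = h * ∑ y, f₁ y + h * ∑ y, f₂ y := by
        rw [sum_add_distrib, sum_zmod_val_cast, sum_zmod_val_cast]
    _ ≤ h * (1 + Δ.natAbs) := by
        rw [hf₁, ← mul_add]
        exact Nat.mul_le_mul_left _ (by omega)

lemma rootCount_prime (Δ n : ℤ) {p : ℕ} [Fact p.Prime] (hp2 : p ≠ 2) (hΔ : ¬ (p : ℤ) ∣ Δ) :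
    (rootCount Δ n p : ℤ) = legendreSym p (n ^ 2 - 4 * Δ) + 1 := by
  have h2 : (2 : ZMod p) ≠ 0 := by
    intro h
    have h3 : ((2 : ℕ) : ZMod p) = 0 := by exact_mod_cast h
    rw [ZMod.natCast_eq_zero_iff] at h3
    exact hp2 ((Nat.prime_dvd_prime_iff_eq Fact.out Nat.prime_two).1 h3)
  have hΔp : (Δ : ZMod p) ≠ 0 := by rwa [Ne, ZMod.intCast_zmod_eq_zero_iff_dvd]
  rw [← legendreSym.card_sqrts p hp2, rootCount, Set.toFinset_card, ← Nat.card_eq_fintype_card]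
  have h4 : (2 * Δ : ZMod p) ≠ 0 := mul_ne_zero h2 hΔp
  have h5 : (4 * Δ : ZMod p) ≠ 0 := by
    rw [show (4 * Δ : ZMod p) = 2 * (2 * Δ) by ring]
    exact mul_ne_zero h2 h4
  congr 1
  refine Nat.card_congr (Equiv.subtypeEquiv
    ((Equiv.mulLeft₀ (2 * Δ : ZMod p) h4).trans (Equiv.subRight (n : ZMod p))) fun d => ?_)
  change _ ↔ (2 * Δ * d - (n : ZMod p)) ^ 2 = ((n ^ 2 - 4 * Δ : ℤ) : ZMod p)
  push_cast
  rw [← mul_right_inj' h5, ← sub_eq_zero (b := (n : ZMod p) ^ 2 - 4 * Δ), mul_zero]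
  constructor <;> intro h <;> linear_combination -h

/-- Partial sums of a non-negative multiplicative function are bounded by its Euler product. -/
lemma sum_le_prod_primesBelow {G : ℕ → ℝ} (hG0 : ∀ n, 0 ≤ G n) (hG1 : G 1 = 1)
    (hmul : ∀ {m n : ℕ}, Nat.Coprime m n → G (m * n) = G m * G n) {E : ℕ → ℝ}
    (hE : ∀ p, p.Prime → ∀ K, ∑ k ∈ range K, G (p ^ k) ≤ E p) (x : ℕ) :
    ∑ d ∈ Ico 1 x, G d ≤ ∏ p ∈ x.primesBelow, E p := by
  have hsum : ∀ {p : ℕ}, p.Prime → Summable fun n : ℕ => G (p ^ n) := fun hp =>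
    summable_of_sum_range_le (fun _ => hG0 _) (hE _ hp)
  obtain ⟨h1, h2⟩ := EulerProduct.summable_and_hasSum_smoothNumbers_prod_primesBelow_tsum hG1 hmul
    (fun hp => (hsum hp).norm) x
  calc ∑ d ∈ Ico 1 x, G d
      ≤ ∑' m : x.smoothNumbers, G m := by
        have h3 : ∀ d ∈ Ico 1 x, d ∈ x.smoothNumbers := fun d hd =>
          Nat.mem_smoothNumbers_of_lt (mem_Ico.1 hd).1 (mem_Ico.1 hd).2
        have h4 := h2.summable.sum_le_tsum ((Ico 1 x).subtype (· ∈ x.smoothNumbers))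
          fun _ _ => hG0 _
        rwa [sum_subtype_of_mem (fun d => G d) h3] at h4
    _ = ∏ p ∈ x.primesBelow, ∑' n : ℕ, G (p ^ n) := h2.tsum_eq
    _ ≤ ∏ p ∈ x.primesBelow, E p :=
        prod_le_prod (fun p _ => tsum_nonneg fun _ => hG0 _) fun p hp =>
          Real.tsum_le_of_sum_range_le (fun _ => hG0 _)
            (hE p (Nat.prime_of_mem_primesBelow hp))

/-- The arithmetic function `m ↦ χ(m) / m`. -/
noncomputable def chiFn (D : ℤ) : ArithmeticFunction ℝ := ⟨fun m => chi D m / m, by simp⟩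

lemma chiFn_apply (D : ℤ) (m : ℕ) : chiFn D m = chi D m / m := rfl

lemma chiFn_mul (D : ℤ) (a b : ℕ) : chiFn D (a * b) = chiFn D a * chiFn D b := by
  rw [chiFn_apply, chiFn_apply, chiFn_apply, chi_mul, Nat.cast_mul, mul_div_mul_comm]

lemma isMultiplicative_chiFn (D : ℤ) : (chiFn D).IsMultiplicative :=
  ⟨by rw [chiFn_apply, chi_one, Nat.cast_one, div_one], fun _ => chiFn_mul D _ _⟩

/-- The Dirichlet inverse of `chiFn`. -/
noncomputable def moebiusChiFn (D : ℤ) : ArithmeticFunction ℝ :=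
  ArithmeticFunction.pmul ((ArithmeticFunction.moebius : ArithmeticFunction ℤ) :
    ArithmeticFunction ℝ) (chiFn D)

lemma moebiusChiFn_apply (D : ℤ) (m : ℕ) :
    moebiusChiFn D m = (ArithmeticFunction.moebius m : ℝ) * chiFn D m := rfl

lemma moebiusChiFn_mul_chiFn (D : ℤ) : moebiusChiFn D * chiFn D = 1 := by
  ext n
  rw [ArithmeticFunction.mul_apply]
  have h1 : ∀ x ∈ n.divisorsAntidiagonal, moebiusChiFn D x.1 * chiFn D x.2 =
      (ArithmeticFunction.moebius x.1 : ℝ) * chiFn D n := by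
    intro x hx
    rw [← (Nat.mem_divisorsAntidiagonal.1 hx).1, chiFn_mul, moebiusChiFn_apply, mul_assoc]
  rw [sum_congr rfl h1, ← sum_mul,
    Nat.sum_divisorsAntidiagonal (f := fun a _ => (ArithmeticFunction.moebius a : ℝ))]
  have h2 := sum_divisors_moebius n
  rw [← Int.cast_sum, h2]
  by_cases hn : n = 1
  · subst hn
    simp [(isMultiplicative_chiFn D).map_one]
  · simp [hn]

/-- The correction factor comparing the singular series with the character. -/
noncomputable def corrFn (Δ n D : ℤ) : ArithmeticFunction ℝ := singFn Δ n * moebiusChiFn D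

lemma corrFn_mul_chiFn (Δ n D : ℤ) : corrFn Δ n D * chiFn D = singFn Δ n := by
  rw [corrFn, mul_assoc, moebiusChiFn_mul_chiFn, mul_one]

lemma isMultiplicative_corrFn (Δ n D : ℤ) : (corrFn Δ n D).IsMultiplicative :=
  (isMultiplicative_singFn Δ n).mul
    (ArithmeticFunction.isMultiplicative_moebius.intCast.pmul (isMultiplicative_chiFn D))

lemma corrFn_prime_pow_succ (Δ n D : ℤ) {p : ℕ} (hp : p.Prime) (k : ℕ) :
    corrFn Δ n D (p ^ (k + 1)) =
      singFn Δ n (p ^ (k + 1)) - singFn Δ n (p ^ k) * (chi D p / p) := by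
  rw [corrFn, mul_apply_prime_pow _ _ hp, sum_range_succ, sum_range_succ, sum_eq_zero]
  · have : k + 1 - k = 1 := by omega
    rw [Nat.sub_self, this]
    simp [ArithmeticFunction.moebius_apply_prime hp, moebiusChiFn_apply, chiFn_apply, chi_one]
    ring
  · intro j hj
    obtain ⟨m, rfl⟩ := Nat.exists_eq_add_of_lt (mem_range.1 hj)
    rw [show j + m + 1 + 1 - j = m + 2 by omega, moebiusChiFn_apply,
      ArithmeticFunction.moebius_apply_prime_pow hp (by omega), if_neg (by omega)]
    simp

lemma abs_singFn_prime_pow_le {Δ n : ℤ} (hΔ : Δ ≠ 0) {p : ℕ} (hp : p.Prime) {v : ℕ}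
    (hv : ∀ i, (p : ℤ) ^ i ∣ n ^ 2 - 4 * Δ → i ≤ v) (k : ℕ) :
    |singFn Δ n (p ^ k)| ≤ 2 * (1 + Δ.natAbs) * ((p : ℝ) ^ (min v k / 2) / (p : ℝ) ^ k) := by
  have hL : (2 : ℝ) ≤ 1 + Δ.natAbs := by
    have : 1 ≤ Δ.natAbs := Int.natAbs_pos.2 hΔ
    have : (1 : ℝ) ≤ Δ.natAbs := by exact_mod_cast this
    linarith
  have hp2 : (2 : ℝ) ≤ p := by exact_mod_cast hp.two_le
  have hp0 : (0 : ℝ) < p := by linarith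
  have hR : ∀ k, (rootCount Δ n (p ^ k) : ℝ) ≤ (p : ℝ) ^ (min v k / 2) * (1 + Δ.natAbs) := by
    intro k
    have := rootCount_prime_pow_le hΔ hp (k := k) hv
    exact_mod_cast this
  set L : ℝ := 1 + Δ.natAbs with hLdef
  have hw := localWeight_le hp
  have hw0 := localWeight_pos hp
  rcases k with _ | _ | k
  · rw [pow_zero, (isMultiplicative_singFn Δ n).map_one]
    simp
    linarith
  · have h1 := hR 1
    simp only [zero_add, pow_one] at h1 ⊢
    rw [singFn_prime Δ n hp, abs_mul, abs_of_pos hw0]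
    set q := (p : ℝ) ^ (min v 1 / 2) with hq
    have hq1 : 1 ≤ q := one_le_pow₀ (by linarith)
    have h2 : |(rootCount Δ n p : ℝ) - 1| ≤ q * L := by
      rw [abs_le]
      constructor
      · have : (0 : ℝ) ≤ rootCount Δ n p := Nat.cast_nonneg _
        nlinarith
      · linarith
    have h3 : |((rootCount Δ n p : ℝ) - 1) / p + ((p : ℝ) ^ 2)⁻¹| ≤ q * L / p + q / p := by
      refine (abs_add_le _ _).trans (add_le_add ?_ ?_)
      · rw [abs_div, abs_of_pos hp0]
        exact div_le_div_of_nonneg_right h2 hp0.le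
      · rw [abs_of_nonneg (by positivity), inv_eq_one_div]
        exact div_le_div₀ (by linarith) hq1 hp0 (by nlinarith)
    calc localWeight p * |((rootCount Δ n p : ℝ) - 1) / p + ((p : ℝ) ^ 2)⁻¹|
        ≤ 4 / 3 * (q * L / p + q / p) := mul_le_mul hw h3 (abs_nonneg _) (by norm_num)
      _ = 4 / 3 * (L + 1) * (q / p) := by ring
      _ ≤ 2 * L * (q / p) := by
        refine mul_le_mul_of_nonneg_right (by linarith) (by positivity)
  · rw [singFn_prime_pow_add_two Δ n hp, abs_mul, abs_of_pos hw0, abs_div,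
      abs_of_pos (pow_pos hp0 _)]
    have h1 := hR (k + 2)
    have h2 := hR (k + 1)
    have h3 : (p : ℝ) ^ (min v (k + 1) / 2) ≤ (p : ℝ) ^ (min v (k + 2) / 2) :=
      pow_le_pow_right₀ (by linarith) (Nat.div_le_div_right (min_le_min_left v (by omega)))
    have h4 : |(rootCount Δ n (p ^ (k + 2)) : ℝ) - rootCount Δ n (p ^ (k + 1))| ≤
        (p : ℝ) ^ (min v (k + 2) / 2) * L := by
      have h5 : (0 : ℝ) ≤ rootCount Δ n (p ^ (k + 2)) := Nat.cast_nonneg _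
      have h6 : (0 : ℝ) ≤ rootCount Δ n (p ^ (k + 1)) := Nat.cast_nonneg _
      have h7 := mul_le_mul_of_nonneg_right h3 (by linarith : (0 : ℝ) ≤ L)
      rw [abs_le]
      constructor <;> linarith
    calc _ ≤ 4 / 3 * ((p : ℝ) ^ (min v (k + 2) / 2) * L / (p : ℝ) ^ (k + 2)) :=
          mul_le_mul hw (div_le_div_of_nonneg_right h4 (by positivity)) (by positivity)
            (by norm_num)
      _ = 4 / 3 * L * ((p : ℝ) ^ (min v (k + 2) / 2) / (p : ℝ) ^ (k + 2)) := by ring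
      _ ≤ _ := mul_le_mul_of_nonneg_right (by linarith) (by positivity)

lemma abs_corrFn_prime_pow_le {Δ n : ℤ} (hΔ : Δ ≠ 0) (D : ℤ) {p : ℕ} (hp : p.Prime) {v : ℕ}
    (hv : ∀ i, (p : ℤ) ^ i ∣ n ^ 2 - 4 * Δ → i ≤ v) (k : ℕ) :
    |corrFn Δ n D (p ^ k)| ≤ 4 * (1 + Δ.natAbs) * ((p : ℝ) ^ (min v k / 2) / (p : ℝ) ^ k) := by
  have hp2 : (2 : ℝ) ≤ p := by exact_mod_cast hp.two_le
  have hp0 : (0 : ℝ) < p := by linarith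
  have hs := abs_singFn_prime_pow_le hΔ hp hv
  have hL : (0 : ℝ) ≤ Δ.natAbs := Nat.cast_nonneg _
  rcases k with _ | k
  · rw [pow_zero, (isMultiplicative_corrFn Δ n D).map_one, abs_one, Nat.min_zero, Nat.zero_div,
      pow_zero, div_one]
    linarith
  · rw [corrFn_prime_pow_succ Δ n D hp]
    have h1 := hs (k + 1)
    have h2 := hs k
    have h3 : (p : ℝ) ^ (min v k / 2) ≤ (p : ℝ) ^ (min v (k + 1) / 2) :=
      pow_le_pow_right₀ (by linarith) (Nat.div_le_div_right (min_le_min_left v (by omega)))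
    have h4 : |singFn Δ n (p ^ k) * (chi D p / p)| ≤
        2 * (1 + Δ.natAbs) * ((p : ℝ) ^ (min v (k + 1) / 2) / (p : ℝ) ^ (k + 1)) := by
      rw [abs_mul, abs_div, abs_of_pos hp0]
      calc _ ≤ (2 * (1 + Δ.natAbs) * ((p : ℝ) ^ (min v k / 2) / (p : ℝ) ^ k)) * (1 / p) :=
            mul_le_mul h2 (div_le_div_of_nonneg_right (abs_chi_le _ _) hp0.le) (by positivity)
              (by positivity)
        _ = 2 * (1 + Δ.natAbs) * ((p : ℝ) ^ (min v k / 2) / (p : ℝ) ^ (k + 1)) := by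
            rw [pow_succ]; field_simp
        _ ≤ _ := by gcongr
    refine (abs_sub _ _).trans ((add_le_add h1 h4).trans (le_of_eq ?_))
    ring

lemma abs_corrFn_prime_le {Δ n s D : ℤ} {p : ℕ} (hp : p.Prime) (hD : n ^ 2 - 4 * Δ = s ^ 2 * D)
    (hgood : ¬ (p : ℤ) ∣ 2 * Δ * (n ^ 2 - 4 * Δ)) :
    |corrFn Δ n D p| ≤ 3 / (p : ℝ) ^ 2 := by
  have hFact : Fact p.Prime := ⟨hp⟩
  have hp2 : (2 : ℝ) ≤ p := by exact_mod_cast hp.two_le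
  have hp0 : (0 : ℝ) < p := by linarith
  have hodd : p ≠ 2 := by
    rintro rfl
    exact hgood ⟨Δ * (n ^ 2 - 4 * Δ), by push_cast; ring⟩
  have hpΔ : ¬ (p : ℤ) ∣ Δ := fun h => hgood ((h.mul_left 2).mul_right _)
  have hpD : ¬ (p : ℤ) ∣ s := fun h =>
    hgood (by rw [hD, pow_two]; exact ((h.mul_right s).mul_right D).mul_left _)
  have hchi : chi D p = legendreSym p (n ^ 2 - 4 * Δ) := by
    rw [chi, if_pos (hp.odd_of_ne_two hodd), ← jacobiSym.legendreSym.to_jacobiSym, hD,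
      legendreSym.mul, legendreSym.sq_one', one_mul]
    rwa [Ne, ZMod.intCast_zmod_eq_zero_iff_dvd]
  have hroot : (rootCount Δ n p : ℝ) = chi D p + 1 := by
    rw [hchi]
    exact_mod_cast rootCount_prime Δ n hodd hpΔ
  have h1 := corrFn_prime_pow_succ Δ n D hp 0
  rw [zero_add, pow_one, pow_zero, (isMultiplicative_singFn Δ n).map_one, one_mul,
    singFn_prime Δ n hp, hroot, add_sub_cancel_right] at h1
  have hw := localWeight_le hp
  have hw0 := localWeight_pos hp
  have h2 : localWeight p - 1 = localWeight p * ((p : ℝ) ^ 2)⁻¹ := by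
    have : localWeight p * (1 - ((p : ℝ) ^ 2)⁻¹) = 1 :=
      inv_mul_cancel₀ (sub_pos.2 (inv_lt_one_of_one_lt₀ (by nlinarith))).ne'
    linear_combination this
  have h3 : corrFn Δ n D p = localWeight p * ((p : ℝ) ^ 2)⁻¹ * (chi D p / p + 1) := by
    rw [h1]
    linear_combination (chi D p / p) * h2
  have h4 : |chi D p / p + 1| ≤ 2 := by
    refine (abs_add_le _ _).trans ?_
    rw [abs_div, abs_of_pos hp0, abs_one]
    have : |chi D p| / p ≤ 1 := (div_le_one hp0).2 ((abs_chi_le D p).trans (by linarith))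
    linarith
  rw [h3, abs_mul, abs_of_nonneg (by positivity)]
  calc _ ≤ 4 / 3 * ((p : ℝ) ^ 2)⁻¹ * 2 :=
        mul_le_mul (mul_le_mul_of_nonneg_right hw (by positivity)) h4 (abs_nonneg _)
          (by positivity)
    _ = (8 / 3) * ((p : ℝ) ^ 2)⁻¹ := by ring
    _ ≤ 3 * ((p : ℝ) ^ 2)⁻¹ := mul_le_mul_of_nonneg_right (by norm_num) (by positivity)
    _ = _ := by rw [div_eq_mul_inv]

lemma sum_geometric_le {t : ℝ} (h0 : 0 ≤ t) (ht : t ≤ 5 / 7) (K : ℕ) :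
    ∑ k ∈ range K, t ^ k ≤ 7 / 2 := by
  have h1 := geom_sum_mul_neg t K
  have h2 : 0 ≤ t ^ K := pow_nonneg h0 K
  have h3 : 0 ≤ ∑ k ∈ range K, t ^ k := sum_nonneg fun _ _ => pow_nonneg h0 _
  nlinarith

lemma sum_truncated_geometric_le {t : ℝ} (h0 : 0 ≤ t) (ht : t ≤ 5 / 7) (v K : ℕ) :
    ∑ k ∈ range K, t ^ (k - v) ≤ v + 7 / 2 := by
  calc ∑ k ∈ range K, t ^ (k - v) ≤ ∑ k ∈ range (v + K), t ^ (k - v) :=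
        sum_le_sum_of_subset_of_nonneg (range_subset_range.2 (by omega))
          fun _ _ _ => pow_nonneg h0 _
    _ = ∑ k ∈ range v, t ^ (k - v) + ∑ k ∈ range K, t ^ k := by
        rw [sum_range_add]
        simp
    _ ≤ v + 7 / 2 := by
        refine add_le_add ((sum_le_sum fun k _ => pow_le_one₀ h0 (by linarith)).trans ?_)
          (sum_geometric_le h0 ht K)
        simp

lemma inv_sqrt_le {p : ℕ} (hp : p.Prime) : (√(p : ℝ))⁻¹ ≤ 5 / 7 := by
  have hp2 : (2 : ℝ) ≤ p := by exact_mod_cast hp.two_le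
  rw [show (5 / 7 : ℝ) = (7 / 5)⁻¹ by norm_num]
  exact inv_anti₀ (by norm_num) (Real.le_sqrt_of_sq_le (by linarith))

/-- The correction factor weighted for an application of Rankin's trick. -/
noncomputable def rankinFn (Δ n D : ℤ) (δ : ℝ) (d : ℕ) : ℝ :=
  |corrFn Δ n D d| * (√(d : ℝ) * (d : ℝ) ^ (-δ))

lemma rankinFn_nonneg (Δ n D : ℤ) (δ : ℝ) (d : ℕ) : 0 ≤ rankinFn Δ n D δ d := by
  unfold rankinFn
  positivity

lemma rankinFn_one (Δ n D : ℤ) (δ : ℝ) : rankinFn Δ n D δ 1 = 1 := by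
  simp [rankinFn, (isMultiplicative_corrFn Δ n D).map_one]

lemma rankinFn_mul (Δ n D : ℤ) (δ : ℝ) {a b : ℕ} (h : a.Coprime b) :
    rankinFn Δ n D δ (a * b) = rankinFn Δ n D δ a * rankinFn Δ n D δ b := by
  unfold rankinFn
  rw [(isMultiplicative_corrFn Δ n D).map_mul_of_coprime h, abs_mul, Nat.cast_mul,
    Real.sqrt_mul (Nat.cast_nonneg a), Real.mul_rpow (Nat.cast_nonneg a) (Nat.cast_nonneg b)]
  ring

lemma rankinFn_prime_pow_le {Δ n : ℤ} (hΔ : Δ ≠ 0) (D : ℤ) {δ : ℝ} {p : ℕ}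
    (hp : p.Prime) {v : ℕ} (hv : ∀ i, (p : ℤ) ^ i ∣ n ^ 2 - 4 * Δ → i ≤ v) (k : ℕ) :
    rankinFn Δ n D δ (p ^ k) ≤
      4 * (1 + Δ.natAbs) * ((√(p : ℝ))⁻¹ ^ (k - v) * ((p : ℝ) ^ (-δ)) ^ k) := by
  have hp2 : (2 : ℝ) ≤ p := by exact_mod_cast hp.two_le
  have hp0 : (0 : ℝ) < p := by linarith
  have hs0 : 0 < √(p : ℝ) := Real.sqrt_pos.2 hp0
  have hs1 : 1 ≤ √(p : ℝ) := Real.one_le_sqrt.2 (by linarith)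
  have hsq : (p : ℝ) = √(p : ℝ) ^ 2 := (Real.sq_sqrt hp0.le).symm
  have hroot : √((p ^ k : ℕ) : ℝ) = √(p : ℝ) ^ k := by
    rw [Nat.cast_pow, Real.sqrt_eq_iff_mul_self_eq (by positivity) (by positivity), ← mul_pow,
      Real.mul_self_sqrt hp0.le]
  have hrpow : ((p ^ k : ℕ) : ℝ) ^ (-δ) = ((p : ℝ) ^ (-δ)) ^ k := by
    rw [Nat.cast_pow, ← Real.rpow_natCast, ← Real.rpow_natCast, ← Real.rpow_mul hp0.le,
      ← Real.rpow_mul hp0.le, mul_comm]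
  unfold rankinFn
  rw [hroot, hrpow]
  have h1 := abs_corrFn_prime_pow_le hΔ D hp hv k
  have h2 : (p : ℝ) ^ (min v k / 2) / (p : ℝ) ^ k * √(p : ℝ) ^ k ≤ (√(p : ℝ))⁻¹ ^ (k - v) := by
    have h3 : (p : ℝ) ^ (min v k / 2) ≤ √(p : ℝ) ^ (min v k) := by
      conv_lhs => rw [hsq]
      rw [← pow_mul]
      exact pow_le_pow_right₀ hs1 (Nat.mul_div_le _ _)
    have h4 : (p : ℝ) ^ k = √(p : ℝ) ^ k * √(p : ℝ) ^ k := by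
      rw [← mul_pow, Real.mul_self_sqrt hp0.le]
    have h5 : √(p : ℝ) ^ k = √(p : ℝ) ^ (min v k) * √(p : ℝ) ^ (k - v) := by
      rw [← pow_add]
      congr 1
      omega
    rw [h4, div_mul_eq_mul_div, mul_div_mul_right _ _ (by positivity), inv_pow,
      div_le_iff₀ (by positivity), h5, mul_comm (√(p : ℝ) ^ (min v k)),
      inv_mul_cancel_left₀ (by positivity)]
    exact h3
  calc _ ≤ 4 * (1 + Δ.natAbs) * ((p : ℝ) ^ (min v k / 2) / (p : ℝ) ^ k) *
        (√(p : ℝ) ^ k * ((p : ℝ) ^ (-δ)) ^ k) := mul_le_mul_of_nonneg_right h1 (by positivity)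
    _ = 4 * (1 + Δ.natAbs) * ((p : ℝ) ^ (min v k / 2) / (p : ℝ) ^ k * √(p : ℝ) ^ k *
        ((p : ℝ) ^ (-δ)) ^ k) := by ring
    _ ≤ _ := by gcongr

lemma sum_rankinFn_prime_pow_le {Δ n : ℤ} (hΔ : Δ ≠ 0) (D : ℤ) {δ : ℝ} (hδ : 0 < δ) {p : ℕ}
    (hp : p.Prime) {v : ℕ} (hv : ∀ i, (p : ℤ) ^ i ∣ n ^ 2 - 4 * Δ → i ≤ v) (K : ℕ) :
    ∑ k ∈ range K, rankinFn Δ n D δ (p ^ k) ≤ 14 * (1 + Δ.natAbs) * (v + 1) := by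
  have hp1 : (1 : ℝ) ≤ p := by exact_mod_cast hp.one_le
  have hd1 : (p : ℝ) ^ (-δ) ≤ 1 := Real.rpow_le_one_of_one_le_of_nonpos hp1 (by linarith)
  have hd0 : 0 ≤ (p : ℝ) ^ (-δ) := by positivity
  calc ∑ k ∈ range K, rankinFn Δ n D δ (p ^ k)
      ≤ ∑ k ∈ range K, 4 * (1 + Δ.natAbs) * (√(p : ℝ))⁻¹ ^ (k - v) := by
        refine sum_le_sum fun k _ => (rankinFn_prime_pow_le hΔ D hp hv k).trans ?_
        refine mul_le_mul_of_nonneg_left ?_ (by positivity)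
        exact mul_le_of_le_one_right (by positivity) (pow_le_one₀ hd0 hd1)
    _ ≤ 4 * (1 + Δ.natAbs) * (v + 7 / 2) := by
        rw [← mul_sum]
        exact mul_le_mul_of_nonneg_left
          (sum_truncated_geometric_le (by positivity) (inv_sqrt_le hp) v K) (by positivity)
    _ ≤ _ := by
        have h1 : (0 : ℝ) ≤ Δ.natAbs := Nat.cast_nonneg _
        have h2 : (0 : ℝ) ≤ v := Nat.cast_nonneg _
        nlinarith [mul_nonneg h1 h2]

lemma sum_rankinFn_prime_pow_le_of_not_dvd {Δ n s D : ℤ} (hΔ : Δ ≠ 0) {δ : ℝ} (hδ : 0 < δ)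
    (hδ_le : δ ≤ 1 / 4) {p : ℕ} (hp : p.Prime) (hD : n ^ 2 - 4 * Δ = s ^ 2 * D)
    (hgood : ¬ (p : ℤ) ∣ 2 * Δ * (n ^ 2 - 4 * Δ)) (K : ℕ) :
    ∑ k ∈ range K, rankinFn Δ n D δ (p ^ k) ≤
      1 + 17 * (1 + Δ.natAbs) * (p : ℝ) ^ (-(1 + 2 * δ)) := by
  have hp1 : (1 : ℝ) ≤ p := by exact_mod_cast hp.one_le
  have hp0 : (0 : ℝ) < p := by linarith
  have hv : ∀ i, (p : ℤ) ^ i ∣ n ^ 2 - 4 * Δ → i ≤ 0 := by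
    intro i hi
    by_contra hi0
    exact hgood (((dvd_pow_self _ (by omega)).trans hi).mul_left _)
  have hd1 : (p : ℝ) ^ (-δ) ≤ 1 := Real.rpow_le_one_of_one_le_of_nonpos hp1 (by linarith)
  have hd0 : 0 ≤ (p : ℝ) ^ (-δ) := by positivity
  set u := (√(p : ℝ))⁻¹ * (p : ℝ) ^ (-δ) with hu
  have hu0 : 0 ≤ u := by positivity
  have hu1 : u ≤ 5 / 7 := (mul_le_of_le_one_right (by positivity) hd1).trans (inv_sqrt_le hp)
  have hu2 : u ^ 2 = (p : ℝ) ^ (-(1 + 2 * δ)) := by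
    rw [hu, mul_pow, inv_pow, Real.sq_sqrt hp0.le, ← Real.rpow_natCast, ← Real.rpow_mul hp0.le,
      ← Real.rpow_neg_one, ← Real.rpow_add hp0]
    congr 1
    push_cast
    ring
  have hfirst : rankinFn Δ n D δ p ≤ 3 * (p : ℝ) ^ (-(1 + 2 * δ)) := by
    have h1 := abs_corrFn_prime_le hp hD hgood
    have h2 : (3 / (p : ℝ) ^ 2) * √(p : ℝ) = 3 * (p : ℝ) ^ (-(3 / 2) : ℝ) := by
      rw [Real.sqrt_eq_rpow, div_mul_eq_mul_div, mul_div_assoc, ← Real.rpow_natCast,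
        ← Real.rpow_sub hp0]
      norm_num
    calc rankinFn Δ n D δ p ≤ (3 / (p : ℝ) ^ 2) * (√(p : ℝ) * 1) :=
          mul_le_mul h1 (mul_le_mul_of_nonneg_left hd1 (Real.sqrt_nonneg _)) (by positivity)
            (by positivity)
      _ = 3 * (p : ℝ) ^ (-(3 / 2) : ℝ) := by rw [mul_one, h2]
      _ ≤ _ := mul_le_mul_of_nonneg_left (Real.rpow_le_rpow_of_exponent_le hp1 (by linarith))
            (by norm_num)
  have htail : ∀ k, rankinFn Δ n D δ (p ^ (k + 2)) ≤ 4 * (1 + Δ.natAbs) * u ^ 2 * u ^ k := by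
    intro k
    have := rankinFn_prime_pow_le (δ := δ) hΔ D hp hv (k + 2)
    rw [Nat.sub_zero, ← mul_pow, ← hu, pow_add u] at this
    linarith
  calc ∑ k ∈ range K, rankinFn Δ n D δ (p ^ k)
      ≤ ∑ k ∈ range (2 + K), rankinFn Δ n D δ (p ^ k) :=
        sum_le_sum_of_subset_of_nonneg (range_subset_range.2 (by omega))
          fun _ _ _ => rankinFn_nonneg _ _ _ _ _
    _ = 1 + rankinFn Δ n D δ p + ∑ k ∈ range K, rankinFn Δ n D δ (p ^ (k + 2)) := by
        rw [sum_range_add]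
        simp [sum_range_succ, rankinFn_one, add_comm]
    _ ≤ 1 + 3 * u ^ 2 + 4 * (1 + Δ.natAbs) * u ^ 2 * (7 / 2) := by
        rw [hu2]
        rw [hu2] at htail
        refine add_le_add (add_le_add le_rfl hfirst) ((sum_le_sum fun k _ => htail k).trans ?_)
        rw [← mul_sum]
        exact mul_le_mul_of_nonneg_left (sum_geometric_le hu0 hu1 K) (by positivity)
    _ ≤ 1 + 17 * (1 + Δ.natAbs) * u ^ 2 := by
        have h1 : (0 : ℝ) ≤ Δ.natAbs := Nat.cast_nonneg _
        nlinarith [mul_nonneg h1 (sq_nonneg u)]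
    _ = _ := by rw [hu2]

/-- The Rankin sum of the correction factor grows at most like a small power of `n`. -/
lemma exists_sum_rankinFn_le {Δ : ℤ} (hΔ : Δ ≠ 0) {δ : ℝ} (hδ : 0 < δ) (hδ_le : δ ≤ 1 / 4) :
    ∃ K : ℝ, 1 ≤ K ∧ ∀ n s D : ℤ, n ^ 2 - 4 * Δ = s ^ 2 * D → n ^ 2 - 4 * Δ ≠ 0 → ∀ x : ℕ,
      ∑ d ∈ Ico 1 x, rankinFn Δ n D δ d ≤
        K * ((2 * Δ * (n ^ 2 - 4 * Δ)).natAbs : ℝ) ^ δ := by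
  set L : ℝ := 1 + Δ.natAbs with hL
  have hL1 : 1 ≤ L := by rw [hL]; linarith [(Nat.cast_nonneg Δ.natAbs : (0 : ℝ) ≤ Δ.natAbs)]
  obtain ⟨K, hK, hprod⟩ := exists_prod_primeFactors_le (14 * L) δ (by linarith) hδ
  have hsum : Summable fun m : ℕ => (m : ℝ) ^ (-(1 + 2 * δ)) :=
    Real.summable_nat_rpow.2 (by linarith)
  set S := ∑' m : ℕ, (m : ℝ) ^ (-(1 + 2 * δ)) with hS
  have hS0 : 0 ≤ S := tsum_nonneg fun m => by positivity
  refine ⟨K * Real.exp (17 * L * S), one_le_mul_of_one_le_of_one_le hK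
    (Real.one_le_exp (by positivity)), fun n s D hD hne x => ?_⟩
  set N := (2 * Δ * (n ^ 2 - 4 * Δ)).natAbs with hN
  have hN0 : N ≠ 0 := Int.natAbs_ne_zero.2 (mul_ne_zero (mul_ne_zero two_ne_zero hΔ) hne)
  have hdvdN : ∀ t : ℕ, (t : ℤ) ∣ 2 * Δ * (n ^ 2 - 4 * Δ) ↔ t ∣ N := fun t => Int.natCast_dvd
  set E : ℕ → ℝ := fun p => if p ∣ N then 14 * L * (N.factorization p + 1) else
    1 + 17 * L * (p : ℝ) ^ (-(1 + 2 * δ)) with hE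
  have h1 := sum_le_prod_primesBelow (G := rankinFn Δ n D δ) (rankinFn_nonneg Δ n D δ)
    (rankinFn_one Δ n D δ) (rankinFn_mul Δ n D δ) (E := E) ?_ x
  swap
  · intro p hp M
    rw [hE]
    dsimp only
    split_ifs with hpN
    · refine sum_rankinFn_prime_pow_le hΔ D hδ hp (fun i hi => ?_) M
      rw [← hp.pow_dvd_iff_le_factorization hN0, ← hdvdN]
      push_cast
      exact hi.mul_left _
    · exact sum_rankinFn_prime_pow_le_of_not_dvd hΔ hδ hδ_le hp hD
        (fun h => hpN ((hdvdN p).1 h)) M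
  refine h1.trans ?_
  rw [← prod_filter_mul_prod_filter_not x.primesBelow (· ∣ N), mul_right_comm]
  refine mul_le_mul ?_ ?_ (prod_nonneg fun p hp => ?_) (by positivity)
  · refine le_trans ?_ (hprod N hN0)
    have hcongr : ∏ p ∈ x.primesBelow with p ∣ N, E p =
        ∏ p ∈ x.primesBelow with p ∣ N, 14 * L * ((N.factorization p : ℝ) + 1) :=
      prod_congr rfl fun p hp => if_pos (mem_filter.1 hp).2
    rw [hcongr]
    refine prod_le_prod_of_subset_of_one_le (fun p hp => ?_) (fun p _ => by positivity)
      fun p _ _ => one_le_mul_of_one_le_of_one_le (by linarith)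
        (le_add_of_nonneg_left (Nat.cast_nonneg _))
    rw [mem_filter, Nat.mem_primesBelow] at hp
    exact Nat.mem_primeFactors.2 ⟨hp.1.2, hp.2, hN0⟩
  · have hcongr : ∏ p ∈ x.primesBelow with ¬ p ∣ N, E p =
        ∏ p ∈ x.primesBelow with ¬ p ∣ N, (1 + 17 * L * (p : ℝ) ^ (-(1 + 2 * δ))) :=
      prod_congr rfl fun p hp => if_neg (mem_filter.1 hp).2
    rw [hcongr]
    calc _ ≤ ∏ p ∈ x.primesBelow with ¬ p ∣ N, Real.exp (17 * L * (p : ℝ) ^ (-(1 + 2 * δ))) :=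
          prod_le_prod (fun p _ => by positivity) fun p _ => by
            rw [add_comm]; exact Real.add_one_le_exp _
      _ = Real.exp (17 * L * ∑ p ∈ x.primesBelow with ¬ p ∣ N, (p : ℝ) ^ (-(1 + 2 * δ))) := by
          rw [← Real.exp_sum, mul_sum]
      _ ≤ _ := by
          refine Real.exp_le_exp.2 (mul_le_mul_of_nonneg_left ?_ (by positivity))
          exact hsum.sum_le_tsum _ fun m _ => by positivity
  · rw [hE]
    dsimp only
    split_ifs <;> positivity

/-- A Dirichlet convolution summed over a dyadic range, grouped by the first factor. -/
lemma sum_Ico_convolution (f g : ArithmeticFunction ℝ) (H : ℕ) :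
    ∑ q ∈ Ico H (2 * H), (f * g) q = ∑ d ∈ Ico 1 (2 * H),
      f d * ∑ m ∈ range (2 * H) with H ≤ d * m ∧ d * m < 2 * H, g m := by
  simp_rw [mul_sum, sum_sigma']
  simp_rw [ArithmeticFunction.mul_apply]
  rw [sum_sigma']
  refine sum_bij' (fun x _ => ⟨x.2.1, x.2.2⟩) (fun y _ => ⟨y.1 * y.2, (y.1, y.2)⟩) ?_ ?_ ?_ ?_ ?_
  · rintro ⟨q, a, b⟩ h
    simp only [mem_sigma, mem_Ico, Nat.mem_divisorsAntidiagonal, mem_filter, mem_range] at h ⊢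
    obtain ⟨⟨h1, h2⟩, rfl, h3⟩ := h
    have ha : 0 < a := Nat.pos_of_ne_zero (left_ne_zero_of_mul h3)
    have hb : 0 < b := Nat.pos_of_ne_zero (right_ne_zero_of_mul h3)
    exact ⟨⟨ha, (Nat.le_mul_of_pos_right a hb).trans_lt h2⟩,
      (Nat.le_mul_of_pos_left b ha).trans_lt h2, h1, h2⟩
  · rintro ⟨d, m⟩ h
    simp only [mem_sigma, mem_Ico, Nat.mem_divisorsAntidiagonal, mem_filter, mem_range] at h ⊢
    exact ⟨h.2.2, trivial, by omega⟩
  · rintro ⟨q, a, b⟩ h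
    simp only [mem_sigma, Nat.mem_divisorsAntidiagonal] at h
    obtain ⟨-, rfl, -⟩ := h
    rfl
  · intros
    rfl
  · intros
    rfl

lemma exists_sq_mul_squarefree {D : ℤ} (hD : ¬ IsSquare D) :
    ∃ s D₀ : ℤ, D = s ^ 2 * D₀ ∧ Squarefree D₀ ∧ D₀ ≠ 1 ∧ |D₀| ≤ |D| := by
  have hD0 : D ≠ 0 := by
    rintro rfl
    exact hD IsSquare.zero
  obtain ⟨a, b, hab, ha⟩ := Nat.sq_mul_squarefree D.natAbs
  have hb : b ≠ 0 := by
    rintro rfl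
    exact hD0 (Int.natAbs_eq_zero.1 (by simpa using hab.symm))
  have hsign : D = (b : ℤ) ^ 2 * (D.sign * a) := by
    conv_lhs => rw [← Int.sign_mul_natAbs D, ← hab]
    push_cast
    ring
  refine ⟨b, D.sign * a, hsign, ?_, ?_, ?_⟩
  · rw [← Int.squarefree_natAbs, Int.natAbs_mul, Int.natAbs_sign_of_ne_zero hD0, one_mul,
      Int.natAbs_natCast]
    exact ha
  · intro h
    rw [h, mul_one] at hsign
    exact hD ⟨b, by rw [hsign, sq]⟩
  · rw [Int.abs_eq_natAbs, Int.abs_eq_natAbs, Int.natAbs_mul, Int.natAbs_sign_of_ne_zero hD0,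
      one_mul, Int.natAbs_natCast, ← hab]
    exact_mod_cast Nat.le_mul_of_pos_left a (by positivity)

/-- Rankin's trick for the convolution of a dyadic character sum with the correction factor. -/
lemma abs_sum_singFn_le {Δ n D : ℤ} {δ M R : ℝ} (hδ : 0 < δ)
    (hM : ∀ a X : ℕ, |∑ i ∈ range X, chi D (a + i)| ≤ M * √(X : ℝ)) {H : ℕ} (hH : 1 ≤ H)
    (hR : ∑ d ∈ Ico 1 (2 * H), rankinFn Δ n D δ d ≤ R) :
    |∑ q ∈ Ico H (2 * H), singFn Δ n q| ≤ M * R * (2 * H) ^ δ * (√(H : ℝ))⁻¹ := by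
  have hM0 : 0 ≤ M := by
    have := (abs_nonneg _).trans (hM 0 1)
    simpa using this
  rw [← corrFn_mul_chiFn Δ n D, sum_Ico_convolution]
  have hterm : ∀ d ∈ Ico 1 (2 * H), |corrFn Δ n D d *
      ∑ m ∈ range (2 * H) with H ≤ d * m ∧ d * m < 2 * H, chiFn D m| ≤
      M * (2 * H) ^ δ * (√(H : ℝ))⁻¹ * rankinFn Δ n D δ d := by
    intro d hd
    rw [mem_Ico] at hd
    have hd0 : (0 : ℝ) < d := by exact_mod_cast hd.1
    have hdH : (d : ℝ) ≤ 2 * H := by exact_mod_cast hd.2.le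
    rw [abs_mul]
    simp_rw [chiFn_apply]
    have h2 : |corrFn Δ n D d| * √(d : ℝ) = rankinFn Δ n D δ d * (d : ℝ) ^ δ := by
      have : (d : ℝ) ^ (-δ) * (d : ℝ) ^ δ = 1 := by
        rw [← Real.rpow_add hd0, neg_add_cancel, Real.rpow_zero]
      rw [rankinFn, mul_assoc, mul_assoc, this, mul_one]
    calc _ ≤ |corrFn Δ n D d| * (M * √((d : ℝ) / H)) :=
          mul_le_mul_of_nonneg_left (abs_sum_chi_div_le D M hM H d hH hd.1) (abs_nonneg _)
      _ = M * (√(H : ℝ))⁻¹ * (|corrFn Δ n D d| * √(d : ℝ)) := by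
          rw [Real.sqrt_div hd0.le]
          ring
      _ = M * (√(H : ℝ))⁻¹ * rankinFn Δ n D δ d * (d : ℝ) ^ δ := by rw [h2]; ring
      _ ≤ M * (√(H : ℝ))⁻¹ * rankinFn Δ n D δ d * (2 * H) ^ δ := by
          have := rankinFn_nonneg Δ n D δ d
          gcongr
      _ = _ := by ring
  calc _ ≤ ∑ d ∈ Ico 1 (2 * H), M * (2 * H) ^ δ * (√(H : ℝ))⁻¹ * rankinFn Δ n D δ d :=
        (abs_sum_le_sum_abs _ _).trans (sum_le_sum hterm)
    _ ≤ M * (2 * H) ^ δ * (√(H : ℝ))⁻¹ * R := by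
        rw [← mul_sum]
        exact mul_le_mul_of_nonneg_left hR (by positivity)
    _ = _ := by ring

lemma rpow_mul_sq_le {x y a : ℝ} (hy : 0 ≤ y) (hx : 1 ≤ x) {c : ℝ} (hc : 0 ≤ c) (ha : 0 ≤ a)
    (h : y ≤ c * x ^ 2) : y ^ a ≤ c ^ a * x ^ (2 * a) := by
  have hx0 : (0 : ℝ) ≤ x := by linarith
  calc y ^ a ≤ (c * x ^ 2) ^ a := Real.rpow_le_rpow hy h ha
    _ = c ^ a * x ^ (2 * a) := by
      rw [Real.mul_rpow hc (by positivity), ← Real.rpow_natCast, ← Real.rpow_mul hx0]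
      norm_num

end CharSum

open CharSum in
/-- Dyadic tail bound for the singular series in the case `Δ = AD − BC ≠ 0`:
for `n² − 4Δ` not a perfect square, `|Σ_{H ≤ q < 2H} 𝔖_q(n)| ≪_ε |n|^{3/8} H^{−1/2} (|n|H)^ε`. -/
theorem singSeries_dyadic_bound (A B C D : ℤ)
    (hgcd : Int.gcd A (Int.gcd B (Int.gcd C D)) = 1) (hΔ : A * D - B * C ≠ 0)
    (ε : ℝ) (hε : 0 < ε) :
    ∃ K : ℝ, 0 < K ∧ ∀ n : ℤ, n ≠ 0 → ¬ IsSquare (n ^ 2 - 4 * (A * D - B * C)) →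
      ∀ H : ℕ, 1 ≤ H →
        |∑ q ∈ Finset.Ico H (2 * H), singSeriesTerm A B C D q n| ≤
          K * ((|n| : ℤ) : ℝ) ^ ((3 : ℝ) / 8) * (H : ℝ) ^ (-(1 : ℝ) / 2) *
            (((|n| : ℤ) : ℝ) * (H : ℝ)) ^ ε := by
  set Δ := A * D - B * C with hΔdef
  set δ := min (ε / 4) (1 / 4) with hδdef
  have hδ : 0 < δ := lt_min (by linarith) (by norm_num)
  have hδε : 4 * δ ≤ ε := by linarith [min_le_left (ε / 4) (1 / 4)]
  obtain ⟨K₁, hK₁, hchi⟩ := exists_abs_sum_chi_le δ hδ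
  obtain ⟨K₂, hK₂, hrankin⟩ := exists_sum_rankinFn_le hΔ hδ (min_le_right _ _)
  have hΔ1 : (1 : ℝ) ≤ |(Δ : ℝ)| := by exact_mod_cast Int.one_le_abs hΔ
  set c : ℝ := 1 + 4 * |(Δ : ℝ)| with hc
  have hc0 : 0 < c := by positivity
  set a : ℝ := 3 / 16 + δ with ha
  refine ⟨K₁ * c ^ a * (K₂ * (2 * |(Δ : ℝ)| * c) ^ δ) * 2 ^ δ, by positivity,
    fun n hn hsq H hH => ?_⟩
  obtain ⟨s, D₀, hD, hfree, hne1, hle⟩ := exists_sq_mul_squarefree hsq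
  have hne : n ^ 2 - 4 * Δ ≠ 0 := fun h => hsq (h ▸ IsSquare.zero)
  have hH1 : (1 : ℝ) ≤ H := by exact_mod_cast hH
  have hH0 : (0 : ℝ) < H := by linarith
  set x : ℝ := ((|n| : ℤ) : ℝ) with hx
  have hx1 : 1 ≤ x := by rw [hx]; exact_mod_cast Int.one_le_abs hn
  have hx0 : 0 < x := by linarith
  have hdisc : |((n ^ 2 - 4 * Δ : ℤ) : ℝ)| ≤ c * x ^ 2 := by
    have h1 : x ^ 2 = (n : ℝ) ^ 2 := by rw [hx, Int.cast_abs, sq_abs]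
    have h2 : 1 ≤ x ^ 2 := one_le_pow₀ hx1
    push_cast
    calc |(n : ℝ) ^ 2 - 4 * (Δ : ℝ)| ≤ |(n : ℝ) ^ 2| + |4 * (Δ : ℝ)| := abs_sub _ _
      _ = x ^ 2 + 4 * |(Δ : ℝ)| := by rw [abs_mul, h1, abs_sq]; norm_num
      _ ≤ c * x ^ 2 := by nlinarith
  have hcond : ((|D₀| : ℤ) : ℝ) ^ a ≤ c ^ a * x ^ (2 * a) := by
    refine rpow_mul_sq_le (by exact_mod_cast abs_nonneg D₀) hx1 hc0.le (by positivity) ?_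
    refine le_trans ?_ hdisc
    exact_mod_cast hle
  have hbad : ((2 * Δ * (n ^ 2 - 4 * Δ)).natAbs : ℝ) ^ δ ≤
      (2 * |(Δ : ℝ)| * c) ^ δ * x ^ (2 * δ) := by
    refine rpow_mul_sq_le (Nat.cast_nonneg _) hx1 (by positivity) hδ.le ?_
    rw [Nat.cast_natAbs, Int.cast_abs, Int.cast_mul, abs_mul, mul_assoc (2 * |(Δ : ℝ)|)]
    refine mul_le_mul ?_ hdisc (abs_nonneg _) (by positivity)
    push_cast
    rw [abs_mul]
    norm_num
  have hmain := abs_sum_singFn_le hδ (hchi D₀ hfree hne1) hH (hrankin n s D₀ hD hne (2 * H))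
  have hterm : ∑ q ∈ Finset.Ico H (2 * H), singSeriesTerm A B C D q n =
      ∑ q ∈ Finset.Ico H (2 * H), singFn Δ n q :=
    Finset.sum_congr rfl fun q hq => singSeriesTerm_eq_singFn A B C D hgcd hΔ n
      (by have := (Finset.mem_Ico.1 hq).1; omega)
  have hsqrt : (√(H : ℝ))⁻¹ = (H : ℝ) ^ (-(1 : ℝ) / 2) := by
    rw [Real.sqrt_eq_rpow, ← Real.rpow_neg hH0.le]
    norm_num
  rw [hterm]
  calc _ ≤ K₁ * ((|D₀| : ℤ) : ℝ) ^ a *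
        (K₂ * ((2 * Δ * (n ^ 2 - 4 * Δ)).natAbs : ℝ) ^ δ) * (2 * H) ^ δ * (√(H : ℝ))⁻¹ := hmain
    _ ≤ K₁ * (c ^ a * x ^ (2 * a)) * (K₂ * ((2 * |(Δ : ℝ)| * c) ^ δ * x ^ (2 * δ))) *
        (2 * H) ^ δ * (√(H : ℝ))⁻¹ := by gcongr
    _ = K₁ * c ^ a * (K₂ * (2 * |(Δ : ℝ)| * c) ^ δ) * 2 ^ δ * x ^ ((3 : ℝ) / 8) *
        (H : ℝ) ^ (-(1 : ℝ) / 2) * (x ^ (4 * δ) * (H : ℝ) ^ δ) := by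
      rw [Real.mul_rpow zero_le_two hH0.le, hsqrt,
        show 2 * a = 3 / 8 + 2 * δ by rw [ha]; ring, show 4 * δ = 2 * δ + 2 * δ by ring,
        Real.rpow_add hx0, Real.rpow_add hx0]
      ring
    _ ≤ _ := by
      rw [Real.mul_rpow hx0.le hH0.le]
      gcongr
      linarith
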